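/- Let n ≥ 3, p = (n+2)/(n-2), and suppose λ, λ' > 1, h, h' ∈ ℝ, k ≥ 0. Let v_λ and v_{λ'} be traveling-wave profiles with parameters λ and λ' respectively (as defined in the context), and let ξ_k(τ) = 1/(1 − k e^{((p−1)/p)τ}). Then there exist q > 0, τ₀ < 0 and a positive function u : ℝ × (−∞, τ₀] → ℝ, twice continuously differentiable in x and once in τ, which solves the pressure equation p ∂_τ u = u ∂_{xx} u − (p/(p−1)) (∂_x u)² + (p−1)(u² − u) on ℝ × (−∞, τ₀], and which satisfies for all x ∈ ℝ and τ ≤ τ₀ the sandwich bound max( v_λ(x − λτ + h), ξ_k(τ), v_{λ'}(−x − λ'τ + h') ) ≤ u(x,τ) ≤ v_λ(x − λτ(1 − q e^{((p−1)/p)τ}) + h) + v_{λ'}(−x − λ'τ(1 − q e^{((p−1)/p)τ}) + h') + ξ_k(τ) − 2. -/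

import Mathlib

open Filter Asymptotics

/-- The exponent `γ_λ = (λp − √(λ²p² − 4(p−1)))/2`. -/
noncomputable def gammaExp (p lam : ℝ) : ℝ :=
  (lam * p - Real.sqrt (lam ^ 2 * p ^ 2 - 4 * (p - 1))) / 2

/-- A traveling-wave profile with parameter `λ > 1`: a C², strictly decreasing solution of
`v v'' − (p/(p−1))(v')² + λp v' + (p−1)(v² − v) = 0` with two-sided exponential bounds
at `−∞` (for `v`, `−v'`, `v''`) and the asymptotics
`v = 1 + C e^{−γ_λ y} + o(e^{−γ_λ y})`, `v' = −γ_λ C e^{−γ_λ y} + o`,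
`v'' = γ_λ² C e^{−γ_λ y} + o` as `y → +∞`. -/
def IsTravelingWaveProfile (p lam : ℝ) (v : ℝ → ℝ) : Prop :=
  ContDiff ℝ 2 v ∧ StrictAnti v ∧
  (∀ y : ℝ,
    v y * deriv (deriv v) y - p / (p - 1) * (deriv v y) ^ 2
      + lam * p * deriv v y + (p - 1) * ((v y) ^ 2 - v y) = 0) ∧
  (∃ c₁ c₂ : ℝ, 0 < c₁ ∧ c₁ ≤ c₂ ∧ ∀ y : ℝ, y ≤ 0 →
    (c₁ * Real.exp (-(p - 1) * y) ≤ v y ∧ v y ≤ c₂ * Real.exp (-(p - 1) * y)) ∧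
    (c₁ * Real.exp (-(p - 1) * y) ≤ -deriv v y ∧
      -deriv v y ≤ c₂ * Real.exp (-(p - 1) * y)) ∧
    (c₁ * Real.exp (-(p - 1) * y) ≤ deriv (deriv v) y ∧
      deriv (deriv v) y ≤ c₂ * Real.exp (-(p - 1) * y))) ∧
  (∃ C : ℝ, 0 < C ∧
    ((fun y => v y - 1 - C * Real.exp (-gammaExp p lam * y)) =o[atTop]
      fun y => Real.exp (-gammaExp p lam * y)) ∧
    ((fun y => deriv v y + gammaExp p lam * C * Real.exp (-gammaExp p lam * y)) =o[atTop]
      fun y => Real.exp (-gammaExp p lam * y)) ∧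
    ((fun y => deriv (deriv v) y
        - gammaExp p lam ^ 2 * C * Real.exp (-gammaExp p lam * y)) =o[atTop]
      fun y => Real.exp (-gammaExp p lam * y)))

section
/-! ### Second derivative test and discrete maximum principle -/

lemma snd_deriv_nonpos_of_max {f f1 : ℝ → ℝ} {f2 x a b : ℝ} (hx : x ∈ Set.Ioo a b)
    (h1 : ∀ z ∈ Set.Ioo a b, HasDerivAt f (f1 z) z) (h2 : HasDerivAt f1 f2 x)
    (hmax : ∀ z ∈ Set.Ioo a b, f z ≤ f x) : f1 x = 0 ∧ f2 ≤ 0 := by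
  have hnhds : Set.Ioo a b ∈ nhds x := Ioo_mem_nhds hx.1 hx.2
  have hloc : IsLocalMax f x := by
    filter_upwards [hnhds] with z hz using hmax z hz
  have h0 : f1 x = 0 := hloc.hasDerivAt_eq_zero (h1 x hx)
  refine ⟨h0, ?_⟩
  by_contra hpos
  push Not at hpos
  have hev : deriv f =ᶠ[nhds x] f1 := by
    filter_upwards [hnhds] with z hz using (h1 z hz).deriv
  have hdd : deriv (deriv f) x = f2 := by
    rw [hev.deriv_eq]; exact h2.deriv
  have hmin : IsLocalMin f x := by
    apply isLocalMin_of_deriv_deriv_pos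
    · rw [hdd]; exact hpos
    · rw [(h1 x hx).deriv, h0]
    · exact (h1 x hx).continuousAt
  have hconst : f =ᶠ[nhds x] fun _ => f x := by
    filter_upwards [hloc, hmin] with z hz1 hz2 using le_antisymm hz1 hz2
  have h3 : f1 =ᶠ[nhds x] fun _ => 0 := by
    have : deriv f =ᶠ[nhds x] deriv (fun _ => f x) := hconst.deriv
    filter_upwards [this, hev] with z hz hz2
    rw [← hz2, hz]; simp
  have : f2 = 0 := by
    rw [← h2.deriv, h3.deriv_eq]; simp
  linarith

lemma exists_max_family (J : ℕ) (P : ℕ → ℝ → ℝ) (ρ : ℝ) (hρ : 0 < ρ)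
    (hc : ∀ j ≤ J, ContinuousOn (P j) (Set.Icc (-ρ) ρ)) :
    ∃ j0 ≤ J, ∃ x0 ∈ Set.Icc (-ρ) ρ, ∀ j ≤ J, ∀ x ∈ Set.Icc (-ρ) ρ, P j x ≤ P j0 x0 := by
  have hne : (Set.Icc (-ρ) ρ).Nonempty := ⟨0, by constructor <;> linarith⟩
  have hex : ∀ j, ∃ x0 ∈ Set.Icc (-ρ) ρ, j ≤ J → ∀ x ∈ Set.Icc (-ρ) ρ, P j x ≤ P j x0 := by
    intro j
    by_cases hj : j ≤ J
    · obtain ⟨x0, hx0, h⟩ := isCompact_Icc.exists_isMaxOn hne (hc j hj)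
      exact ⟨x0, hx0, fun _ x hx => h hx⟩
    · exact ⟨0, by constructor <;> linarith, fun h => absurd h hj⟩
  choose X hX hXmax using hex
  obtain ⟨j0, hj0, hmax⟩ := Finset.exists_max_image (Finset.range (J+1)) (fun j => P j (X j))
    ⟨0, by simp⟩
  refine ⟨j0, by simpa [Nat.lt_succ_iff] using hj0, X j0, hX j0, fun j hj x hx => ?_⟩
  exact (hXmax j hj x hx).trans (hmax j (by simpa [Nat.lt_succ_iff] using hj))

lemma discrete_max_principle (J : ℕ) (P P1 P2 : ℕ → ℝ → ℝ) (ρ B : ℝ) (hρ : 0 < ρ)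
    (hc : ∀ j ≤ J, ContinuousOn (P j) (Set.Icc (-ρ) ρ))
    (h1 : ∀ j ≤ J, ∀ x ∈ Set.Ioo (-ρ) ρ, HasDerivAt (P j) (P1 j x) x)
    (h2 : ∀ j ≤ J, ∀ x ∈ Set.Ioo (-ρ) ρ, HasDerivAt (P1 j) (P2 j x) x)
    (hstart0 : ∀ x ∈ Set.Icc (-ρ) ρ, P 0 x ≤ B)
    (hbd : ∀ j ≤ J, P j (-ρ) ≤ B ∧ P j ρ ≤ B)
    (hinter : ∀ j, j + 1 ≤ J → ∀ x ∈ Set.Ioo (-ρ) ρ, P1 (j+1) x = 0 → P2 (j+1) x ≤ 0 →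
      P j x ≤ P (j+1) x → P (j+1) x ≤ B) :
    ∀ j ≤ J, ∀ x ∈ Set.Icc (-ρ) ρ, P j x ≤ B := by
  obtain ⟨j0, hj0, x0, hx0, hmax⟩ := exists_max_family J P ρ hρ hc
  suffices h : P j0 x0 ≤ B from fun j hj x hx => (hmax j hj x hx).trans h
  rcases Nat.eq_zero_or_pos j0 with h0 | h0
  · subst h0; exact hstart0 x0 hx0
  obtain ⟨j, rfl⟩ : ∃ j, j0 = j + 1 := ⟨j0 - 1, by omega⟩
  rcases eq_or_lt_of_le hx0.1 with hl | hl
  · rw [← hl]; exact (hbd _ hj0).1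
  rcases eq_or_lt_of_le hx0.2 with hr | hr
  · rw [hr]; exact (hbd _ hj0).2
  have hx : x0 ∈ Set.Ioo (-ρ) ρ := ⟨hl, hr⟩
  obtain ⟨ha, hb⟩ := snd_deriv_nonpos_of_max hx (h1 _ hj0) (h2 _ hj0 x0 hx)
    (fun z hz => hmax _ hj0 z (Set.Ioo_subset_Icc_self hz))
  exact hinter j hj0 x0 hx ha hb (hmax j (by omega) x0 hx0)

/-! ### Pointwise algebra of the Bernstein estimates -/

lemma sq_le_sq_of_abs_le {a b : ℝ} (h : |a| ≤ b) : a ^ 2 ≤ b ^ 2 :=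
  sq_le_sq' (by linarith [abs_le.1 h]) (abs_le.1 h).2

lemma cut_aux1 {e1 : ℝ} (h : |e1| ≤ 2) : e1 ^ 2 ≤ 4 := by
  have := sq_le_sq_of_abs_le h; linarith

lemma cut_aux2 {e e2 : ℝ} (he0 : 0 ≤ e) (he : e ≤ 1) (h : |e2| ≤ 2) : -(e * e2) ≤ 2 := by
  have := abs_le.1 h
  nlinarith

lemma young_aux {G S y : ℝ} : 2 * (G * S * |y|) ≤ y ^ 2 / 2 + 2 * G ^ 2 * S ^ 2 := by
  have := sq_nonneg (|y| - 2 * (G * S))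
  have h := sq_abs y
  nlinarith

lemma bern_alg_one {κ c m u uh y y1 y2 yh e e1 e2 K M M1 : ℝ} (hκ : 0 < κ)
    (hc : c = (m + 1) / m) (hm : 0 < m)
    (hu : 1 ≤ u) (huM : u ≤ M) (he0 : 0 ≤ e) (he : e ≤ 1) (he1 : |e1| ≤ 2) (he2 : |e2| ≤ 2)
    (hM1 : e * |y| ≤ M1)
    (hK : K = m * (36 * M + 4 * m * M + 8 * c * M1 + 1) )
    (hP1 : 2 * e * e1 * y ^ 2 + 2 * e ^ 2 * y * y1 - K * y = 0)
    (hP2 : 2 * e1 ^ 2 * y ^ 2 + 2 * e * e2 * y ^ 2 + 8 * e * e1 * y * y1 + 2 * e ^ 2 * y1 ^ 2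
      + 2 * e ^ 2 * y * y2 - K * y1 ≤ 0)
    (hP : e ^ 2 * yh ^ 2 - K * uh ≤ e ^ 2 * y ^ 2 - K * u)
    (hy : κ * (y - yh) = u * y2 + (1 - 2 * c) * y * y1 + m * (2 * u - 1) * y)
    (huu : κ * (u - uh) = u * y1 - c * y ^ 2 + m * (u ^ 2 - u)) :
    e ^ 2 * y ^ 2 - K * u ≤ 0 := by
  have hM1' : 0 ≤ M1 := le_trans (mul_nonneg he0 (abs_nonneg _)) hM1
  have hc1 : 1 < c := by rw [hc, lt_div_iff₀ hm]; linarith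
  have hcm : (c - 1) * m = 1 := by rw [hc]; field_simp; ring
  have hM0 : 0 ≤ M := by linarith
  have hKpos : 0 < K := by rw [hK]; positivity
  by_contra hneg
  push Not at hneg
  have hy0 : y ≠ 0 := by
    rintro rfl
    have : 0 < K * u := by positivity
    linarith
  have hy2 : 0 < y ^ 2 := by positivity
  -- from `P1 = 0`
  have hkey : e ^ 2 * y1 = K / 2 - e * e1 * y := by
    have : y * (2 * (e ^ 2 * y1) - (K - 2 * (e * e1 * y))) = 0 := by linarith
    rcases mul_eq_zero.1 this with h | h
    · exact absurd h hy0
    · linarith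
  -- time difference
  have htime : 0 ≤ 2 * e ^ 2 * y * (κ * (y - yh)) - K * (κ * (u - uh)) := by
    have h1 : 0 ≤ κ * ((e ^ 2 * y ^ 2 - K * u) - (e ^ 2 * yh ^ 2 - K * uh)) :=
      mul_nonneg hκ.le (by linarith)
    have h2 : 0 ≤ κ * (e ^ 2 * (y - yh) ^ 2) := by positivity
    linarith
  rw [hy, huu] at htime
  have hu0 : 0 < u := by linarith
  have h3 : u * (2 * e1 ^ 2 * y ^ 2 + 2 * e * e2 * y ^ 2 + 8 * e * e1 * y * y1 + 2 * e ^ 2 * y1 ^ 2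
      + 2 * e ^ 2 * y * y2 - K * y1) ≤ 0 := mul_nonpos_of_nonneg_of_nonpos hu0.le hP2
  have h4 : 0 ≤ u * (2 * (e * y1 + 2 * e1 * y) ^ 2) := by positivity
  -- combine
  have h5 : 2 * (1 - 2 * c) * y ^ 2 * (e ^ 2 * y1) =
      2 * (1 - 2 * c) * y ^ 2 * (K / 2 - e * e1 * y) := by rw [hkey]
  have h6 : (c - 1) * K * y ^ 2 ≤ u * (6 * e1 ^ 2 - 2 * e * e2) * y ^ 2
      + 2 * (2 * c - 1) * e * e1 * y ^ 3 + 2 * m * e ^ 2 * (2 * u - 1) * y ^ 2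
      - K * m * (u ^ 2 - u) := by
    linarith
  have h7 : 0 ≤ K * m * (u ^ 2 - u) := by
    have : 0 ≤ u ^ 2 - u := by nlinarith
    positivity
  have he1' : e1 ^ 2 ≤ 4 := cut_aux1 he1
  have hee2 : -(e * e2) ≤ 2 := cut_aux2 he0 he he2
  have he1y : e * e1 * y ≤ 2 * M1 := by
    calc e * e1 * y ≤ |e * e1 * y| := le_abs_self _
      _ = |e1| * (e * |y|) := by rw [abs_mul, abs_mul, abs_of_nonneg he0]; ring
      _ ≤ 2 * M1 := mul_le_mul he1 hM1 (by positivity) (by norm_num)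
  have hee : e ^ 2 ≤ 1 := pow_le_one₀ he0 he
  have a1 : u * (6 * e1 ^ 2 - 2 * e * e2) ≤ 28 * M := by
    have : u * (6 * e1 ^ 2 - 2 * e * e2) ≤ u * 28 :=
      mul_le_mul_of_nonneg_left (by linarith) hu0.le
    linarith
  have a2 : 2 * (2 * c - 1) * (e * e1 * y) ≤ 8 * c * M1 := by
    have : 2 * (2 * c - 1) * (e * e1 * y) ≤ 2 * (2 * c - 1) * (2 * M1) :=
      mul_le_mul_of_nonneg_left he1y (by linarith)
    linarith
  have a3 : 2 * m * (e ^ 2 * (2 * u - 1)) ≤ 4 * m * M := by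
    have : e ^ 2 * (2 * u - 1) ≤ 1 * (2 * u - 1) :=
      mul_le_mul_of_nonneg_right hee (by linarith)
    have : 2 * m * (e ^ 2 * (2 * u - 1)) ≤ 2 * m * (2 * M) :=
      mul_le_mul_of_nonneg_left (by linarith) (by linarith)
    linarith
  have hcK : (c - 1) * K = 36 * M + 4 * m * M + 8 * c * M1 + 1 := by
    rw [hK, ← mul_assoc, hcm, one_mul]
  have b : (c - 1) * K * y ^ 2 ≤ (28 * M + 8 * c * M1 + 4 * m * M) * y ^ 2 := by
    have : (u * (6 * e1 ^ 2 - 2 * e * e2) + 2 * (2 * c - 1) * (e * e1 * y)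
        + 2 * m * (e ^ 2 * (2 * u - 1))) * y ^ 2 ≤ (28 * M + 8 * c * M1 + 4 * m * M) * y ^ 2 :=
      mul_le_mul_of_nonneg_right (by linarith) hy2.le
    linarith
  rw [hcK] at b
  have : 36 * M + 4 * m * M + 8 * c * M1 + 1 ≤ 28 * M + 8 * c * M1 + 4 * m * M :=
    le_of_mul_le_mul_right b hy2
  linarith

lemma bern_alg_two {κ u y y1 y2 yh g gh β r s e e1 e2 K M b L G S : ℝ} (hκ : 0 < κ)
    (hu : 1 ≤ u) (huM : u ≤ M) (he0 : 0 ≤ e) (he : e ≤ 1) (he1 : |e1| ≤ 2) (he2 : |e2| ≤ 2)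
    (hβ : |β| ≤ b) (hL0 : 0 ≤ L) (hr : 2 * e ^ 2 * y * r ≤ L * y ^ 2 + L)
    (hg : |g| ≤ G) (hS : 0 ≤ S) (hs : |s| ≤ S * (1 + |y|))
    (hK : K = 2 * (68 * M + b ^ 2 + L))
    (hP2 : 2 * e1 ^ 2 * y ^ 2 + 2 * e * e2 * y ^ 2 + 8 * e * e1 * y * y1 + 2 * e ^ 2 * y1 ^ 2
      + 2 * e ^ 2 * y * y2 + 2 * K * y ^ 2 + 2 * K * g * y1 ≤ 0)
    (hP : e ^ 2 * yh ^ 2 + K * gh ^ 2 ≤ e ^ 2 * y ^ 2 + K * g ^ 2)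
    (hy : κ * (y - yh) = u * y2 + β * y1 + r)
    (hgg : κ * (g - gh) = u * y1 + s) :
    e ^ 2 * y ^ 2 + K * g ^ 2 ≤ 1 + 2 * G * S + 2 * G ^ 2 * S ^ 2 + K * G ^ 2 := by
  have hM0 : 0 ≤ M := by linarith
  have hu0 : 0 < u := by linarith
  have hG0 : 0 ≤ G := (abs_nonneg _).trans hg
  have hKpos : 0 < K := by rw [hK]; linarith [sq_nonneg b]
  have hee : e ^ 2 ≤ 1 := pow_le_one₀ he0 he
  have he1' : e1 ^ 2 ≤ 4 := cut_aux1 he1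
  have hee2 : -(e * e2) ≤ 2 := cut_aux2 he0 he he2
  have htime : 0 ≤ 2 * e ^ 2 * y * (κ * (y - yh)) + 2 * K * g * (κ * (g - gh)) := by
    have h1 : 0 ≤ κ * ((e ^ 2 * y ^ 2 + K * g ^ 2) - (e ^ 2 * yh ^ 2 + K * gh ^ 2)) :=
      mul_nonneg hκ.le (by linarith)
    have h2 : 0 ≤ κ * (e ^ 2 * (y - yh) ^ 2) := by positivity
    have h3 : 0 ≤ κ * (K * (g - gh) ^ 2) := by positivity
    linarith
  rw [hy, hgg] at htime
  have h3 := mul_nonpos_of_nonneg_of_nonpos hu0.le hP2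
  have h4 : 0 ≤ u * (e * y1 + 4 * e1 * y) ^ 2 := by positivity
  have h5 : 2 * e ^ 2 * y * β * y1 ≤ u * (e ^ 2 * y1 ^ 2) + b ^ 2 * y ^ 2 := by
    have q1 : 0 ≤ e ^ 2 * (y1 - β * y) ^ 2 := by positivity
    have q2 : 1 * (e ^ 2 * y1 ^ 2) ≤ u * (e ^ 2 * y1 ^ 2) :=
      mul_le_mul_of_nonneg_right hu (by positivity)
    have q3 : e ^ 2 * (β ^ 2 * y ^ 2) ≤ 1 * (b ^ 2 * y ^ 2) := by
      apply mul_le_mul hee _ (by positivity) (by norm_num)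
      apply mul_le_mul_of_nonneg_right _ (sq_nonneg y)
      exact sq_le_sq' (by linarith [abs_le.1 hβ]) (abs_le.1 hβ).2
    linarith
  have h6 : 2 * K * g * s ≤ K * (2 * G * S) + K * (y ^ 2 / 2 + 2 * G ^ 2 * S ^ 2) := by
    have q1 : g * s ≤ G * (S * (1 + |y|)) := by
      calc g * s ≤ |g * s| := le_abs_self _
        _ = |g| * |s| := abs_mul _ _
        _ ≤ _ := mul_le_mul hg hs (abs_nonneg _) hG0
    have q2 : 2 * (G * S * |y|) ≤ y ^ 2 / 2 + 2 * G ^ 2 * S ^ 2 := young_aux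
    have q3 : 2 * (g * s) ≤ 2 * G * S + (y ^ 2 / 2 + 2 * G ^ 2 * S ^ 2) := by linarith
    have := mul_le_mul_of_nonneg_left q3 hKpos.le
    linarith
  have h7 : u * (2 * K * y ^ 2) ≤ u * (14 * e1 ^ 2 - 2 * e * e2) * y ^ 2 + b ^ 2 * y ^ 2
      + 2 * e ^ 2 * y * r + 2 * K * g * s := by
    linarith
  have h8 : u * (14 * e1 ^ 2 - 2 * e * e2) * y ^ 2 ≤ 68 * M * y ^ 2 := by
    apply mul_le_mul_of_nonneg_right _ (sq_nonneg y)
    have : u * (14 * e1 ^ 2 - 2 * e * e2) ≤ u * 68 :=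
      mul_le_mul_of_nonneg_left (by linarith) hu0.le
    linarith
  have h9 : 1 * (2 * K * y ^ 2) ≤ u * (2 * K * y ^ 2) :=
    mul_le_mul_of_nonneg_right hu (by positivity)
  have hLK : L ≤ K := by rw [hK]; linarith [sq_nonneg b]
  have h10 : 2 * K * y ^ 2 ≤ (68 * M + b ^ 2 + L) * y ^ 2 + K + K * (2 * G * S)
      + K * (y ^ 2 / 2 + 2 * G ^ 2 * S ^ 2) := by
    linarith
  have hK2 : 68 * M + b ^ 2 + L = K / 2 := by linarith
  rw [hK2] at h10
  have h11 : K * y ^ 2 ≤ K * (1 + 2 * G * S + 2 * G ^ 2 * S ^ 2) := by linarith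
  have h12 := le_of_mul_le_mul_left h11 hKpos
  have h13 : e ^ 2 * y ^ 2 ≤ 1 * y ^ 2 := mul_le_mul_of_nonneg_right hee (sq_nonneg y)
  have h14 : K * g ^ 2 ≤ K * G ^ 2 := by
    apply mul_le_mul_of_nonneg_left _ hKpos.le
    exact sq_le_sq' (by linarith [abs_le.1 hg]) (abs_le.1 hg).2
  linarith

end

section
set_option linter.unusedSimpArgs false

/-- The spatial operator of the pressure equation. -/
noncomputable def NN (p u u1 u2 : ℝ) : ℝ :=
  u * u2 - p / (p - 1) * u1 ^ 2 + (p - 1) * (u ^ 2 - u)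

/-- A family of functions solving the implicit Euler scheme; `D i j` is the `i`-th spatial
derivative at time step `j`. -/
structure RotheFam (p κ R : ℝ) (J : ℕ) (D : ℕ → ℕ → ℝ → ℝ) : Prop where
  der : ∀ i, i < 5 → ∀ j ≤ J, ∀ x ∈ Set.Ioo (-R) R, HasDerivAt (D i j) (D (i+1) j x) x
  eqn : ∀ j, j + 1 ≤ J → ∀ x ∈ Set.Ioo (-R) R,
    κ * (D 0 (j+1) x - D 0 j x) = NN p (D 0 (j+1) x) (D 1 (j+1) x) (D 2 (j+1) x)

/-- Spatial cut-off. -/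
noncomputable def eta (ρ x : ℝ) : ℝ := 1 - x ^ 2 / ρ ^ 2
noncomputable def eta1 (ρ x : ℝ) : ℝ := - (2 * x / ρ ^ 2)
noncomputable def eta2 (ρ : ℝ) : ℝ := - (2 / ρ ^ 2)

lemma eta_hasDerivAt (ρ x : ℝ) : HasDerivAt (eta ρ) (eta1 ρ x) x := by
  have h := ((hasDerivAt_pow 2 x).div_const (ρ ^ 2)).const_sub 1
  exact h.congr_deriv (by unfold eta1; norm_num)

lemma eta1_hasDerivAt (ρ x : ℝ) : HasDerivAt (eta1 ρ) (eta2 ρ) x := by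
  have h := (((hasDerivAt_id x).const_mul 2).div_const (ρ ^ 2)).neg
  exact h.congr_deriv (by unfold eta2; norm_num)

lemma eta_bounds {ρ x : ℝ} (hρ : 1 ≤ ρ) (hx : x ∈ Set.Icc (-ρ) ρ) :
    0 ≤ eta ρ x ∧ eta ρ x ≤ 1 ∧ |eta1 ρ x| ≤ 2 ∧ |eta2 ρ| ≤ 2 := by
  have hρ0 : 0 < ρ ^ 2 := by positivity
  have hx2 : x ^ 2 ≤ ρ ^ 2 := sq_le_sq' hx.1 hx.2
  have hρ1 : 1 ≤ ρ ^ 2 := by nlinarith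
  have hρρ : ρ ≤ ρ ^ 2 := by nlinarith
  unfold eta eta1 eta2
  refine ⟨?_, ?_, ?_, ?_⟩
  · rw [sub_nonneg, div_le_one hρ0]; exact hx2
  · have : 0 ≤ x ^ 2 / ρ ^ 2 := by positivity
    linarith
  · rw [abs_neg, abs_div, abs_of_pos hρ0, div_le_iff₀ hρ0, abs_mul, abs_two]
    have : |x| ≤ ρ := abs_le.2 hx
    linarith
  · rw [abs_neg, abs_div, abs_of_pos hρ0, div_le_iff₀ hρ0, abs_two]
    linarith

lemma eta_half {ρ x : ℝ} (hρ : 1 ≤ ρ) (hx : |x| ≤ ρ / 2) : 1 / 2 ≤ eta ρ x := by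
  have hρ0 : 0 < ρ ^ 2 := by positivity
  have hx2 : x ^ 2 ≤ (ρ / 2) ^ 2 := sq_le_sq_of_abs_le hx
  unfold eta
  have : x ^ 2 / ρ ^ 2 ≤ 1 / 2 := by
    rw [div_le_iff₀ hρ0]; nlinarith
  linarith

lemma eta_end (ρ : ℝ) (hρ : 1 ≤ ρ) : eta ρ ρ = 0 ∧ eta ρ (-ρ) = 0 := by
  have hρ0 : ρ ^ 2 ≠ 0 := by positivity
  unfold eta
  constructor
  · rw [div_self hρ0]; ring
  · rw [neg_sq, div_self hρ0]; ring

lemma eta_continuous (ρ : ℝ) : Continuous (eta ρ) := by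
  unfold eta; fun_prop

namespace RotheFam

variable {p κ R : ℝ} {J : ℕ} {D : ℕ → ℕ → ℝ → ℝ}

lemma eq1 (H : RotheFam p κ R J D) : ∀ j, j + 1 ≤ J → ∀ x ∈ Set.Ioo (-R) R,
    κ * (D 1 (j+1) x - D 1 j x) = D 0 (j+1) x * D 3 (j+1) x
      + (1 - 2 * (p / (p - 1))) * D 1 (j+1) x * D 2 (j+1) x
      + (p - 1) * (2 * D 0 (j+1) x - 1) * D 1 (j+1) x := by
  intro j hj x hx
  have d := fun i (hi : i < 5) => H.der i hi (j+1) hj x hx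
  have e0 := H.der 0 (by norm_num) j (by omega) x hx
  have hl := ((d 0 (by norm_num)).sub e0).const_mul κ
  have hr := (((d 0 (by norm_num)).mul (d 2 (by norm_num))).sub
    (((d 1 (by norm_num)).pow 2).const_mul (p / (p - 1)))).add
    ((((d 0 (by norm_num)).pow 2).sub (d 0 (by norm_num))).const_mul (p - 1))
  have hu := hl.unique (hr.congr_of_eventuallyEq (by
    filter_upwards [Ioo_mem_nhds hx.1 hx.2] with z hz
    have := H.eqn j hj z hz
    try unfold NN at this
    exact this))
  simp only [zero_add, Nat.reduceAdd, Nat.reduceSub, pow_one, Nat.cast_ofNat] at hu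
  rw [hu]; ring

lemma eq2 (H : RotheFam p κ R J D) : ∀ j, j + 1 ≤ J → ∀ x ∈ Set.Ioo (-R) R,
    κ * (D 2 (j+1) x - D 2 j x) = D 0 (j+1) x * D 4 (j+1) x
      + (2 - 2 * (p / (p - 1))) * D 1 (j+1) x * D 3 (j+1) x
      + ((1 - 2 * (p / (p - 1))) * D 2 (j+1) x ^ 2
      + (p - 1) * ((2 * D 0 (j+1) x - 1) * D 2 (j+1) x + 2 * D 1 (j+1) x ^ 2)) := by
  intro j hj x hx
  have d := fun i (hi : i < 5) => H.der i hi (j+1) hj x hx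
  have e0 := H.der 1 (by norm_num) j (by omega) x hx
  have hl := ((d 1 (by norm_num)).sub e0).const_mul κ
  have hr := (((d 0 (by norm_num)).mul (d 3 (by norm_num))).add
    (((d 1 (by norm_num)).const_mul (1 - 2 * (p / (p - 1)))).mul (d 2 (by norm_num)))).add
    (((((d 0 (by norm_num)).const_mul 2).sub_const 1).const_mul (p - 1)).mul (d 1 (by norm_num)))
  have hu := hl.unique (hr.congr_of_eventuallyEq (by
    filter_upwards [Ioo_mem_nhds hx.1 hx.2] with z hz
    have := H.eq1 j hj z hz
    try unfold NN at this
    exact this))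
  simp only [zero_add, Nat.reduceAdd, Nat.reduceSub, pow_one, Nat.cast_ofNat] at hu
  rw [hu]; ring

lemma eq3 (H : RotheFam p κ R J D) : ∀ j, j + 1 ≤ J → ∀ x ∈ Set.Ioo (-R) R,
    κ * (D 3 (j+1) x - D 3 j x) = D 0 (j+1) x * D 5 (j+1) x
      + (3 - 2 * (p / (p - 1))) * D 1 (j+1) x * D 4 (j+1) x
      + ((4 - 6 * (p / (p - 1))) * D 2 (j+1) x * D 3 (j+1) x
      + (p - 1) * ((2 * D 0 (j+1) x - 1) * D 3 (j+1) x + 6 * D 1 (j+1) x * D 2 (j+1) x)) := by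
  intro j hj x hx
  have d := fun i (hi : i < 5) => H.der i hi (j+1) hj x hx
  have e0 := H.der 2 (by norm_num) j (by omega) x hx
  have hl := ((d 2 (by norm_num)).sub e0).const_mul κ
  have hr := (((d 0 (by norm_num)).mul (d 4 (by norm_num))).add
    (((d 1 (by norm_num)).const_mul (2 - 2 * (p / (p - 1)))).mul (d 3 (by norm_num)))).add
    ((((d 2 (by norm_num)).pow 2).const_mul (1 - 2 * (p / (p - 1)))).add
    (((((((d 0 (by norm_num)).const_mul 2).sub_const 1)).mul (d 2 (by norm_num))).add
      (((d 1 (by norm_num)).pow 2).const_mul 2)).const_mul (p - 1)))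
  have hu := hl.unique (hr.congr_of_eventuallyEq (by
    filter_upwards [Ioo_mem_nhds hx.1 hx.2] with z hz
    have := H.eq2 j hj z hz
    try unfold NN at this
    exact this))
  simp only [zero_add, Nat.reduceAdd, Nat.reduceSub, pow_one, Nat.cast_ofNat] at hu
  rw [hu]; ring

end RotheFam

end

section
namespace RotheFam

variable {p κ R : ℝ} {J : ℕ} {D : ℕ → ℕ → ℝ → ℝ}

lemma contOn (H : RotheFam p κ R J D) {ρ : ℝ} (hR : ρ < R) (i : ℕ) (hi : i < 5) (j : ℕ)
    (hj : j ≤ J) : ContinuousOn (D i j) (Set.Icc (-ρ) ρ) := fun x hx =>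
  (H.der i hi j hj x ⟨by linarith [hx.1], by linarith [hx.2]⟩).continuousAt.continuousWithinAt

lemma sqrt_trick {M a b : ℝ} (hb : 0 ≤ b) (ha : 0 ≤ a) (h : M ^ 2 ≤ a + b * M) :
    M ≤ a + b + 1 := by
  by_contra hc
  push Not at hc
  nlinarith

/-- Interior gradient estimate. -/
theorem grad (H : RotheFam p κ R J D) (hp : 1 < p) (hκ : 0 < κ) {ρ M I : ℝ} (hρ : 1 ≤ ρ)
    (hR : ρ < R) (hI : 0 ≤ I)
    (hM : ∀ j ≤ J, ∀ x ∈ Set.Icc (-ρ) ρ, 1 ≤ D 0 j x ∧ D 0 j x ≤ M)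
    (hstart0 : ∀ x ∈ Set.Icc (-ρ) ρ, |D 1 0 x| ≤ I) :
    ∀ j ≤ J, ∀ x, |x| ≤ ρ / 2 → |D 1 j x| ≤
      2 * ((I ^ 2 + (p - 1) * (36 * M + 4 * (p - 1) * M + 1) * M)
        + (p - 1) * (8 * (p / (p - 1))) * M + 1) := by
  have hm : 0 < p - 1 := by linarith
  set m := p - 1 with hmdef
  set c := p / m with hcdef
  have hρ0 : 0 < ρ := by linarith
  have hsub : ∀ x ∈ Set.Icc (-ρ) ρ, x ∈ Set.Ioo (-R) R := fun x hx =>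
    ⟨by linarith [hx.1], by linarith [hx.2]⟩
  have hMpos : 1 ≤ M := (hM 0 (Nat.zero_le _) 0 ⟨by linarith, hρ0.le⟩).1.trans
    (hM 0 (Nat.zero_le _) 0 ⟨by linarith, hρ0.le⟩).2
  have hc0 : 0 < c := by rw [hcdef]; positivity
  -- the maximum of `η |u_x|`
  obtain ⟨j0, hj0, x0, hx0, hmax⟩ := exists_max_family J (fun j x => eta ρ x * |D 1 j x|) ρ hρ0
    (fun j hj => (eta_continuous ρ).continuousOn.mul (H.contOn hR 1 (by norm_num) j hj).abs)
  set M1 := eta ρ x0 * |D 1 j0 x0| with hM1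
  have hM1nn : 0 ≤ M1 := mul_nonneg (eta_bounds hρ hx0).1 (abs_nonneg _)
  set K := m * (36 * M + 4 * m * M + 8 * c * M1 + 1) with hK
  have hKnn : 0 ≤ K := by rw [hK]; positivity
  have key : ∀ j ≤ J, ∀ x ∈ Set.Icc (-ρ) ρ, eta ρ x ^ 2 * D 1 j x ^ 2 - K * D 0 j x ≤ I ^ 2 := by
    apply discrete_max_principle J _
      (fun j x => 2 * eta ρ x * eta1 ρ x * D 1 j x ^ 2 + 2 * eta ρ x ^ 2 * D 1 j x * D 2 j x
        - K * D 1 j x)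
      (fun j x => 2 * eta1 ρ x ^ 2 * D 1 j x ^ 2 + 2 * eta ρ x * eta2 ρ * D 1 j x ^ 2
        + 8 * eta ρ x * eta1 ρ x * D 1 j x * D 2 j x + 2 * eta ρ x ^ 2 * D 2 j x ^ 2
        + 2 * eta ρ x ^ 2 * D 1 j x * D 3 j x - K * D 2 j x) ρ _ hρ0
    · intro j hj
      exact (((eta_continuous ρ).continuousOn.pow 2).mul
        ((H.contOn hR 1 (by norm_num) j hj).pow 2)).sub
        (continuousOn_const.mul (H.contOn hR 0 (by norm_num) j hj))
    · intro j hj x hx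
      have hx' := hsub x (Set.Ioo_subset_Icc_self hx)
      have h0 := H.der 0 (by norm_num) j hj x hx'
      have h1 := H.der 1 (by norm_num) j hj x hx'
      have := (((eta_hasDerivAt ρ x).pow 2).mul (h1.pow 2)).sub (h0.const_mul K)
      exact this.congr_deriv (by simp; ring)
    · intro j hj x hx
      have hx' := hsub x (Set.Ioo_subset_Icc_self hx)
      have h1 := H.der 1 (by norm_num) j hj x hx'
      have h2 := H.der 2 (by norm_num) j hj x hx'
      have he := eta_hasDerivAt ρ x
      have he1 := eta1_hasDerivAt ρ x
      have := ((((he.const_mul 2).mul he1).mul (h1.pow 2)).add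
        ((((he.pow 2).const_mul 2).mul h1).mul h2)).sub (h1.const_mul K)
      exact this.congr_deriv (by simp; ring)
    · intro x hx
      have hb := eta_bounds hρ hx
      have h1 : eta ρ x ^ 2 * D 1 0 x ^ 2 ≤ 1 * I ^ 2 :=
        mul_le_mul (pow_le_one₀ hb.1 hb.2.1) (sq_le_sq_of_abs_le (hstart0 x hx)) (sq_nonneg _)
          (by norm_num)
      have h2 : 0 ≤ K * D 0 0 x := mul_nonneg hKnn (by linarith [(hM 0 (Nat.zero_le _) x hx).1])
      linarith
    · intro j hj
      have h1 : 0 ≤ K * D 0 j (-ρ) :=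
        mul_nonneg hKnn (by linarith [(hM j hj (-ρ) ⟨le_refl _, by linarith⟩).1])
      have h2 : 0 ≤ K * D 0 j ρ :=
        mul_nonneg hKnn (by linarith [(hM j hj ρ ⟨by linarith, le_refl _⟩).1])
      simp only [(eta_end ρ hρ).1, (eta_end ρ hρ).2]
      constructor <;> nlinarith [sq_nonneg I]
    · intro j hj x hx hP1 hP2 hP
      have hxc := Set.Ioo_subset_Icc_self hx
      have hx' := hsub x hxc
      have hb := eta_bounds hρ hxc
      have := bern_alg_one (κ := κ) (c := c) (m := m) (u := D 0 (j+1) x) (uh := D 0 j x)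
        (y := D 1 (j+1) x) (y1 := D 2 (j+1) x) (y2 := D 3 (j+1) x) (yh := D 1 j x)
        (e := eta ρ x) (e1 := eta1 ρ x) (e2 := eta2 ρ) (K := K) (M := M) (M1 := M1) hκ
        (by rw [hcdef, hmdef]; ring) hm (hM _ hj x hxc).1 (hM _ hj x hxc).2 hb.1 hb.2.1 hb.2.2.1
        hb.2.2.2 (hmax _ hj x hxc) hK hP1 hP2 hP (H.eq1 j hj x hx')
        (by rw [H.eqn j hj x hx', NN])
      exact this.trans (sq_nonneg I)
  have key2 : ∀ j ≤ J, ∀ x ∈ Set.Icc (-ρ) ρ, eta ρ x ^ 2 * D 1 j x ^ 2 ≤ I ^ 2 + K * M := by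
    intro j hj x hx
    have h1 := key j hj x hx
    have h2 : K * D 0 j x ≤ K * M := mul_le_mul_of_nonneg_left (hM j hj x hx).2 hKnn
    linarith
  have hM1sq : M1 ^ 2 ≤ (I ^ 2 + m * (36 * M + 4 * m * M + 1) * M) + m * (8 * c) * M * M1 := by
    have h := key2 j0 hj0 x0 hx0
    have h3 : M1 ^ 2 = eta ρ x0 ^ 2 * D 1 j0 x0 ^ 2 := by
      rw [hM1, mul_pow, sq_abs]
    rw [h3]
    refine h.trans (le_of_eq ?_)
    rw [hK]; ring
  have hfin := sqrt_trick (by positivity) (by positivity) hM1sq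
  intro j hj x hx
  have hxc : x ∈ Set.Icc (-ρ) ρ := by
    have := abs_le.1 hx
    exact ⟨by linarith, by linarith⟩
  have h1 := hmax j hj x hxc
  have h2 := eta_half hρ hx
  have h3 : 1 / 2 * |D 1 j x| ≤ eta ρ x * |D 1 j x| :=
    mul_le_mul_of_nonneg_right h2 (abs_nonneg _)
  linarith

/-- Abstract second Bernstein estimate. -/
theorem bern_gen {ρ M I b L G S : ℝ} (hκ : 0 < κ) (hρ : 1 ≤ ρ)
    (y y1 y2 g β r s u : ℕ → ℝ → ℝ)
    (hgy : ∀ j ≤ J, ∀ x ∈ Set.Icc (-ρ) ρ, HasDerivAt (g j) (y j x) x)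
    (hyy : ∀ j ≤ J, ∀ x ∈ Set.Icc (-ρ) ρ, HasDerivAt (y j) (y1 j x) x)
    (hyy1 : ∀ j ≤ J, ∀ x ∈ Set.Icc (-ρ) ρ, HasDerivAt (y1 j) (y2 j x) x)
    (hu : ∀ j ≤ J, ∀ x ∈ Set.Icc (-ρ) ρ, 1 ≤ u j x ∧ u j x ≤ M)
    (hβ : ∀ j ≤ J, ∀ x ∈ Set.Icc (-ρ) ρ, |β j x| ≤ b)
    (hg : ∀ j ≤ J, ∀ x ∈ Set.Icc (-ρ) ρ, |g j x| ≤ G)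
    (hL0 : 0 ≤ L) (hS : 0 ≤ S)
    (hr : ∀ j ≤ J, ∀ x ∈ Set.Icc (-ρ) ρ, 2 * eta ρ x ^ 2 * y j x * r j x ≤ L * y j x ^ 2 + L)
    (hs : ∀ j ≤ J, ∀ x ∈ Set.Icc (-ρ) ρ, |s j x| ≤ S * (1 + |y j x|))
    (hstart0 : ∀ x ∈ Set.Icc (-ρ) ρ, |y 0 x| ≤ I)
    (ey : ∀ j, j + 1 ≤ J → ∀ x ∈ Set.Icc (-ρ) ρ, κ * (y (j+1) x - y j x) =
      u (j+1) x * y2 (j+1) x + β (j+1) x * y1 (j+1) x + r (j+1) x)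
    (eg : ∀ j, j + 1 ≤ J → ∀ x ∈ Set.Icc (-ρ) ρ, κ * (g (j+1) x - g j x) =
      u (j+1) x * y1 (j+1) x + s (j+1) x) :
    ∀ j ≤ J, ∀ x ∈ Set.Icc (-ρ) ρ, eta ρ x ^ 2 * y j x ^ 2 ≤
      I ^ 2 + (1 + 2 * G * S + 2 * G ^ 2 * S ^ 2 + 2 * (68 * M + b ^ 2 + L) * G ^ 2) := by
  have hρ0 : 0 < ρ := by linarith
  have h0mem : (0:ℝ) ∈ Set.Icc (-ρ) ρ := ⟨by linarith, hρ0.le⟩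
  have hMpos : 1 ≤ M := (hu 0 (Nat.zero_le _) 0 h0mem).1.trans (hu 0 (Nat.zero_le _) 0 h0mem).2
  have hG0 : 0 ≤ G := (abs_nonneg _).trans (hg 0 (Nat.zero_le _) 0 h0mem)
  set K := 2 * (68 * M + b ^ 2 + L) with hK
  have hKnn : 0 ≤ K := by rw [hK]; positivity
  have hKg : ∀ j ≤ J, ∀ x ∈ Set.Icc (-ρ) ρ, K * g j x ^ 2 ≤ K * G ^ 2 := fun j hj x hx =>
    mul_le_mul_of_nonneg_left (sq_le_sq_of_abs_le (hg j hj x hx)) hKnn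
  have hB : 0 ≤ 1 + 2 * G * S + 2 * G ^ 2 * S ^ 2 := by positivity
  have key : ∀ j ≤ J, ∀ x ∈ Set.Icc (-ρ) ρ, eta ρ x ^ 2 * y j x ^ 2 + K * g j x ^ 2 ≤
      I ^ 2 + (1 + 2 * G * S + 2 * G ^ 2 * S ^ 2 + K * G ^ 2) := by
    apply discrete_max_principle J _
      (fun j x => 2 * eta ρ x * eta1 ρ x * y j x ^ 2 + 2 * eta ρ x ^ 2 * y j x * y1 j x
        + 2 * K * g j x * y j x)
      (fun j x => 2 * eta1 ρ x ^ 2 * y j x ^ 2 + 2 * eta ρ x * eta2 ρ * y j x ^ 2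
        + 8 * eta ρ x * eta1 ρ x * y j x * y1 j x + 2 * eta ρ x ^ 2 * y1 j x ^ 2
        + 2 * eta ρ x ^ 2 * y j x * y2 j x + 2 * K * y j x ^ 2 + 2 * K * g j x * y1 j x) ρ _ hρ0
    · intro j hj x hx
      have h1 := (hyy j hj x hx).continuousAt
      have h2 := (hgy j hj x hx).continuousAt
      have h3 : ContinuousAt (eta ρ) x := (eta_continuous ρ).continuousAt
      exact (((h3.pow 2).mul (h1.pow 2)).add (continuousAt_const.mul (h2.pow 2))).continuousWithinAt
    · intro j hj x hx
      have hx' := Set.Ioo_subset_Icc_self hx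
      have h0 := hgy j hj x hx'
      have h1 := hyy j hj x hx'
      have := (((eta_hasDerivAt ρ x).pow 2).mul (h1.pow 2)).add ((h0.pow 2).const_mul K)
      exact this.congr_deriv (by simp; ring)
    · intro j hj x hx
      have hx' := Set.Ioo_subset_Icc_self hx
      have h0 := hgy j hj x hx'
      have h1 := hyy j hj x hx'
      have h2 := hyy1 j hj x hx'
      have he := eta_hasDerivAt ρ x
      have he1 := eta1_hasDerivAt ρ x
      have := ((((he.const_mul 2).mul he1).mul (h1.pow 2)).add
        ((((he.pow 2).const_mul 2).mul h1).mul h2)).add ((h0.const_mul (2 * K)).mul h1)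
      exact this.congr_deriv (by simp; ring)
    · intro x hx
      have hb := eta_bounds hρ hx
      have h1 : eta ρ x ^ 2 * y 0 x ^ 2 ≤ 1 * I ^ 2 :=
        mul_le_mul (pow_le_one₀ hb.1 hb.2.1) (sq_le_sq_of_abs_le (hstart0 x hx)) (sq_nonneg _)
          (by norm_num)
      have h2 := hKg 0 (Nat.zero_le _) x hx
      linarith
    · intro j hj
      have h1 := hKg j hj (-ρ) ⟨le_refl _, by linarith⟩
      have h2 := hKg j hj ρ ⟨by linarith, le_refl _⟩
      simp only [(eta_end ρ hρ).1, (eta_end ρ hρ).2]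
      constructor <;> linarith [sq_nonneg I]
    · intro j hj x hx hP1 hP2 hP
      have hxc := Set.Ioo_subset_Icc_self hx
      have hb := eta_bounds hρ hxc
      have := bern_alg_two hκ (hu _ hj x hxc).1 (hu _ hj x hxc).2 hb.1 hb.2.1 hb.2.2.1
        hb.2.2.2 (hβ _ hj x hxc) hL0 (hr _ hj x hxc) (hg _ hj x hxc) hS (hs _ hj x hxc) hK
        hP2 hP (ey j hj x hxc) (eg j hj x hxc)
      linarith [sq_nonneg I]
  intro j hj x hx
  have h1 := key j hj x hx
  have h2 : 0 ≤ K * g j x ^ 2 := by positivity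
  linarith

end RotheFam

end

section
lemma b4_aux1 {e y r1 g u m k M2 M G : ℝ} (he0 : 0 ≤ e) (he : e ≤ 1) (hm : 0 ≤ m)
    (hM2 : e * |y| ≤ M2) (hu : 1 ≤ u) (huM : u ≤ M) (hg : |g| ≤ G)
    (hr : r1 = k * y ^ 2 + m * ((2 * u - 1) * y + 2 * g ^ 2)) :
    2 * e ^ 2 * y * r1 ≤ (2 * |k| * M2 + 4 * m * M + 4 * m * G ^ 2) * y ^ 2
      + (2 * |k| * M2 + 4 * m * M + 4 * m * G ^ 2) := by
  have hG : 0 ≤ G := (abs_nonneg _).trans hg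
  have hM20 : 0 ≤ M2 := (mul_nonneg he0 (abs_nonneg _)).trans hM2
  have hy : |y| ≤ y ^ 2 + 1 := by nlinarith [sq_abs y, sq_nonneg (|y| - 1), abs_nonneg y]
  have he2 : e ^ 2 ≤ 1 := pow_le_one₀ he0 he
  have hg2 : g ^ 2 ≤ G ^ 2 := sq_le_sq_of_abs_le hg
  have h1 : 2 * e ^ 2 * k * y ^ 3 ≤ 2 * |k| * M2 * y ^ 2 := by
    have a1 : 2 * e ^ 2 * k * y ^ 3 ≤ 2 * e ^ 2 * |k| * |y| * y ^ 2 := by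
      have : k * y ≤ |k| * |y| := by rw [← abs_mul]; exact le_abs_self _
      have h2 : 0 ≤ 2 * e ^ 2 * y ^ 2 := by positivity
      nlinarith [mul_le_mul_of_nonneg_left this h2]
    have a2 : e ^ 2 * |y| ≤ M2 := by
      have : e ^ 2 * |y| = e * (e * |y|) := by ring
      rw [this]
      have h3 : 0 ≤ e * |y| := mul_nonneg he0 (abs_nonneg _)
      nlinarith
    have a3 := mul_le_mul_of_nonneg_left a2 (show 0 ≤ 2 * |k| * y ^ 2 by positivity)
    linarith
  have h2 : 2 * e ^ 2 * m * (2 * u - 1) * y ^ 2 ≤ 4 * m * M * y ^ 2 := by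
    have a1 : e ^ 2 * (2 * u - 1) ≤ 2 * M := by nlinarith [sq_nonneg e]
    have a3 := mul_le_mul_of_nonneg_left a1 (show 0 ≤ 2 * m * y ^ 2 by positivity)
    linarith
  have h3 : 4 * e ^ 2 * m * y * g ^ 2 ≤ 4 * m * G ^ 2 * (y ^ 2 + 1) := by
    have a1 : e ^ 2 * g ^ 2 ≤ G ^ 2 := by nlinarith [sq_nonneg e, sq_nonneg g]
    have a2 : (e ^ 2 * g ^ 2) * y ≤ G ^ 2 * (y ^ 2 + 1) := by
      have b1 : (e ^ 2 * g ^ 2) * y ≤ (e ^ 2 * g ^ 2) * |y| :=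
        mul_le_mul_of_nonneg_left (le_abs_self _) (by positivity)
      have b2 : (e ^ 2 * g ^ 2) * |y| ≤ G ^ 2 * (y ^ 2 + 1) :=
        mul_le_mul a1 hy (abs_nonneg _) (by positivity)
      linarith
    have a3 := mul_le_mul_of_nonneg_left a2 (show 0 ≤ 4 * m by positivity)
    linarith
  have h4 : 0 ≤ 2 * |k| * M2 := by positivity
  have h5 : 0 ≤ 4 * m * M := by have : 0 ≤ M := by linarith
                                positivity
  rw [hr]
  nlinarith

lemma b4_aux2 {e y r1 g1 g2 u m k M G G2 : ℝ} (he0 : 0 ≤ e) (he : e ≤ 1) (hm : 0 ≤ m)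
    (hu : 1 ≤ u) (huM : u ≤ M) (hg1 : |g1| ≤ G) (hg2 : |g2| ≤ G2)
    (hr : r1 = k * g2 * y + m * ((2 * u - 1) * y + 6 * g1 * g2)) :
    2 * e ^ 2 * y * r1 ≤ (2 * |k| * G2 + 4 * m * M + 12 * m * (G * G2)) * y ^ 2
      + (2 * |k| * G2 + 4 * m * M + 12 * m * (G * G2)) := by
  have hG : 0 ≤ G := (abs_nonneg _).trans hg1
  have hG2 : 0 ≤ G2 := (abs_nonneg _).trans hg2
  have hy : |y| ≤ y ^ 2 + 1 := by nlinarith [sq_abs y, sq_nonneg (|y| - 1), abs_nonneg y]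
  have he2 : e ^ 2 ≤ 1 := pow_le_one₀ he0 he
  have h1 : 2 * e ^ 2 * k * g2 * y ^ 2 ≤ 2 * |k| * G2 * y ^ 2 := by
    have a0 : k * g2 ≤ |k| * G2 := by
      calc k * g2 ≤ |k| * |g2| := by rw [← abs_mul]; exact le_abs_self _
        _ ≤ _ := mul_le_mul_of_nonneg_left hg2 (abs_nonneg _)
    have a1 : e ^ 2 * (k * g2) ≤ |k| * G2 := by
      have : 0 ≤ |k| * G2 := by positivity
      nlinarith [sq_nonneg e]
    have a3 := mul_le_mul_of_nonneg_left a1 (show 0 ≤ 2 * y ^ 2 by positivity)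
    linarith
  have h2 : 2 * e ^ 2 * m * (2 * u - 1) * y ^ 2 ≤ 4 * m * M * y ^ 2 := by
    have a1 : e ^ 2 * (2 * u - 1) ≤ 2 * M := by nlinarith [sq_nonneg e]
    have a3 := mul_le_mul_of_nonneg_left a1 (show 0 ≤ 2 * m * y ^ 2 by positivity)
    linarith
  have h3 : 12 * e ^ 2 * m * y * (g1 * g2) ≤ 12 * m * (G * G2) * (y ^ 2 + 1) := by
    have a0 : |g1 * g2| ≤ G * G2 := by
      rw [abs_mul]; exact mul_le_mul hg1 hg2 (abs_nonneg _) hG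
    have a1 : e ^ 2 * |g1 * g2| ≤ G * G2 := by nlinarith [sq_nonneg e, abs_nonneg (g1 * g2)]
    have a2 : e ^ 2 * (y * (g1 * g2)) ≤ (G * G2) * (y ^ 2 + 1) := by
      have b1 : e ^ 2 * (y * (g1 * g2)) ≤ (e ^ 2 * |g1 * g2|) * |y| := by
        have : y * (g1 * g2) ≤ |g1 * g2| * |y| := by
          rw [← abs_mul, mul_comm]; exact le_abs_self _
        have := mul_le_mul_of_nonneg_left this (sq_nonneg e)
        linarith
      have b2 : (e ^ 2 * |g1 * g2|) * |y| ≤ (G * G2) * (y ^ 2 + 1) :=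
        mul_le_mul a1 hy (abs_nonneg _) (by positivity)
      linarith
    have a3 := mul_le_mul_of_nonneg_left a2 (show 0 ≤ 12 * m by positivity)
    linarith
  have h4 : 0 ≤ 2 * |k| * G2 := by positivity
  have h5 : 0 ≤ 4 * m * M := by have : 0 ≤ M := by linarith
                                positivity
  rw [hr]
  nlinarith

lemma abs_two_u {u M : ℝ} (hu : 1 ≤ u) (huM : u ≤ M) : |2 * u - 1| ≤ 2 * M := by
  rw [abs_le]; constructor <;> linarith

lemma b4_s1 {y g u m k M G : ℝ} (hm : 0 ≤ m) (hu : 1 ≤ u) (huM : u ≤ M) (hg : |g| ≤ G) :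
    |k * g * y + m * (2 * u - 1) * g| ≤ (|k| * G + 2 * m * M * G) * (1 + |y|) := by
  have hG : 0 ≤ G := (abs_nonneg _).trans hg
  have hM : 0 ≤ M := by linarith
  have h1 : |k * g * y| ≤ |k| * G * |y| := by
    rw [abs_mul, abs_mul]; gcongr
  have h2 : |m * (2 * u - 1) * g| ≤ m * (2 * M) * G := by
    rw [abs_mul, abs_mul, abs_of_nonneg hm]
    have := abs_two_u hu huM
    gcongr
  have h3 := abs_add_le (k * g * y) (m * (2 * u - 1) * g)
  have h4 : 0 ≤ |k| * G := by positivity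
  have h5 : 0 ≤ 2 * m * M * G * |y| := by positivity
  nlinarith

lemma b4_s2 {y g1 g2 u m k k' M G G2 : ℝ} (hm : 0 ≤ m) (hu : 1 ≤ u) (huM : u ≤ M)
    (hg1 : |g1| ≤ G) (hg2 : |g2| ≤ G2) :
    |k * g1 * y + (k' * g2 ^ 2 + m * ((2 * u - 1) * g2 + 2 * g1 ^ 2))| ≤
      (|k| * G + (|k'| * G2 ^ 2 + m * (2 * M * G2 + 2 * G ^ 2))) * (1 + |y|) := by
  have hG : 0 ≤ G := (abs_nonneg _).trans hg1
  have hG2 : 0 ≤ G2 := (abs_nonneg _).trans hg2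
  have hM : 0 ≤ M := by linarith
  have h1 : |k * g1 * y| ≤ |k| * G * |y| := by
    rw [abs_mul, abs_mul]; gcongr
  have h2 : |k' * g2 ^ 2| ≤ |k'| * G2 ^ 2 := by
    rw [abs_mul, abs_pow]; gcongr
  have h3 : |m * ((2 * u - 1) * g2 + 2 * g1 ^ 2)| ≤ m * (2 * M * G2 + 2 * G ^ 2) := by
    rw [abs_mul, abs_of_nonneg hm]
    have a1 : |(2 * u - 1) * g2| ≤ 2 * M * G2 := by
      rw [abs_mul]; have := abs_two_u hu huM
      gcongr
    have a2 : |2 * g1 ^ 2| ≤ 2 * G ^ 2 := by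
      rw [abs_mul, abs_pow, abs_two]; gcongr
    have := abs_add_le ((2 * u - 1) * g2) (2 * g1 ^ 2)
    gcongr; linarith
  have h4 := abs_add_le (k * g1 * y) (k' * g2 ^ 2 + m * ((2 * u - 1) * g2 + 2 * g1 ^ 2))
  have h5 := abs_add_le (k' * g2 ^ 2) (m * ((2 * u - 1) * g2 + 2 * g1 ^ 2))
  have h6 : 0 ≤ |k| * G := by positivity
  have h7 : 0 ≤ (|k'| * G2 ^ 2 + m * (2 * M * G2 + 2 * G ^ 2)) * |y| := by positivity
  nlinarith

namespace RotheFam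

theorem second {p : ℝ} (hp : 1 < p) (M G I : ℝ) : ∃ C : ℝ, 0 ≤ C ∧
    ∀ {κ R : ℝ} {J : ℕ} {D : ℕ → ℕ → ℝ → ℝ} (_ : RotheFam p κ R J D) (_ : 0 < κ) {ρ : ℝ}
    (_ : 1 ≤ ρ) (_ : ρ < R)
    (_ : ∀ j ≤ J, ∀ x ∈ Set.Icc (-ρ) ρ, 1 ≤ D 0 j x ∧ D 0 j x ≤ M)
    (_ : ∀ j ≤ J, ∀ x ∈ Set.Icc (-ρ) ρ, |D 1 j x| ≤ G)
    (_ : ∀ x ∈ Set.Icc (-ρ) ρ, |D 2 0 x| ≤ I),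
    ∀ j ≤ J, ∀ x, |x| ≤ ρ / 2 → |D 2 j x| ≤ C := by
  set m := p - 1 with hmdef
  have hm : 0 < m := by rw [hmdef]; linarith
  set c := p / m with hcdef
  set S := |1 - 2 * c| * G + 2 * m * M * G with hSdef
  set b := |2 - 2 * c| * G with hbdef
  refine ⟨2 * |(I ^ 2 + (1 + 2 * G * S + 2 * G ^ 2 * S ^ 2 + 2 * (68 * M + b ^ 2 + (4 * m * M + 4 * m * G ^ 2)) * G ^ 2)) + 4 * |1 - 2 * c| * G ^ 2 + 1|, by positivity, ?_⟩
  intro κ R J D H hκ ρ hρ hR hM hG hI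
  have hρ0 : 0 < ρ := by linarith
  have hsub : ∀ x ∈ Set.Icc (-ρ) ρ, x ∈ Set.Ioo (-R) R := fun x hx =>
    ⟨by linarith [hx.1], by linarith [hx.2]⟩
  have h0mem : (0:ℝ) ∈ Set.Icc (-ρ) ρ := ⟨by linarith, hρ0.le⟩
  have hMpos : 1 ≤ M := (hM 0 (Nat.zero_le _) 0 h0mem).1.trans (hM 0 (Nat.zero_le _) 0 h0mem).2
  have hG0 : 0 ≤ G := (abs_nonneg _).trans (hG 0 (Nat.zero_le _) 0 h0mem)
  obtain ⟨j0, hj0, x0, hx0, hmax⟩ := exists_max_family J (fun j x => eta ρ x * |D 2 j x|) ρ hρ0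
    (fun j hj => (eta_continuous ρ).continuousOn.mul (H.contOn hR 2 (by norm_num) j hj).abs)
  set M2 := eta ρ x0 * |D 2 j0 x0| with hM2
  have hM2nn : 0 ≤ M2 := mul_nonneg (eta_bounds hρ hx0).1 (abs_nonneg _)
  have key := bern_gen (J := J) (κ := κ) (ρ := ρ) (M := M) (I := I) (b := b)
    (L := 2 * |1 - 2 * c| * M2 + 4 * m * M + 4 * m * G ^ 2) (G := G) (S := S) hκ hρ
    (D 2) (D 3) (D 4) (D 1) (fun j x => (2 - 2 * c) * D 1 j x)
    (fun j x => (1 - 2 * c) * D 2 j x ^ 2 + m * ((2 * D 0 j x - 1) * D 2 j x + 2 * D 1 j x ^ 2))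
    (fun j x => (1 - 2 * c) * D 1 j x * D 2 j x + m * (2 * D 0 j x - 1) * D 1 j x) (D 0)
    (fun j hj x hx => H.der 1 (by norm_num) j hj x (hsub x hx))
    (fun j hj x hx => H.der 2 (by norm_num) j hj x (hsub x hx))
    (fun j hj x hx => H.der 3 (by norm_num) j hj x (hsub x hx))
    hM
    (fun j hj x hx => by
      rw [abs_mul]; exact mul_le_mul_of_nonneg_left (hG j hj x hx) (abs_nonneg _))
    hG (by positivity) (by positivity)
    (fun j hj x hx => b4_aux1 (eta_bounds hρ hx).1 (eta_bounds hρ hx).2.1 hm.le (hmax j hj x hx)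
      (hM j hj x hx).1 (hM j hj x hx).2 (hG j hj x hx) rfl)
    (fun j hj x hx => b4_s1 hm.le (hM j hj x hx).1 (hM j hj x hx).2 (hG j hj x hx))
    hI
    (fun j hj x hx => H.eq2 j hj x (hsub x hx))
    (fun j hj x hx => by rw [H.eq1 j hj x (hsub x hx)]; ring)
  have hsq : M2 ^ 2 ≤ (I ^ 2 + (1 + 2 * G * S + 2 * G ^ 2 * S ^ 2 + 2 * (68 * M + b ^ 2 + (4 * m * M + 4 * m * G ^ 2)) * G ^ 2)) + (4 * |1 - 2 * c| * G ^ 2) * M2 := by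
    have h := key j0 hj0 x0 hx0
    rw [hM2, mul_pow, sq_abs]
    refine h.trans (le_of_eq ?_)
    ring
  have hS0 : 0 ≤ S := by positivity
  have hfin := sqrt_trick (by positivity) (by positivity) hsq
  intro j hj x hx
  have hxc : x ∈ Set.Icc (-ρ) ρ := by
    have := abs_le.1 hx
    exact ⟨by linarith, by linarith⟩
  have h1 := hmax j hj x hxc
  have h2 := eta_half hρ hx
  have h3 : 1 / 2 * |D 2 j x| ≤ eta ρ x * |D 2 j x| :=
    mul_le_mul_of_nonneg_right h2 (abs_nonneg _)
  have h4 := hfin.trans (le_abs_self _)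
  linarith

theorem third {p : ℝ} (hp : 1 < p) (M G G2 I : ℝ) : ∃ C : ℝ, 0 ≤ C ∧
    ∀ {κ R : ℝ} {J : ℕ} {D : ℕ → ℕ → ℝ → ℝ} (_ : RotheFam p κ R J D) (_ : 0 < κ) {ρ : ℝ}
    (_ : 1 ≤ ρ) (_ : ρ < R)
    (_ : ∀ j ≤ J, ∀ x ∈ Set.Icc (-ρ) ρ, 1 ≤ D 0 j x ∧ D 0 j x ≤ M)
    (_ : ∀ j ≤ J, ∀ x ∈ Set.Icc (-ρ) ρ, |D 1 j x| ≤ G)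
    (_ : ∀ j ≤ J, ∀ x ∈ Set.Icc (-ρ) ρ, |D 2 j x| ≤ G2)
    (_ : ∀ x ∈ Set.Icc (-ρ) ρ, |D 3 0 x| ≤ I),
    ∀ j ≤ J, ∀ x, |x| ≤ ρ / 2 → |D 3 j x| ≤ C := by
  set m := p - 1 with hmdef
  have hm : 0 < m := by rw [hmdef]; linarith
  set c := p / m with hcdef
  set S := |2 - 2 * c| * G + (|1 - 2 * c| * G2 ^ 2 + m * (2 * M * G2 + 2 * G ^ 2)) with hSdef
  set b := |3 - 2 * c| * G with hbdef
  set L := 2 * |4 - 6 * c| * G2 + 4 * m * M + 12 * m * (G * G2) with hLdef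
  refine ⟨4 * |I ^ 2 + (1 + 2 * G2 * S + 2 * G2 ^ 2 * S ^ 2 + 2 * (68 * M + b ^ 2 + L) * G2 ^ 2)| + 1, by positivity, ?_⟩
  intro κ R J D H hκ ρ hρ hR hM hG hG2 hI
  have hρ0 : 0 < ρ := by linarith
  have hsub : ∀ x ∈ Set.Icc (-ρ) ρ, x ∈ Set.Ioo (-R) R := fun x hx =>
    ⟨by linarith [hx.1], by linarith [hx.2]⟩
  have h0mem : (0:ℝ) ∈ Set.Icc (-ρ) ρ := ⟨by linarith, hρ0.le⟩
  have hMpos : 1 ≤ M := (hM 0 (Nat.zero_le _) 0 h0mem).1.trans (hM 0 (Nat.zero_le _) 0 h0mem).2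
  have hG0 : 0 ≤ G := (abs_nonneg _).trans (hG 0 (Nat.zero_le _) 0 h0mem)
  have hG20 : 0 ≤ G2 := (abs_nonneg _).trans (hG2 0 (Nat.zero_le _) 0 h0mem)
  have key := bern_gen (J := J) (κ := κ) (ρ := ρ) (M := M) (I := I) (b := b)
    (L := L) (G := G2) (S := S) hκ hρ
    (D 3) (D 4) (D 5) (D 2) (fun j x => (3 - 2 * c) * D 1 j x)
    (fun j x => (4 - 6 * c) * D 2 j x * D 3 j x
      + m * ((2 * D 0 j x - 1) * D 3 j x + 6 * D 1 j x * D 2 j x))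
    (fun j x => (2 - 2 * c) * D 1 j x * D 3 j x + ((1 - 2 * c) * D 2 j x ^ 2
      + m * ((2 * D 0 j x - 1) * D 2 j x + 2 * D 1 j x ^ 2))) (D 0)
    (fun j hj x hx => H.der 2 (by norm_num) j hj x (hsub x hx))
    (fun j hj x hx => H.der 3 (by norm_num) j hj x (hsub x hx))
    (fun j hj x hx => H.der 4 (by norm_num) j hj x (hsub x hx))
    hM
    (fun j hj x hx => by
      rw [abs_mul]; exact mul_le_mul_of_nonneg_left (hG j hj x hx) (abs_nonneg _))
    hG2 (by positivity) (by positivity)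
    (fun j hj x hx => b4_aux2 (eta_bounds hρ hx).1 (eta_bounds hρ hx).2.1 hm.le
      (hM j hj x hx).1 (hM j hj x hx).2 (hG j hj x hx) (hG2 j hj x hx) rfl)
    (fun j hj x hx => b4_s2 hm.le (hM j hj x hx).1 (hM j hj x hx).2 (hG j hj x hx)
      (hG2 j hj x hx))
    hI
    (fun j hj x hx => H.eq3 j hj x (hsub x hx))
    (fun j hj x hx => by rw [H.eq2 j hj x (hsub x hx)]; ring)
  intro j hj x hx
  have hxc : x ∈ Set.Icc (-ρ) ρ := by
    have := abs_le.1 hx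
    exact ⟨by linarith, by linarith⟩
  have h1 := (key j hj x hxc).trans (le_abs_self _)
  have h2 := eta_half hρ hx
  have h3 : 1 / 4 * D 3 j x ^ 2 ≤ eta ρ x ^ 2 * D 3 j x ^ 2 :=
    mul_le_mul_of_nonneg_right (by nlinarith) (sq_nonneg _)
  have hy : |D 3 j x| ≤ D 3 j x ^ 2 + 1 := by
    nlinarith [sq_abs (D 3 j x), sq_nonneg (|D 3 j x| - 1), abs_nonneg (D 3 j x)]
  linarith

/-- Interior derivative estimates up to order three. -/
theorem interior {p : ℝ} (hp : 1 < p) (M I : ℝ) : ∃ C : ℝ, 0 ≤ C ∧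
    ∀ {κ R : ℝ} {J : ℕ} {D : ℕ → ℕ → ℝ → ℝ} (_ : RotheFam p κ R J D) (_ : 0 < κ) {ρ : ℝ}
    (_ : 1 ≤ ρ) (_ : 8 * ρ < R)
    (_ : ∀ j ≤ J, ∀ x ∈ Set.Icc (-(8 * ρ)) (8 * ρ), 1 ≤ D 0 j x ∧ D 0 j x ≤ M)
    (_ : ∀ x ∈ Set.Icc (-(8 * ρ)) (8 * ρ), |D 1 0 x| ≤ I ∧ |D 2 0 x| ≤ I ∧ |D 3 0 x| ≤ I),
    ∀ j ≤ J, ∀ x, |x| ≤ ρ → |D 1 j x| ≤ C ∧ |D 2 j x| ≤ C ∧ |D 3 j x| ≤ C := by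
  set G := |2 * ((I ^ 2 + (p - 1) * (36 * M + 4 * (p - 1) * M + 1) * M)
        + (p - 1) * (8 * (p / (p - 1))) * M + 1)| with hGdef
  obtain ⟨C2, hC2, h2⟩ := second hp M G I
  obtain ⟨C3, hC3, h3⟩ := third hp M G C2 I
  refine ⟨G + C2 + C3, by positivity, ?_⟩
  intro κ R J D H hκ ρ hρ hR hM hI
  have h0mem : (0:ℝ) ∈ Set.Icc (-(8 * ρ)) (8 * ρ) := ⟨by linarith, by linarith⟩
  have hI0 : 0 ≤ I := (abs_nonneg _).trans (hI 0 h0mem).1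
  have g1 : ∀ j ≤ J, ∀ x, |x| ≤ 4 * ρ → |D 1 j x| ≤ G := fun j hj x hx =>
    (H.grad hp hκ (ρ := 8 * ρ) (by linarith) hR hI0 hM (fun x hx => (hI x hx).1) j hj x
      (by linarith)).trans (le_abs_self _)
  have hs : ∀ r, r ≤ 8 * ρ → ∀ x ∈ Set.Icc (-r) r, x ∈ Set.Icc (-(8 * ρ)) (8 * ρ) := fun r hr x hx =>
    ⟨by linarith [hx.1], by linarith [hx.2]⟩
  have g2 : ∀ j ≤ J, ∀ x, |x| ≤ 2 * ρ → |D 2 j x| ≤ C2 := fun j hj x hx =>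
    h2 H hκ (ρ := 4 * ρ) (by linarith) (by linarith)
      (fun j hj x hx => hM j hj x (hs _ (by linarith) x hx))
      (fun j hj x hx => g1 j hj x (abs_le.2 hx))
      (fun x hx => (hI x (hs _ (by linarith) x hx)).2.1) j hj x (by linarith)
  have g3 : ∀ j ≤ J, ∀ x, |x| ≤ ρ → |D 3 j x| ≤ C3 := fun j hj x hx =>
    h3 H hκ (ρ := 2 * ρ) (by linarith) (by linarith)
      (fun j hj x hx => hM j hj x (hs _ (by linarith) x hx))
      (fun j hj x hx => g1 j hj x ((abs_le.2 hx).trans (by linarith)))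
      (fun j hj x hx => g2 j hj x (abs_le.2 hx))
      (fun x hx => (hI x (hs _ (by linarith) x hx)).2.2) j hj x (by linarith)
  intro j hj x hx
  have a1 := g1 j hj x (by linarith)
  have a2 := g2 j hj x (by linarith)
  have a3 := g3 j hj x hx
  have hG0 : 0 ≤ G := abs_nonneg _
  refine ⟨by linarith, by linarith, by linarith⟩

end RotheFam

end

section
section
open Real MeasureTheory intervalIntegral

/-- particular solution of `y'' = Λ² y + g`, vanishing at `-R`. -/
noncomputable def linS (Λ R : ℝ) (g : ℝ → ℝ) (x : ℝ) : ℝ :=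
  (exp (Λ * x) * (∫ s in (-R)..x, exp (-(Λ * s)) * g s)
    - exp (-(Λ * x)) * ∫ s in (-R)..x, exp (Λ * s) * g s) / (2 * Λ)

noncomputable def linS1 (Λ R : ℝ) (g : ℝ → ℝ) (x : ℝ) : ℝ :=
  (exp (Λ * x) * (∫ s in (-R)..x, exp (-(Λ * s)) * g s)
    + exp (-(Λ * x)) * ∫ s in (-R)..x, exp (Λ * s) * g s) / 2

noncomputable def linT (Λ R a b : ℝ) (g : ℝ → ℝ) (x : ℝ) : ℝ :=
  linS Λ R g x + a * (sinh (Λ * (R - x)) / sinh (Λ * (2 * R)))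
    + (b - linS Λ R g R) * (sinh (Λ * (x + R)) / sinh (Λ * (2 * R)))

noncomputable def linT1 (Λ R a b : ℝ) (g : ℝ → ℝ) (x : ℝ) : ℝ :=
  linS1 Λ R g x - a * (Λ * cosh (Λ * (R - x)) / sinh (Λ * (2 * R)))
    + (b - linS Λ R g R) * (Λ * cosh (Λ * (x + R)) / sinh (Λ * (2 * R)))

lemma linS_end (Λ R : ℝ) (g : ℝ → ℝ) : linS Λ R g (-R) = 0 := by
  simp [linS]

lemma hasDerivAt_expm (Λ x : ℝ) : HasDerivAt (fun x => exp (-(Λ * x))) (-(Λ * exp (-(Λ * x)))) x := by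
  have h := (((hasDerivAt_id x).const_mul Λ).neg).exp
  exact h.congr_deriv (by simp; ring)

lemma hasDerivAt_expp (Λ x : ℝ) : HasDerivAt (fun x => exp (Λ * x)) (Λ * exp (Λ * x)) x := by
  have h := (((hasDerivAt_id x).const_mul Λ)).exp
  exact h.congr_deriv (by simp; ring)

lemma linS_deriv {Λ : ℝ} (hΛ : 0 < Λ) (R : ℝ) {g : ℝ → ℝ} (hg : Continuous g) (x : ℝ) :
    HasDerivAt (linS Λ R g) (linS1 Λ R g x) x := by
  have c1 : Continuous fun s => exp (-(Λ * s)) * g s := by fun_prop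
  have c2 : Continuous fun s => exp (Λ * s) * g s := by fun_prop
  have i1 := integral_hasDerivAt_right (c1.intervalIntegrable (-R) x)
    c1.stronglyMeasurable.stronglyMeasurableAtFilter c1.continuousAt
  have i2 := integral_hasDerivAt_right (c2.intervalIntegrable (-R) x)
    c2.stronglyMeasurable.stronglyMeasurableAtFilter c2.continuousAt
  have h := (((hasDerivAt_expp Λ x).mul i1).sub ((hasDerivAt_expm Λ x).mul i2)).div_const (2 * Λ)
  refine h.congr_deriv ?_
  unfold linS1
  have e1 : exp (Λ * x) * exp (-(Λ * x)) = 1 := by rw [← exp_add]; simp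
  field_simp
  ring

lemma linS1_deriv {Λ : ℝ} (hΛ : 0 < Λ) (R : ℝ) {g : ℝ → ℝ} (hg : Continuous g) (x : ℝ) :
    HasDerivAt (linS1 Λ R g) (Λ ^ 2 * linS Λ R g x + g x) x := by
  have c1 : Continuous fun s => exp (-(Λ * s)) * g s := by fun_prop
  have c2 : Continuous fun s => exp (Λ * s) * g s := by fun_prop
  have i1 := integral_hasDerivAt_right (c1.intervalIntegrable (-R) x)
    c1.stronglyMeasurable.stronglyMeasurableAtFilter c1.continuousAt
  have i2 := integral_hasDerivAt_right (c2.intervalIntegrable (-R) x)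
    c2.stronglyMeasurable.stronglyMeasurableAtFilter c2.continuousAt
  have h := (((hasDerivAt_expp Λ x).mul i1).add ((hasDerivAt_expm Λ x).mul i2)).div_const 2
  refine h.congr_deriv ?_
  unfold linS
  have e1 : exp (Λ * x) * (exp (-(Λ * x)) * g x) = g x := by rw [← mul_assoc, ← exp_add]; simp
  have e2 : exp (-(Λ * x)) * (exp ((Λ * x)) * g x) = g x := by rw [← mul_assoc, ← exp_add]; simp
  rw [e1, e2]
  field_simp
  ring

lemma linT_ends {Λ R : ℝ} (hΛ : 0 < Λ) (hR : 0 < R) (a b : ℝ) (g : ℝ → ℝ) :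
    linT Λ R a b g (-R) = a ∧ linT Λ R a b g R = b := by
  have hs : sinh (Λ * (2 * R)) ≠ 0 := by
    have : 0 < sinh (Λ * (2 * R)) := by rw [sinh_pos_iff]; positivity
    exact this.ne'
  constructor
  · unfold linT
    rw [linS_end]
    have : R - -R = 2 * R := by ring
    rw [this, div_self hs]; simp
  · unfold linT
    have : R + R = 2 * R := by ring
    rw [this, div_self hs]; simp

lemma linT_deriv {Λ : ℝ} (hΛ : 0 < Λ) (R a b : ℝ) {g : ℝ → ℝ} (hg : Continuous g) (x : ℝ) :
    HasDerivAt (linT Λ R a b g) (linT1 Λ R a b g x) x := by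
  have h1 : HasDerivAt (fun x => sinh (Λ * (R - x))) (cosh (Λ * (R - x)) * (Λ * -1)) x :=
    (((hasDerivAt_id x).const_sub R).const_mul Λ).sinh
  have h2 : HasDerivAt (fun x => sinh (Λ * (x + R))) (cosh (Λ * (x + R)) * (Λ * 1)) x :=
    (((hasDerivAt_id x).add_const R).const_mul Λ).sinh
  have h := ((linS_deriv hΛ R hg x).add ((h1.div_const (sinh (Λ * (2 * R)))).const_mul a)).add
    ((h2.div_const (sinh (Λ * (2 * R)))).const_mul (b - linS Λ R g R))
  exact h.congr_deriv (by unfold linT1; ring)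

lemma linT1_deriv {Λ : ℝ} (hΛ : 0 < Λ) (R a b : ℝ) {g : ℝ → ℝ} (hg : Continuous g) (x : ℝ) :
    HasDerivAt (linT1 Λ R a b g) (Λ ^ 2 * linT Λ R a b g x + g x) x := by
  have h1 : HasDerivAt (fun x => cosh (Λ * (R - x))) (sinh (Λ * (R - x)) * (Λ * -1)) x :=
    (((hasDerivAt_id x).const_sub R).const_mul Λ).cosh
  have h2 : HasDerivAt (fun x => cosh (Λ * (x + R))) (sinh (Λ * (x + R)) * (Λ * 1)) x :=
    (((hasDerivAt_id x).add_const R).const_mul Λ).cosh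
  have h := ((linS1_deriv hΛ R hg x).sub
    (((h1.const_mul Λ).div_const (sinh (Λ * (2 * R)))).const_mul a)).add
    (((h2.const_mul Λ).div_const (sinh (Λ * (2 * R)))).const_mul (b - linS Λ R g R))
  exact h.congr_deriv (by unfold linT; ring)

/-- maximum principle for `∂² − Λ²`. -/
lemma lin_max {Λ R : ℝ} (hΛ : 0 < Λ) (hR : 0 < R) {z z1 z2 : ℝ → ℝ}
    (hc : ContinuousOn z (Set.Icc (-R) R))
    (h1 : ∀ x ∈ Set.Ioo (-R) R, HasDerivAt z (z1 x) x)
    (h2 : ∀ x ∈ Set.Ioo (-R) R, HasDerivAt z1 (z2 x) x)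
    (hz : ∀ x ∈ Set.Ioo (-R) R, Λ ^ 2 * z x ≤ z2 x)
    (ha : z (-R) ≤ 0) (hb : z R ≤ 0) : ∀ x ∈ Set.Icc (-R) R, z x ≤ 0 := by
  obtain ⟨x0, hx0, hmax⟩ := isCompact_Icc.exists_isMaxOn ⟨0, by constructor <;> linarith⟩ hc
  suffices h : z x0 ≤ 0 from fun x hx => (hmax hx).trans h
  rcases eq_or_lt_of_le hx0.1 with hl | hl
  · rw [← hl]; exact ha
  rcases eq_or_lt_of_le hx0.2 with hr | hr
  · rw [hr]; exact hb
  have := (snd_deriv_nonpos_of_max ⟨hl, hr⟩ h1 (h2 x0 ⟨hl, hr⟩)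
    (fun z hz => hmax (Set.Ioo_subset_Icc_self hz))).2
  have h3 := hz x0 ⟨hl, hr⟩
  have h4 : 0 < Λ ^ 2 := by positivity
  by_contra hc
  push Not at hc
  nlinarith [mul_pos h4 hc]

lemma linS_tendsto {Λ R B : ℝ} {g : ℕ → ℝ → ℝ} {G : ℝ → ℝ} (hg : ∀ k, Continuous (g k))
    (hB : ∀ k x, |g k x| ≤ B) (hlim : ∀ x, Filter.Tendsto (fun k => g k x) Filter.atTop (nhds (G x)))
    (x : ℝ) : Filter.Tendsto (fun k => linS Λ R (g k) x) Filter.atTop (nhds (linS Λ R G x)) := by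
  have aux : ∀ e : ℝ → ℝ, Continuous e → Filter.Tendsto (fun k => ∫ s in (-R)..x, e s * g k s)
      Filter.atTop (nhds (∫ s in (-R)..x, e s * G s)) := by
    intro e he
    apply intervalIntegral.tendsto_integral_filter_of_dominated_convergence (fun s => |e s| * B)
    · exact Filter.Eventually.of_forall fun k => (he.mul (hg k)).aestronglyMeasurable
    · refine Filter.Eventually.of_forall fun k => Filter.Eventually.of_forall fun s _ => ?_
      rw [Real.norm_eq_abs, abs_mul]
      exact mul_le_mul_of_nonneg_left (hB k s) (abs_nonneg _)
    · exact (he.abs.mul continuous_const).intervalIntegrable _ _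
    · exact Filter.Eventually.of_forall fun s _ => (hlim s).const_mul _
  unfold linS
  exact ((((aux _ (by fun_prop)).const_mul _).sub ((aux _ (by fun_prop)).const_mul _)).div_const _)

lemma linT_tendsto {Λ R B a b : ℝ} {g : ℕ → ℝ → ℝ} {G : ℝ → ℝ} (hg : ∀ k, Continuous (g k))
    (hB : ∀ k x, |g k x| ≤ B) (hlim : ∀ x, Filter.Tendsto (fun k => g k x) Filter.atTop (nhds (G x)))
    (x : ℝ) : Filter.Tendsto (fun k => linT Λ R a b (g k) x) Filter.atTop (nhds (linT Λ R a b G x)) := by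
  unfold linT
  exact ((linS_tendsto hg hB hlim x).add_const _).add
    (((linS_tendsto hg hB hlim R).const_sub b).mul_const _)

lemma linT_continuous {Λ R B a b : ℝ} {G : ℝ → ℝ} (hm : Measurable G) (hB : ∀ x, |G x| ≤ B) :
    Continuous (linT Λ R a b G) := by
  have aux : ∀ e : ℝ → ℝ, Continuous e → Continuous fun x => ∫ s in (-R)..x, e s * G s := by
    intro e he
    apply continuous_primitive
    intro c d
    apply ((he.abs.mul (continuous_const (y := B))).intervalIntegrable c d).mono_fun
    · exact (he.measurable.mul hm).aestronglyMeasurable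
    · refine Filter.Eventually.of_forall fun s => ?_
      simp only [Pi.mul_apply, Real.norm_eq_abs, abs_mul, abs_abs]
      exact mul_le_mul_of_nonneg_left ((hB s).trans (le_abs_self _)) (abs_nonneg _)
  have a1 := aux (fun s => exp (-(Λ * s))) (by fun_prop)
  have a2 := aux (fun s => exp (Λ * s)) (by fun_prop)
  unfold linT
  have h1 : Continuous (linS Λ R G) := by
    unfold linS
    fun_prop
  fun_prop

end

end

section
/-- clamp to `[-R,R]` -/
noncomputable def clampR (R x : ℝ) : ℝ := max (-R) (min x R)

lemma clampR_mem {R : ℝ} (hR : 0 < R) (x : ℝ) : clampR R x ∈ Set.Icc (-R) R := by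
  unfold clampR
  exact ⟨le_max_left _ _, max_le (by linarith) (min_le_right _ _)⟩

lemma clampR_eq {R x : ℝ} (hx : x ∈ Set.Icc (-R) R) : clampR R x = x := by
  unfold clampR
  rw [min_eq_left hx.2, max_eq_right hx.1]

lemma clampR_cont (R : ℝ) : Continuous (clampR R) := by
  unfold clampR; fun_prop

/-- monotone iteration -/
noncomputable def bvpIter (Λ R a b : ℝ) (F : ℝ → ℝ → ℝ) : ℕ → ℝ → ℝ
  | 0 => fun _ => 1
  | k + 1 => fun x => linT Λ R a b (fun s => F (clampR R s) (bvpIter Λ R a b F k s)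
      - Λ ^ 2 * bvpIter Λ R a b F k s) (clampR R x)

theorem bvp_exists {Λ R : ℝ} (hΛ : 0 < Λ) (hR : 0 < R) (F : ℝ → ℝ → ℝ)
    (hF : Continuous (Function.uncurry F)) (α α1 α2 : ℝ → ℝ)
    (hα0 : ∀ x ∈ Set.Icc (-R) R, 0 ≤ α x)
    (hαc : ContinuousOn α (Set.Icc (-R) R))
    (hα1 : ∀ x ∈ Set.Ioo (-R) R, HasDerivAt α (α1 x) x)
    (hα2 : ∀ x ∈ Set.Ioo (-R) R, HasDerivAt α1 (α2 x) x)
    (hαle : ∀ x ∈ Set.Icc (-R) R, α x ≤ 1)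
    (hsub : ∀ x ∈ Set.Ioo (-R) R, F x (α x) ≤ α2 x)
    (hsup : ∀ x ∈ Set.Ioo (-R) R, 0 ≤ F x 1)
    (hmono : ∀ x ∈ Set.Icc (-R) R, ∀ s t, α x ≤ s → s ≤ t → t ≤ 1 →
      F x t - Λ ^ 2 * t ≤ F x s - Λ ^ 2 * s) :
    ∃ w w1 : ℝ → ℝ, ContinuousOn w (Set.Icc (-R) R) ∧
      (∀ x ∈ Set.Ioo (-R) R, HasDerivAt w (w1 x) x) ∧
      (∀ x ∈ Set.Ioo (-R) R, HasDerivAt w1 (F x (w x)) x) ∧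
      (∀ x ∈ Set.Icc (-R) R, α x ≤ w x ∧ w x ≤ 1) ∧ w (-R) = α (-R) ∧ w R = α R := by
  have hcl := clampR_cont R
  have hmem := clampR_mem hR
  set W := bvpIter Λ R (α (-R)) (α R) F with hW
  set g : ℕ → ℝ → ℝ := fun k s => F (clampR R s) (W k s) - Λ ^ 2 * W k s with hgdef
  have hWs : ∀ k x, W (k+1) x = linT Λ R (α (-R)) (α R) (g k) (clampR R x) := fun k x => rfl
  have hW0 : ∀ x, W 0 x = 1 := fun x => rfl
  have hgc_of : ∀ k, Continuous (W k) → Continuous (g k) := fun k hk => by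
    have : Continuous fun s => F (clampR R s) (W k s) := hF.comp (hcl.prodMk hk)
    exact this.sub (continuous_const.mul hk)
  have hWc : ∀ k, Continuous (W k) := by
    intro k
    induction k with
    | zero => exact continuous_const
    | succ k ih =>
      have : Continuous (linT Λ R (α (-R)) (α R) (g k)) :=
        continuous_iff_continuousAt.2 fun x => (linT_deriv hΛ R _ _ (hgc_of k ih) x).continuousAt
      exact this.comp hcl
  have hgc : ∀ k, Continuous (g k) := fun k => hgc_of k (hWc k)
  have hTc : ∀ k, Continuous (linT Λ R (α (-R)) (α R) (g k)) := fun k =>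
    continuous_iff_continuousAt.2 fun x => (linT_deriv hΛ R _ _ (hgc k) x).continuousAt
  have hWeq : ∀ k, ∀ x ∈ Set.Icc (-R) R, W (k+1) x = linT Λ R (α (-R)) (α R) (g k) x := by
    intro k x hx; rw [hWs, clampR_eq hx]
  have hgeq : ∀ k, ∀ x ∈ Set.Icc (-R) R, g k x = F x (W k x) - Λ ^ 2 * W k x := by
    intro k x hx; simp only [hgdef]; rw [clampR_eq hx]
  have hends := fun k => linT_ends hΛ hR (α (-R)) (α R) (g k)
  have hl : (-R) ∈ Set.Icc (-R) R := ⟨le_refl _, by linarith⟩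
  have hr : R ∈ Set.Icc (-R) R := ⟨by linarith, le_refl _⟩
  -- lower bound step
  have hlow : ∀ k, (∀ x ∈ Set.Icc (-R) R, α x ≤ W k x ∧ W k x ≤ 1) →
      ∀ x ∈ Set.Icc (-R) R, α x ≤ W (k+1) x := by
    intro k hk x hx
    have := lin_max hΛ hR (z := fun x => α x - linT Λ R (α (-R)) (α R) (g k) x)
      (hαc.sub (hTc k).continuousOn)
      (fun x hx => (hα1 x hx).sub (linT_deriv hΛ R _ _ (hgc k) x))
      (fun x hx => (hα2 x hx).sub (linT1_deriv hΛ R _ _ (hgc k) x))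
      (fun x hx => by
        have hx' := Set.Ioo_subset_Icc_self hx
        have h1 := hsub x hx
        have h2 := hmono x hx' (α x) (W k x) le_rfl (hk x hx').1 (hk x hx').2
        rw [hgeq k x hx']; linarith)
      (by rw [(hends k).1]; linarith) (by rw [(hends k).2]; linarith) x hx
    rw [hWeq k x hx]; linarith
  have hstep : ∀ k, (∀ x ∈ Set.Icc (-R) R, α x ≤ W k x ∧ W k x ≤ 1) ∧
      (∀ x ∈ Set.Icc (-R) R, W (k+1) x ≤ W k x) := by
    intro k
    induction k with
    | zero =>
      refine ⟨fun x hx => ⟨hαle x hx, le_refl _⟩, fun x hx => ?_⟩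
      have := lin_max hΛ hR (z := fun x => linT Λ R (α (-R)) (α R) (g 0) x - 1)
        ((hTc 0).continuousOn.sub continuousOn_const)
        (fun x hx => (linT_deriv hΛ R _ _ (hgc 0) x).sub_const 1)
        (fun x hx => (linT1_deriv hΛ R _ _ (hgc 0) x))
        (fun x hx => by
          have hx' := Set.Ioo_subset_Icc_self hx
          have h1 := hsup x hx
          rw [hgeq 0 x hx', hW0]; linarith)
        (by rw [(hends 0).1]; linarith [hαle _ hl]) (by rw [(hends 0).2]; linarith [hαle _ hr]) x hx
      rw [hWeq 0 x hx, hW0]; linarith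
    | succ k ih =>
      have hb : ∀ x ∈ Set.Icc (-R) R, α x ≤ W (k+1) x ∧ W (k+1) x ≤ 1 := fun x hx =>
        ⟨hlow k ih.1 x hx, (ih.2 x hx).trans (ih.1 x hx).2⟩
      refine ⟨hb, fun x hx => ?_⟩
      have := lin_max hΛ hR (z := fun x => linT Λ R (α (-R)) (α R) (g (k+1)) x -
          linT Λ R (α (-R)) (α R) (g k) x)
        ((hTc (k+1)).continuousOn.sub (hTc k).continuousOn)
        (fun x hx => (linT_deriv hΛ R _ _ (hgc (k+1)) x).sub (linT_deriv hΛ R _ _ (hgc k) x))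
        (fun x hx => (linT1_deriv hΛ R _ _ (hgc (k+1)) x).sub (linT1_deriv hΛ R _ _ (hgc k) x))
        (fun x hx => by
          have hx' := Set.Ioo_subset_Icc_self hx
          have h2 := hmono x hx' (W (k+1) x) (W k x) (hb x hx').1 (ih.2 x hx') (ih.1 x hx').2
          rw [hgeq (k+1) x hx', hgeq k x hx']; linarith)
        (by rw [(hends k).1, (hends (k+1)).1]; linarith)
        (by rw [(hends k).2, (hends (k+1)).2]; linarith) x hx
      rw [hWeq (k+1) x hx, hWeq k x hx]; linarith
  have hWcl : ∀ k x, W k x = W k (clampR R x) := by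
    intro k x
    cases k with
    | zero => rfl
    | succ k => rw [hWs, hWs, clampR_eq (hmem x)]
  have hanti : ∀ x, Antitone fun k => W k x := by
    intro x
    apply antitone_nat_of_succ_le
    intro k
    rw [hWcl k, hWcl (k+1)]
    exact (hstep k).2 _ (hmem x)
  have hbd : ∀ x, ∀ k, 0 ≤ W k x ∧ W k x ≤ 1 := by
    intro x k
    rw [hWcl k]
    exact ⟨(hα0 _ (hmem x)).trans ((hstep k).1 _ (hmem x)).1, ((hstep k).1 _ (hmem x)).2⟩
  have hlim : ∀ x, ∃ l, Filter.Tendsto (fun k => W k x) Filter.atTop (nhds l) := fun x =>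
    ⟨_, tendsto_atTop_ciInf (hanti x) ⟨0, by rintro _ ⟨k, rfl⟩; exact (hbd x k).1⟩⟩
  choose w hw using hlim
  have hwm : Measurable w := measurable_of_tendsto_metrizable (fun k => (hWc k).measurable)
    (tendsto_pi_nhds.2 hw)
  set G : ℝ → ℝ := fun s => F (clampR R s) (w s) - Λ ^ 2 * w s with hG
  have hglim : ∀ x, Filter.Tendsto (fun k => g k x) Filter.atTop (nhds (G x)) := by
    intro x
    have h1 : Continuous fun t => F (clampR R x) t := hF.comp (continuous_const.prodMk continuous_id)
    exact ((h1.tendsto _).comp (hw x)).sub ((hw x).const_mul _)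
  have hBex : ∃ B, ∀ y ∈ (Set.Icc (-R) R) ×ˢ (Set.Icc (0:ℝ) 1),
      ‖(fun y : ℝ × ℝ => F y.1 y.2 - Λ ^ 2 * y.2) y‖ ≤ B := by
    apply (isCompact_Icc.prod isCompact_Icc).exists_bound_of_continuousOn
    have : Continuous fun y : ℝ × ℝ => F y.1 y.2 := hF
    fun_prop
  obtain ⟨B, hB⟩ := hBex
  have hgB : ∀ k x, |g k x| ≤ B := fun k x => hB (clampR R x, W k x) ⟨hmem x, hbd x k⟩
  have hGB : ∀ x, |G x| ≤ B := fun x =>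
    le_of_tendsto (hglim x).abs (Filter.Eventually.of_forall fun k => hgB k x)
  have hGm : Measurable G := by
    have : Measurable fun s => F (clampR R s) (w s) :=
      hF.measurable.comp (hcl.measurable.prodMk hwm)
    exact this.sub (hwm.const_mul _)
  have hweq : ∀ x, w x = linT Λ R (α (-R)) (α R) G (clampR R x) := fun x =>
    tendsto_nhds_unique ((Filter.tendsto_add_atTop_iff_nat 1).2 (hw x))
      (linT_tendsto hgc hgB hglim (clampR R x))
  have hwc : Continuous w := by
    have h1 : Continuous (linT Λ R (α (-R)) (α R) G) := linT_continuous hGm hGB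
    have : w = (linT Λ R (α (-R)) (α R) G) ∘ clampR R := funext hweq
    rw [this]; exact h1.comp hcl
  have hGc : Continuous G := by
    have : Continuous fun s => F (clampR R s) (w s) := hF.comp (hcl.prodMk hwc)
    exact this.sub (continuous_const.mul hwc)
  have hweq' : ∀ x ∈ Set.Icc (-R) R, w x = linT Λ R (α (-R)) (α R) G x := by
    intro x hx; rw [hweq, clampR_eq hx]
  refine ⟨w, linT1 Λ R (α (-R)) (α R) G, hwc.continuousOn, ?_, ?_, ?_, ?_, ?_⟩
  · intro x hx
    refine (linT_deriv hΛ R _ _ hGc x).congr_of_eventuallyEq ?_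
    filter_upwards [Ioo_mem_nhds hx.1 hx.2] with z hz
    exact hweq' z (Set.Ioo_subset_Icc_self hz)
  · intro x hx
    have hx' := Set.Ioo_subset_Icc_self hx
    refine (linT1_deriv hΛ R _ _ hGc x).congr_deriv ?_
    rw [← hweq' x hx']
    simp only [hG]; rw [clampR_eq hx']; ring
  · intro x hx
    exact ⟨ge_of_tendsto' (hw x) fun k => ((hstep k).1 x hx).1,
      le_of_tendsto' (hw x) fun k => ((hstep k).1 x hx).2⟩
  · rw [hweq' _ hl, (linT_ends hΛ hR _ _ _).1]
  · rw [hweq' _ hr, (linT_ends hΛ hR _ _ _).2]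

end

section
lemma rpow_derivs {f f1 f2 : ℝ → ℝ} {R r : ℝ}
    (hpos : ∀ x ∈ Set.Ioo (-R) R, 0 < f x)
    (h1 : ∀ x ∈ Set.Ioo (-R) R, HasDerivAt f (f1 x) x)
    (h2 : ∀ x ∈ Set.Ioo (-R) R, HasDerivAt f1 (f2 x) x) :
    (∀ x ∈ Set.Ioo (-R) R, HasDerivAt (fun x => f x ^ r) (r * f x ^ r * f1 x / f x) x) ∧
    (∀ x ∈ Set.Ioo (-R) R, HasDerivAt (fun x => r * f x ^ r * f1 x / f x)
      (r * (r - 1) * f x ^ r * f1 x ^ 2 / f x ^ 2 + r * f x ^ r * f2 x / f x) x) := by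
  have A : ∀ x ∈ Set.Ioo (-R) R, HasDerivAt (fun x => f x ^ r) (r * f x ^ r * f1 x / f x) x := by
    intro x hx
    refine ((h1 x hx).rpow_const (p := r) (Or.inl (hpos x hx).ne')).congr_deriv ?_
    rw [Real.rpow_sub_one (hpos x hx).ne']
    ring
  refine ⟨A, fun x hx => ?_⟩
  have hf := (hpos x hx).ne'
  have h := (((A x hx).const_mul r).mul (h2 x hx)).div (h1 x hx) hf
  refine h.congr_deriv ?_
  simp only [Pi.mul_apply]
  field_simp
  ring

lemma rpow_diff_le {r s t : ℝ} (hr : 1 ≤ r) (hs : 0 ≤ s) (hst : s ≤ t) (ht : t ≤ 1) :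
    t ^ r - s ^ r ≤ r * (t - s) := by
  rcases eq_or_lt_of_le (hs.trans hst) with h0 | h0
  · have : s = 0 := by linarith
    rw [← h0, this]; simp
  have hb := one_add_mul_self_le_rpow_one_add (s := s / t - 1) (p := r)
    (by have : 0 ≤ s / t := by positivity
        linarith) hr
  have e : 1 + (s / t - 1) = s / t := by ring
  rw [e, Real.div_rpow hs h0.le, le_div_iff₀ (Real.rpow_pos_of_pos h0 r)] at hb
  have e2 : t ^ r = t ^ (r - 1) * t := by
    rw [Real.rpow_sub_one h0.ne']; field_simp
  have h1 : t ^ (r - 1) ≤ 1 := Real.rpow_le_one h0.le ht (by linarith)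
  have e3 : t ^ r - s ^ r ≤ r * (1 - s / t) * t ^ r := by linarith
  have e4 : r * (1 - s / t) * t ^ r = r * (t - s) * t ^ (r - 1) := by
    rw [e2]; field_simp
  rw [e4] at e3
  have : r * (t - s) * t ^ (r - 1) ≤ r * (t - s) * 1 :=
    mul_le_mul_of_nonneg_left h1 (mul_nonneg (by linarith) (by linarith))
  linarith

/-- right hand side for the transformed problem -/
noncomputable def stepF (m κ : ℝ) (uh : ℝ → ℝ) (x w : ℝ) : ℝ :=
  w - (1 + κ / m) * w * w ^ m + κ / m * uh x * (w * w ^ m * w ^ m)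

lemma stepF_mono {m κ B : ℝ} (hm : 0 < m) (hκ : 0 < κ) {uh : ℝ → ℝ} {x : ℝ} (h0 : 0 ≤ uh x)
    (hB : uh x ≤ B) {s t : ℝ} (hs : 0 ≤ s) (hst : s ≤ t) (ht : t ≤ 1) :
    stepF m κ uh x t - stepF m κ uh x s ≤ (1 + κ / m * B * (2 * m + 1)) * (t - s) := by
  have ht0 : 0 ≤ t := hs.trans hst
  have pw : ∀ w : ℝ, 0 ≤ w → w * w ^ m * w ^ m = w ^ (2 * m + 1) := by
    intro w hw
    have : w ^ (2 * m + 1) = w ^ m * w ^ m * w ^ (1:ℝ) := by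
      rw [← Real.rpow_add_of_nonneg hw hm.le hm.le, ← Real.rpow_add_of_nonneg hw (by linarith) (by norm_num)]
      congr 1; ring
    rw [this, Real.rpow_one]; ring
  have h1 : s * s ^ m ≤ t * t ^ m :=
    mul_le_mul hst (Real.rpow_le_rpow hs hst hm.le) (Real.rpow_nonneg hs _) ht0
  have h2 := rpow_diff_le (r := 2 * m + 1) (by linarith) hs hst ht
  have h3 : 0 ≤ κ / m := by positivity
  have h4 : κ / m * uh x * (t ^ (2 * m + 1) - s ^ (2 * m + 1)) ≤
      κ / m * B * ((2 * m + 1) * (t - s)) := by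
    have a1 : κ / m * uh x * (t ^ (2 * m + 1) - s ^ (2 * m + 1)) ≤
        κ / m * uh x * ((2 * m + 1) * (t - s)) := mul_le_mul_of_nonneg_left h2 (by positivity)
    have a2 : κ / m * uh x * ((2 * m + 1) * (t - s)) ≤ κ / m * B * ((2 * m + 1) * (t - s)) := by
      apply mul_le_mul_of_nonneg_right
      · exact mul_le_mul_of_nonneg_left hB h3
      · exact mul_nonneg (by linarith) (by linarith)
    linarith
  have h5 := mul_le_mul_of_nonneg_left h1 (show 0 ≤ 1 + κ / m by linarith)
  unfold stepF
  rw [pw t ht0, pw s hs]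
  linarith

theorem step_exists {p κ R : ℝ} (hp : 1 < p) (hκ : 0 < κ) (hR : 0 < R)
    (uh Φ Φ1 Φ2 : ℝ → ℝ) (huc : ContinuousOn uh (Set.Icc (-R) R))
    (hu1 : ∀ x ∈ Set.Icc (-R) R, 1 ≤ uh x)
    (hΦc : ContinuousOn Φ (Set.Icc (-R) R))
    (hΦ1 : ∀ x ∈ Set.Ioo (-R) R, HasDerivAt Φ (Φ1 x) x)
    (hΦ2 : ∀ x ∈ Set.Ioo (-R) R, HasDerivAt Φ1 (Φ2 x) x)
    (hΦge : ∀ x ∈ Set.Icc (-R) R, 1 ≤ Φ x)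
    (hsup : ∀ x ∈ Set.Ioo (-R) R, NN p (Φ x) (Φ1 x) (Φ2 x) ≤ κ * (Φ x - uh x)) :
    ∃ u u1 u2 : ℝ → ℝ, ContinuousOn u (Set.Icc (-R) R) ∧
      (∀ x ∈ Set.Ioo (-R) R, HasDerivAt u (u1 x) x) ∧
      (∀ x ∈ Set.Ioo (-R) R, HasDerivAt u1 (u2 x) x) ∧
      (∀ x ∈ Set.Ioo (-R) R, κ * (u x - uh x) = NN p (u x) (u1 x) (u2 x)) ∧
      (∀ x ∈ Set.Icc (-R) R, 1 ≤ u x ∧ u x ≤ Φ x) ∧ u (-R) = Φ (-R) ∧ u R = Φ R := by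
  obtain ⟨m, hm, rfl⟩ : ∃ m : ℝ, 0 < m ∧ p = m + 1 := ⟨p - 1, by linarith, by ring⟩
  have hpm : m + 1 - 1 = m := by ring
  have hcl := clampR_cont R
  have hIoo : Set.Ioo (-R) R ⊆ Set.Icc (-R) R := Set.Ioo_subset_Icc_self
  set uc : ℝ → ℝ := fun x => uh (clampR R x) with huc_def
  have hucc : Continuous uc := by
    have := huc.comp_continuous hcl (clampR_mem hR)
    exact this
  obtain ⟨B, hB⟩ := isCompact_Icc.exists_bound_of_continuousOn huc
  have hB0 : 0 ≤ B := (norm_nonneg _).trans (hB 0 ⟨by linarith, hR.le⟩)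
  have huceq : ∀ x ∈ Set.Icc (-R) R, uc x = uh x := by
    intro x hx; simp only [huc_def]; rw [clampR_eq hx]
  set Λ := Real.sqrt (1 + κ / m * B * (2 * m + 1)) with hΛdef
  have hpos1 : 0 < 1 + κ / m * B * (2 * m + 1) := by positivity
  have hΛ : 0 < Λ := Real.sqrt_pos.2 hpos1
  have hΛ2 : Λ ^ 2 = 1 + κ / m * B * (2 * m + 1) := Real.sq_sqrt hpos1.le
  have hΦpos : ∀ x ∈ Set.Icc (-R) R, 0 < Φ x := fun x hx => by linarith [hΦge x hx]
  have hrd := rpow_derivs (r := -(1/m)) (fun x hx => hΦpos x (hIoo hx)) hΦ1 hΦ2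
  have hFc : Continuous (Function.uncurry (stepF m κ uc)) := by
    have h1 : Continuous fun y : ℝ × ℝ => y.2 ^ m :=
      continuous_snd.rpow_const (fun _ => Or.inr hm.le)
    have h2 : Continuous fun y : ℝ × ℝ => uc y.1 := hucc.comp continuous_fst
    unfold stepF Function.uncurry
    fun_prop
  have hαm : ∀ x ∈ Set.Icc (-R) R, (Φ x ^ (-(1/m))) ^ m = 1 / Φ x := by
    intro x hx
    rw [← Real.rpow_mul (hΦpos x hx).le]
    have : -(1/m) * m = -1 := by field_simp
    rw [this, Real.rpow_neg_one, one_div]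
  obtain ⟨w, w1, hwc, hw1, hw2, hwb, hwl, hwr⟩ := bvp_exists hΛ hR (stepF m κ uc) hFc
    (fun x => Φ x ^ (-(1/m))) _ _
    (fun x hx => Real.rpow_nonneg (hΦpos x hx).le _)
    (hΦc.rpow_const fun x hx => Or.inl (hΦpos x hx).ne')
    hrd.1 hrd.2
    (fun x hx => Real.rpow_le_one_of_one_le_of_nonpos (hΦge x hx) (by
      have : 0 < 1 / m := by positivity
      linarith))
    (fun x hx => by
      have hx' := hIoo hx
      have hs := hsup x hx
      have hΦp := hΦpos x hx'
      have ha : 0 < Φ x ^ (-(1/m)) := Real.rpow_pos_of_pos hΦp _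
      unfold stepF
      rw [hαm x hx', huceq x hx']
      unfold NN at hs
      rw [hpm] at hs
      set a := Φ x ^ (-(1/m))
      have e : (-(1/m)) * (-(1/m) - 1) * a * Φ1 x ^ 2 / Φ x ^ 2 + (-(1/m)) * a * Φ2 x / Φ x
        - (a - (1 + κ / m) * a * (1 / Φ x) + κ / m * uh x * (a * (1 / Φ x) * (1 / Φ x)))
        = a / (m * Φ x ^ 2) * (κ * (Φ x - uh x) - (Φ x * Φ2 x - (m + 1) / m * Φ1 x ^ 2
          + m * (Φ x ^ 2 - Φ x))) := by
        field_simp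
        ring
      have h0 : 0 ≤ a / (m * Φ x ^ 2) * (κ * (Φ x - uh x) - (Φ x * Φ2 x - (m + 1) / m * Φ1 x ^ 2
          + m * (Φ x ^ 2 - Φ x))) := mul_nonneg (by positivity) (by linarith)
      linarith)
    (fun x hx => by
      unfold stepF
      rw [huceq x (hIoo hx), Real.one_rpow]
      have h1 := hu1 x (hIoo hx)
      have h2 : 0 < κ / m := by positivity
      nlinarith)
    (fun x hx s t has hst ht => by
      have h1 := hu1 x hx
      have := stepF_mono (uh := uc) (x := x) (B := B) hm hκ (by rw [huceq x hx]; linarith)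
        (by rw [huceq x hx]; exact (le_abs_self _).trans (hB x hx))
        ((Real.rpow_nonneg (hΦpos x hx).le _).trans has) hst ht
      rw [hΛ2]; linarith)
  have hwpos : ∀ x ∈ Set.Icc (-R) R, 0 < w x := fun x hx =>
    (Real.rpow_pos_of_pos (hΦpos x hx) _).trans_le (hwb x hx).1
  have hwd := rpow_derivs (r := -m) (fun x hx => hwpos x (hIoo hx)) hw1 hw2
  have hback : ∀ x ∈ Set.Icc (-R) R, (Φ x ^ (-(1/m))) ^ (-m) = Φ x := by
    intro x hx
    rw [← Real.rpow_mul (hΦpos x hx).le]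
    have : -(1/m) * -m = 1 := by field_simp
    rw [this, Real.rpow_one]
  refine ⟨fun x => w x ^ (-m), _, _, hwc.rpow_const fun x hx => Or.inl (hwpos x hx).ne',
    hwd.1, hwd.2, ?_, ?_, ?_, ?_⟩
  · intro x hx
    have hx' := hIoo hx
    have hw := hwpos x hx'
    have hwm : 0 < w x ^ (-m) := Real.rpow_pos_of_pos hw _
    have e : w x ^ m = 1 / (w x ^ (-m)) := by
      rw [Real.rpow_neg hw.le]; simp
    unfold NN stepF
    rw [huceq x hx', e, hpm]
    set u := w x ^ (-m)
    field_simp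
    ring
  · intro x hx
    refine ⟨Real.one_le_rpow_of_pos_of_le_one_of_nonpos (hwpos x hx) (hwb x hx).2 (by linarith), ?_⟩
    have h1 := Real.rpow_le_rpow_of_nonpos (Real.rpow_pos_of_pos (hΦpos x hx) (-(1/m))) (hwb x hx).1
      (show -m ≤ 0 by linarith)
    rw [hback x hx] at h1
    exact h1
  · show w (-R) ^ (-m) = _
    rw [hwl]; exact hback _ ⟨le_refl _, by linarith⟩
  · show w R ^ (-m) = _
    rw [hwr]; exact hback _ ⟨by linarith, le_refl _⟩

end

section
open scoped ContDiff

lemma ode_smooth {s : Set ℝ} (hs : IsOpen s) {f f1 f2 g : ℝ → ℝ} {a b d e : ℝ}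
    (h1 : ∀ x ∈ s, HasDerivAt f (f1 x) x) (h2 : ∀ x ∈ s, HasDerivAt f1 (f2 x) x)
    (hf : ∀ x ∈ s, f x ≠ 0) (hg : ContDiffOn ℝ ∞ g s)
    (heq : ∀ x ∈ s, f x * f2 x = a * f1 x ^ 2 + b * f1 x + d * f x ^ 2 + e * f x + g x) :
    ContDiffOn ℝ ∞ f s := by
  have h2' : ∀ x ∈ s, f2 x = (a * f1 x ^ 2 + b * f1 x + d * f x ^ 2 + e * f x + g x) / f x := by
    intro x hx
    rw [eq_div_iff (hf x hx), ← heq x hx]; ring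
  have key : ∀ n : ℕ, ContDiffOn ℝ n f s ∧ ContDiffOn ℝ n f1 s := by
    intro n
    induction n with
    | zero =>
      simp only [Nat.cast_zero, contDiffOn_zero]
      exact ⟨fun x hx => (h1 x hx).continuousAt.continuousWithinAt,
        fun x hx => (h2 x hx).continuousAt.continuousWithinAt⟩
    | succ n ih =>
      have hgn : ContDiffOn ℝ n g s := hg.of_le (by exact_mod_cast le_top)
      have hf2 : ContDiffOn ℝ n f2 s := by
        have : ContDiffOn ℝ n (fun x => (a * f1 x ^ 2 + b * f1 x + d * f x ^ 2 + e * f x + g x) / f x) s := by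
          apply ContDiffOn.div _ ih.1 hf
          exact ((((contDiffOn_const.mul (ih.2.pow 2)).add (contDiffOn_const.mul ih.2)).add
            (contDiffOn_const.mul (ih.1.pow 2))).add (contDiffOn_const.mul ih.1)).add hgn
        exact this.congr h2'
      have e1 : ∀ x ∈ s, deriv f x = f1 x := fun x hx => (h1 x hx).deriv
      have e2 : ∀ x ∈ s, deriv f1 x = f2 x := fun x hx => (h2 x hx).deriv
      push_cast
      constructor
      · rw [contDiffOn_succ_iff_deriv_of_isOpen hs]
        refine ⟨fun x hx => (h1 x hx).differentiableAt.differentiableWithinAt, by simp, ih.2.congr e1⟩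
      · rw [contDiffOn_succ_iff_deriv_of_isOpen hs]
        refine ⟨fun x hx => (h2 x hx).differentiableAt.differentiableWithinAt, by simp, hf2.congr e2⟩
  rw [contDiffOn_infty]
  exact fun n => (key n).1

lemma smooth_iter {s : Set ℝ} (hs : IsOpen s) {f : ℝ → ℝ} (hf : ContDiffOn ℝ ∞ f s) (i : ℕ) :
    ContDiffOn ℝ ∞ (iteratedDeriv i f) s ∧
    ∀ x ∈ s, HasDerivAt (iteratedDeriv i f) (iteratedDeriv (i+1) f x) x := by
  have A : ∀ i, ContDiffOn ℝ ∞ (iteratedDeriv i f) s := by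
    intro i
    induction i with
    | zero => simpa using hf
    | succ i ih =>
      rw [iteratedDeriv_succ]
      exact ih.deriv_of_isOpen hs (by simp)
  refine ⟨A i, fun x hx => ?_⟩
  rw [iteratedDeriv_succ]
  exact (((A i).contDiffAt (hs.mem_nhds hx)).differentiableAt (by simp)).hasDerivAt

theorem rothe_exists {p κ R : ℝ} (hp : 1 < p) (hκ : 0 < κ) (hR : 0 < R) (Φ : ℕ → ℝ → ℝ)
    (hΦ : ∀ j, ContDiff ℝ ∞ (Φ j)) (J : ℕ)
    (hge : ∀ j ≤ J, ∀ x ∈ Set.Icc (-R) R, 1 ≤ Φ j x)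
    (hsup : ∀ j, j + 1 ≤ J → ∀ x ∈ Set.Ioo (-R) R,
      NN p (Φ (j+1) x) (deriv (Φ (j+1)) x) (deriv (deriv (Φ (j+1))) x) ≤
        κ * (Φ (j+1) x - Φ j x)) :
    ∃ U : ℕ → ℝ → ℝ, RotheFam p κ R J (fun i j => iteratedDeriv i (U j)) ∧
      (∀ j ≤ J, ContinuousOn (U j) (Set.Icc (-R) R)) ∧
      (∀ j ≤ J, ∀ x ∈ Set.Icc (-R) R, 1 ≤ U j x ∧ U j x ≤ Φ j x) ∧
      (∀ j ≤ J, U j (-R) = Φ j (-R) ∧ U j R = Φ j R) ∧ U 0 = Φ 0 := by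
  have main : ∀ K ≤ J, ∃ U : ℕ → ℝ → ℝ,
      (∀ j ≤ K, ContDiffOn ℝ ∞ (U j) (Set.Ioo (-R) R) ∧ ContinuousOn (U j) (Set.Icc (-R) R) ∧
        (∀ x ∈ Set.Icc (-R) R, 1 ≤ U j x ∧ U j x ≤ Φ j x) ∧ U j (-R) = Φ j (-R) ∧ U j R = Φ j R) ∧
      (∀ j, j + 1 ≤ K → ∀ x ∈ Set.Ioo (-R) R, κ * (U (j+1) x - U j x) =
        NN p (U (j+1) x) (deriv (U (j+1)) x) (deriv (deriv (U (j+1))) x)) ∧ U 0 = Φ 0 := by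
    intro K
    induction K with
    | zero =>
      intro _
      refine ⟨fun _ => Φ 0, ?_, ?_, rfl⟩
      · intro j hj
        have : j = 0 := by omega
        subst this
        exact ⟨(hΦ 0).contDiffOn, (hΦ 0).continuous.continuousOn,
          fun x hx => ⟨hge 0 (Nat.zero_le _) x hx, le_refl _⟩, rfl, rfl⟩
      · intro j hj; omega
    | succ K ih =>
      intro hK
      obtain ⟨U, hU, hUe, hU0⟩ := ih (by omega)
      obtain ⟨hKs, hKc, hKb, -, -⟩ := hU K le_rfl
      have hd : ∀ x, HasDerivAt (Φ (K+1)) (deriv (Φ (K+1)) x) x := fun x =>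
        ((hΦ (K+1)).differentiable (by simp) x).hasDerivAt
      have hd2 : ∀ x, HasDerivAt (deriv (Φ (K+1))) (deriv (deriv (Φ (K+1))) x) x := fun x => by
        have h := (smooth_iter isOpen_univ (hΦ (K+1)).contDiffOn 1).2 x trivial
        simpa [iteratedDeriv_succ, iteratedDeriv_one] using h
      obtain ⟨u, u1, u2, huc, hu1, hu2, hue, hub, hul, hur⟩ := step_exists hp hκ hR (U K) (Φ (K+1))
        _ _ hKc (fun x hx => (hKb x hx).1) (hΦ (K+1)).continuous.continuousOn
        (fun x _ => hd x) (fun x _ => hd2 x) (hge (K+1) hK)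
        (fun x hx => (hsup K hK x hx).trans (by
          have := (hKb x (Set.Ioo_subset_Icc_self hx)).2
          gcongr))
      have hdu : ∀ x ∈ Set.Ioo (-R) R, deriv u x = u1 x := fun x hx => (hu1 x hx).deriv
      have hddu : ∀ x ∈ Set.Ioo (-R) R, deriv (deriv u) x = u2 x := fun x hx => by
        have : deriv u =ᶠ[nhds x] u1 := by
          filter_upwards [Ioo_mem_nhds hx.1 hx.2] with z hz using hdu z hz
        rw [this.deriv_eq, (hu2 x hx).deriv]
      have hus : ContDiffOn ℝ ∞ u (Set.Ioo (-R) R) := by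
        refine ode_smooth isOpen_Ioo (a := p / (p - 1)) (b := 0) (d := -(p - 1)) (e := κ + (p - 1))
          (g := fun x => -κ * U K x) hu1 hu2
          (fun x hx => by have := (hub x (Set.Ioo_subset_Icc_self hx)).1; positivity)
          (contDiffOn_const.mul hKs) ?_
        intro x hx
        have := hue x hx
        unfold NN at this
        linarith
      refine ⟨fun j => if j = K + 1 then u else U j, ?_, ?_, ?_⟩
      · intro j hj
        by_cases h : j = K + 1
        · subst h
          simp only [if_true]
          exact ⟨hus, huc, hub, hul, hur⟩
        · simp only [h, if_false]
          exact hU j (by omega)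
      · intro j hj x hx
        by_cases h : j = K
        · subst h
          have h2 : ¬ (j = j + 1) := by omega
          simp only [if_true, h2, if_false]
          rw [hdu x hx, hddu x hx]
          exact hue x hx
        · have h1 : ¬ (j + 1 = K + 1) := by omega
          have h2 : ¬ (j = K + 1) := by omega
          simp only [h1, h2, if_false]
          exact hUe j (by omega) x hx
      · have h2 : ¬ (0 = K + 1) := by omega
        simp only [h2, if_false]
        exact hU0
  obtain ⟨U, hU, hUe, hU0⟩ := main J le_rfl
  refine ⟨U, ⟨?_, ?_⟩, fun j hj => (hU j hj).2.1, fun j hj => (hU j hj).2.2.1,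
    fun j hj => (hU j hj).2.2.2, hU0⟩
  · intro i _ j hj x hx
    exact (smooth_iter isOpen_Ioo (hU j hj).1 i).2 x hx
  · intro j hj x hx
    have := hUe j hj x hx
    simpa [iteratedDeriv_succ, iteratedDeriv_zero, iteratedDeriv_one] using this

end

section
/-- A space-time function with its first derivatives, jointly continuous for `t ≤ τ`. -/
structure Barr (τ : ℝ) (φ φt φx φxx : ℝ → ℝ → ℝ) : Prop where
  dx : ∀ t ≤ τ, ∀ x, HasDerivAt (fun y => φ y t) (φx x t) x
  dxx : ∀ t ≤ τ, ∀ x, HasDerivAt (fun y => φx y t) (φxx x t) x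
  dt : ∀ t ≤ τ, ∀ x, HasDerivAt (fun s => φ x s) (φt x t) t
  c : ContinuousOn (Function.uncurry φ) (Set.univ ×ˢ Set.Iic τ)
  ct : ContinuousOn (Function.uncurry φt) (Set.univ ×ˢ Set.Iic τ)
  cx : ContinuousOn (Function.uncurry φx) (Set.univ ×ˢ Set.Iic τ)
  cxx : ContinuousOn (Function.uncurry φxx) (Set.univ ×ˢ Set.Iic τ)

lemma time_disc {p R T0 τ : ℝ} (hp : 0 < p) {Ψ Ψt : ℝ → ℝ → ℝ} {G : ℝ × ℝ → ℝ}
    (hd : ∀ t ≤ τ, ∀ x, HasDerivAt (fun s => Ψ x s) (Ψt x t) t)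
    (hc : ContinuousOn (Function.uncurry Ψt) (Set.univ ×ˢ Set.Iic τ))
    (hG : ContinuousOn G (Set.univ ×ˢ Set.Iic τ))
    (hpos : ∀ x ∈ Set.Icc (-R) R, ∀ t ∈ Set.Icc T0 τ, 0 < p * Ψt x t + G (x, t)) :
    ∃ h0 > 0, ∀ h, 0 < h → h < h0 → ∀ t, T0 ≤ t - h → t ≤ τ → ∀ x ∈ Set.Icc (-R) R,
      0 < p * (Ψ x t - Ψ x (t - h)) + h * G (x, t) := by
  set K : Set (ℝ × ℝ) := Set.Icc (-R) R ×ˢ Set.Icc T0 τ with hK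
  have hKc : IsCompact K := isCompact_Icc.prod isCompact_Icc
  have hKs : K ⊆ Set.univ ×ˢ Set.Iic τ := fun y hy => ⟨trivial, hy.2.2⟩
  rcases K.eq_empty_or_nonempty with hne | hne
  · refine ⟨1, one_pos, fun h h1 _ t ht1 ht2 x hx => ?_⟩
    have : (x, t) ∈ K := ⟨hx, by linarith, ht2⟩
    rw [hne] at this; exact absurd this (Set.notMem_empty _)
  have hcont : ContinuousOn (fun y : ℝ × ℝ => p * Function.uncurry Ψt y + G y) K :=
    (continuousOn_const.mul (hc.mono hKs)).add (hG.mono hKs)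
  obtain ⟨y0, hy0, hmin⟩ := hKc.exists_isMinOn hne hcont
  set ε := p * Function.uncurry Ψt y0 + G y0 with hε
  have hεpos : 0 < ε := hpos y0.1 hy0.1 y0.2 hy0.2
  have huc := hKc.uniformContinuousOn_of_continuous (hc.mono hKs)
  rw [Metric.uniformContinuousOn_iff] at huc
  obtain ⟨δ, hδ, hu⟩ := huc (ε / p) (by positivity)
  refine ⟨δ, hδ, fun h h0 hh t ht1 ht2 x hx => ?_⟩
  obtain ⟨θ, hθ, hθe⟩ := exists_hasDerivAt_eq_slope (fun s => Ψ x s) (fun s => Ψt x s)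
    (show t - h < t by linarith)
    (fun s hs => (hd s (hs.2.trans ht2) x).continuousAt.continuousWithinAt)
    (fun s hs => hd s (hs.2.le.trans ht2) x)
  have e1 : Ψ x t - Ψ x (t - h) = h * Ψt x θ := by
    have e0 : t - (t - h) = h := by ring
    rw [hθe, e0]; field_simp
  have mθ : (x, θ) ∈ K := ⟨hx, by linarith [hθ.1], by linarith [hθ.2]⟩
  have mt : (x, t) ∈ K := ⟨hx, by linarith, ht2⟩
  have hdist := hu (x, θ) mθ (x, t) mt (by
    rw [Prod.dist_eq]
    simp only [dist_self, Real.dist_eq]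
    rw [max_eq_right (abs_nonneg _), abs_lt]
    constructor <;> linarith [hθ.1, hθ.2])
  rw [Real.dist_eq, abs_lt] at hdist
  have h3 : ε ≤ p * Ψt x t + G (x, t) := hmin mt
  simp only [Function.uncurry] at hdist
  have h4 : p * Ψt x t - ε < p * Ψt x θ := by
    have : Ψt x t < ε / p + Ψt x θ := by linarith [hdist.1]
    have h5 : p * Ψt x t < p * (ε / p + Ψt x θ) := mul_lt_mul_of_pos_left this hp
    have h6 : p * (ε / p + Ψt x θ) = ε + p * Ψt x θ := by field_simp
    linarith
  rw [e1]
  have h7 : 0 < p * Ψt x θ + G (x, t) := by linarith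
  have := mul_pos h0 h7
  linarith

/-- discrete comparison from below -/
lemma rothe_lower {p κ R : ℝ} (hR : 0 < R) {J : ℕ} {D : ℕ → ℕ → ℝ → ℝ}
    (H : RotheFam p κ R J D) (hDc : ∀ j ≤ J, ContinuousOn (D 0 j) (Set.Icc (-R) R))
    (hD1 : ∀ j ≤ J, ∀ x ∈ Set.Icc (-R) R, 1 ≤ D 0 j x)
    {φ φ1 φ2 : ℕ → ℝ → ℝ} (hφc : ∀ j ≤ J, ContinuousOn (φ j) (Set.Icc (-R) R))
    (hφ1 : ∀ j ≤ J, ∀ x ∈ Set.Ioo (-R) R, HasDerivAt (φ j) (φ1 j x) x)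
    (hφ2 : ∀ j ≤ J, ∀ x ∈ Set.Ioo (-R) R, HasDerivAt (φ1 j) (φ2 j x) x)
    (hsub : ∀ j, j + 1 ≤ J → ∀ x ∈ Set.Ioo (-R) R,
      κ * (φ (j+1) x - φ j x) ≤ NN p (φ (j+1) x) (φ1 (j+1) x) (φ2 (j+1) x))
    (hκ0 : 0 < κ)
    (hκ : ∀ j ≤ J, ∀ x ∈ Set.Ioo (-R) R, φ2 j x + (p - 1) * (φ j x + D 0 j x - 1) < κ)
    (hstart0 : ∀ x ∈ Set.Icc (-R) R, φ 0 x ≤ D 0 0 x)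
    (hbd : ∀ j ≤ J, φ j (-R) ≤ D 0 j (-R) ∧ φ j R ≤ D 0 j R) :
    ∀ j ≤ J, ∀ x ∈ Set.Icc (-R) R, φ j x ≤ D 0 j x := by
  intro j
  induction j with
  | zero => exact fun _ => hstart0
  | succ j ih =>
    intro hj
    have ih' := ih (by omega)
    obtain ⟨x0, hx0, hmax⟩ := isCompact_Icc.exists_isMaxOn (s := Set.Icc (-R) R)
      ⟨0, by constructor <;> linarith⟩ ((hφc (j+1) hj).sub (hDc (j+1) hj))
    suffices h : φ (j+1) x0 - D 0 (j+1) x0 ≤ 0 by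
      intro x hx
      have h1 : φ (j+1) x - D 0 (j+1) x ≤ φ (j+1) x0 - D 0 (j+1) x0 := hmax hx
      linarith
    rcases eq_or_lt_of_le hx0.1 with hl | hl
    · rw [← hl]; linarith [(hbd (j+1) hj).1]
    rcases eq_or_lt_of_le hx0.2 with hr | hr
    · rw [hr]; linarith [(hbd (j+1) hj).2]
    have hx : x0 ∈ Set.Ioo (-R) R := ⟨hl, hr⟩
    obtain ⟨g1, g2⟩ := snd_deriv_nonpos_of_max hx
      (f := fun x => φ (j+1) x - D 0 (j+1) x) (f1 := fun x => φ1 (j+1) x - D 1 (j+1) x)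
      (fun z hz => (hφ1 (j+1) hj z hz).sub (H.der 0 (by norm_num) (j+1) hj z hz))
      ((hφ2 (j+1) hj x0 hx).sub (H.der 1 (by norm_num) (j+1) hj x0 hx))
      (fun z hz => hmax (Set.Ioo_subset_Icc_self hz))
    have e1 := hsub j hj x0 hx
    have e2 := H.eqn j hj x0 hx
    have e3 := ih' x0 hx0
    have e4 := hκ (j+1) hj x0 hx
    have e5 := hD1 (j+1) hj x0 hx0
    have g1' : φ1 (j+1) x0 = D 1 (j+1) x0 := by linarith
    unfold NN at e1 e2
    rw [g1'] at e1
    simp only [Nat.reduceAdd] at g2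
    clear hmax hsub hφ1 hφ2 hφc hDc hD1 hκ hstart0 hbd ih ih'
    generalize φ (j+1) x0 = a at *
    generalize D 0 (j+1) x0 = b at *
    generalize φ2 (j+1) x0 = a2 at *
    generalize D 2 (j+1) x0 = b2 at *
    generalize D 1 (j+1) x0 = b1 at *
    generalize φ j x0 = a' at *
    generalize D 0 j x0 = b' at *
    by_contra hc
    push Not at hc
    have h1 : κ * (a - b) ≤ (a - b) * (a2 + (p - 1) * (a + b - 1)) + b * (a2 - b2) := by
      have : κ * (a' - b') ≤ 0 := mul_nonpos_of_nonneg_of_nonpos hκ0.le (by linarith)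
      linarith
    have h2 : b * (a2 - b2) ≤ 0 := mul_nonpos_of_nonneg_of_nonpos (by linarith) (by linarith)
    have h3 := mul_lt_mul_of_pos_left e4 hc
    linarith

end

section
open scoped ContDiff

lemma Barr.cNN {τ p : ℝ} {φ φt φx φxx : ℝ → ℝ → ℝ} (B : Barr τ φ φt φx φxx) :
    ContinuousOn (fun y : ℝ × ℝ => NN p (φ y.1 y.2) (φx y.1 y.2) (φxx y.1 y.2))
      (Set.univ ×ˢ Set.Iic τ) := by
  have h0 : ContinuousOn (fun y : ℝ × ℝ => φ y.1 y.2) (Set.univ ×ˢ Set.Iic τ) := B.c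
  have h1 : ContinuousOn (fun y : ℝ × ℝ => φx y.1 y.2) (Set.univ ×ˢ Set.Iic τ) := B.cx
  have h2 : ContinuousOn (fun y : ℝ × ℝ => φxx y.1 y.2) (Set.univ ×ˢ Set.Iic τ) := B.cxx
  unfold NN
  exact ((h0.mul h2).sub (continuousOn_const.mul (h1.pow 2))).add
    (continuousOn_const.mul ((h0.pow 2).sub h0))

lemma bound_on {τ R T0 : ℝ} {f : ℝ → ℝ → ℝ}
    (hf : ContinuousOn (Function.uncurry f) (Set.univ ×ˢ Set.Iic τ)) :
    ∃ C, 0 ≤ C ∧ ∀ x ∈ Set.Icc (-R) R, ∀ t ∈ Set.Icc T0 τ, |f x t| ≤ C := by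
  obtain ⟨C, hC⟩ := (isCompact_Icc.prod isCompact_Icc).exists_bound_of_continuousOn
    (s := Set.Icc (-R) R ×ˢ Set.Icc T0 τ) (hf.mono fun y hy => ⟨trivial, hy.2.2⟩)
  exact ⟨|C|, abs_nonneg _, fun x hx t ht => (hC (x, t) ⟨hx, ht⟩).trans (le_abs_self _)⟩

lemma sub_alg {p L e a at' ax axx : ℝ} (hp : 1 < p) (he : 0 < e)
    (heq : p * at' = NN p a ax axx) (hL : axx + (p - 1) * (2 * a - 1) < p * L) :
    0 < p * (-(at' - L * e)) + NN p (a - e) ax axx := by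
  unfold NN at *
  have h1 := mul_lt_mul_of_pos_right hL he
  have h2 : 0 ≤ (p - 1) * e ^ 2 := mul_nonneg (by linarith) (sq_nonneg _)
  nlinarith

theorem lower_stage {p τ R T0 ε B : ℝ} (hp : 1 < p) (hR : 0 < R) (hε : 0 < ε)
    {φ φt φx φxx : ℝ → ℝ → ℝ} (Bφ : Barr τ φ φt φx φxx)
    (hsol : ∀ x, ∀ t ≤ τ, p * φt x t = NN p (φ x t) (φx x t) (φxx x t)) :
    ∃ κ0 > 0, ∀ κ ≥ κ0, ∀ (J : ℕ) (D : ℕ → ℕ → ℝ → ℝ), RotheFam p κ R J D →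
      (∀ j ≤ J, ContinuousOn (D 0 j) (Set.Icc (-R) R)) →
      (∀ j ≤ J, ∀ x ∈ Set.Icc (-R) R, 1 ≤ D 0 j x ∧ D 0 j x ≤ B) →
      T0 + J * (p / κ) ≤ τ →
      (∀ x ∈ Set.Icc (-R) R, φ x T0 ≤ D 0 0 x) →
      (∀ j ≤ J, φ (-R) (T0 + j * (p / κ)) ≤ D 0 j (-R) ∧ φ R (T0 + j * (p / κ)) ≤ D 0 j R) →
      ∀ j ≤ J, ∀ x ∈ Set.Icc (-R) R, φ x (T0 + j * (p / κ)) - ε ≤ D 0 j x := by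
  have hp0 : 0 < p := by linarith
  obtain ⟨C, hC0, hC⟩ := bound_on (R := R) (T0 := T0) Bφ.c
  obtain ⟨C2, hC20, hC2⟩ := bound_on (R := R) (T0 := T0) Bφ.cxx
  set L := (C2 + (p - 1) * (2 * C) + 1) / p with hL
  have hpL : p * L = C2 + (p - 1) * (2 * C) + 1 := by rw [hL]; field_simp
  have hL0 : 0 < L := by
    have : 0 ≤ (p - 1) * (2 * C) := mul_nonneg (by linarith) (by linarith)
    rw [hL]; positivity
  set e : ℝ → ℝ := fun t => ε * Real.exp (L * (t - τ)) with he
  have he0 : ∀ t, 0 < e t := fun t => by positivity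
  have heε : ∀ t ≤ τ, e t ≤ ε := fun t ht => by
    have : Real.exp (L * (t - τ)) ≤ 1 := by
      rw [Real.exp_le_one_iff]; exact mul_nonpos_of_nonneg_of_nonpos hL0.le (by linarith)
    calc e t = ε * Real.exp (L * (t - τ)) := rfl
      _ ≤ ε * 1 := by gcongr
      _ = ε := mul_one _
  have hed : ∀ t, HasDerivAt e (L * e t) t := fun t => by
    have := ((((hasDerivAt_id t).sub_const τ).const_mul L).exp).const_mul ε
    exact this.congr_deriv (by simp [he]; ring)
  have hec : Continuous e := by simp only [he]; fun_prop
  have BφN : Barr τ (fun x t => φ x t - e t) (fun x t => φt x t - L * e t) φx φxx := by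
    refine ⟨fun t ht x => (Bφ.dx t ht x).sub_const _, Bφ.dxx,
      fun t ht x => (Bφ.dt t ht x).sub (hed t), ?_, ?_, Bφ.cx, Bφ.cxx⟩
    · exact Bφ.c.sub ((hec.comp continuous_snd).continuousOn)
    · exact Bφ.ct.sub ((continuous_const.mul (hec.comp continuous_snd)).continuousOn)
  obtain ⟨h0, hh0, hdisc⟩ := time_disc (p := p) (R := R) (T0 := T0) (τ := τ) hp0
    (Ψ := fun x t => -(φ x t - e t)) (Ψt := fun x t => -(φt x t - L * e t))
    (G := fun y => NN p (φ y.1 y.2 - e y.2) (φx y.1 y.2) (φxx y.1 y.2))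
    (fun t ht x => (BφN.dt t ht x).neg) BφN.ct.neg BφN.cNN
    (fun x hx t ht => by
      apply sub_alg hp (he0 t) (hsol x t ht.2)
      have a1 := (abs_le.1 (hC x hx t ht)).2
      have a2 := (abs_le.1 (hC2 x hx t ht)).2
      rw [hpL]
      have : (p - 1) * (2 * φ x t - 1) ≤ (p - 1) * (2 * C) :=
        mul_le_mul_of_nonneg_left (by linarith) (by linarith)
      linarith)
  refine ⟨max (p / h0 + 1) (C2 + (p - 1) * (C + |B|) + 1), ?_, ?_⟩
  · exact lt_max_of_lt_left (by positivity)
  intro κ hκ J D H hDc hD1 hJ hstart0 hbd j hj x hx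
  have hκ1 : p / h0 + 1 ≤ κ := (le_max_left _ _).trans hκ
  have hκ2 : C2 + (p - 1) * (C + |B|) + 1 ≤ κ := (le_max_right _ _).trans hκ
  have hκ0 : 0 < κ := by
    have : 0 < p / h0 := by positivity
    linarith
  set h := p / κ with hh
  have hhpos : 0 < h := by positivity
  have hhlt : h < h0 := by
    rw [hh, div_lt_iff₀ hκ0]
    have : p / h0 < κ := by linarith
    rw [div_lt_iff₀ hh0] at this; linarith
  have htj : ∀ j ≤ J, T0 + j * h ∈ Set.Icc T0 τ := by
    intro j hj
    have h1 : (j:ℝ) * h ≤ J * h := by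
      have : (j:ℝ) ≤ J := by exact_mod_cast hj
      gcongr
    have h2 : 0 ≤ (j:ℝ) * h := by positivity
    exact ⟨by linarith, by linarith⟩
  have hIoo : Set.Ioo (-R) R ⊆ Set.Icc (-R) R := Set.Ioo_subset_Icc_self
  have key := rothe_lower hR H hDc (fun j hj x hx => (hD1 j hj x hx).1)
    (φ := fun j x => φ x (T0 + j * h) - e (T0 + j * h))
    (φ1 := fun j x => φx x (T0 + j * h)) (φ2 := fun j x => φxx x (T0 + j * h))
    (fun j hj x _ => (BφN.dx _ (htj j hj).2 x).continuousAt.continuousWithinAt)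
    (fun j hj x _ => BφN.dx _ (htj j hj).2 x)
    (fun j hj x _ => BφN.dxx _ (htj j hj).2 x)
    (fun j hj x hx => by
      have e1 : T0 + ((j + 1 : ℕ) : ℝ) * h - h = T0 + j * h := by push_cast; ring
      have := hdisc h hhpos hhlt (T0 + ((j + 1 : ℕ) : ℝ) * h)
        (by rw [e1]; exact (htj j (by omega)).1) (htj (j+1) hj).2 x (hIoo hx)
      rw [e1] at this
      have e2 : κ * h = p := by rw [hh]; field_simp
      rw [← e2] at this
      have h3 : 0 < h * (κ * (-(φ x (T0 + ((j + 1 : ℕ) : ℝ) * h) - e (T0 + ((j + 1 : ℕ) : ℝ) * h)) -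
          -(φ x (T0 + j * h) - e (T0 + j * h))) + NN (κ * h) (φ x (T0 + ((j + 1 : ℕ) : ℝ) * h)
            - e (T0 + ((j + 1 : ℕ) : ℝ) * h)) (φx x (T0 + ((j + 1 : ℕ) : ℝ) * h))
            (φxx x (T0 + ((j + 1 : ℕ) : ℝ) * h))) := by
        linarith
      have h4 := pos_of_mul_pos_right h3 hhpos.le
      rw [e2] at h4
      linarith)
    hκ0
    (fun j hj x hx => by
      have a1 := (abs_le.1 (hC x (hIoo hx) _ (htj j hj))).2
      have a2 := (abs_le.1 (hC2 x (hIoo hx) _ (htj j hj))).2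
      have a3 := (hD1 j hj x (hIoo hx)).2.trans (le_abs_self _)
      have a4 := he0 (T0 + j * h)
      have : (p - 1) * (φ x (T0 + j * h) - e (T0 + j * h) + D 0 j x - 1) ≤ (p - 1) * (C + |B|) :=
        mul_le_mul_of_nonneg_left (by linarith) (by linarith)
      linarith)
    (fun x hx => by
      have := hstart0 x hx
      have a4 := he0 T0
      simp only [Nat.cast_zero, zero_mul, add_zero]
      linarith)
    (fun j hj => by
      have := hbd j hj
      have a4 := he0 (T0 + j * h)
      constructor <;> linarith [this.1, this.2])
    j hj x hx
  have a5 := heε _ (htj j hj).2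
  linarith

/-- One full approximation stage. -/
theorem stage {p τ R T0 ε : ℝ} (hp : 1 < p) (hR : 0 < R) (hε : 0 < ε) {ι : Type} [Finite ι]
    {Φ Φt Φx Φxx : ℝ → ℝ → ℝ} (BΦ : Barr τ Φ Φt Φx Φxx)
    (hsm : ∀ t ≤ τ, ContDiff ℝ ∞ (fun x => Φ x t))
    (hge : ∀ x, ∀ t ≤ τ, 1 ≤ Φ x t)
    (hsup : ∀ x, ∀ t ≤ τ, NN p (Φ x t) (Φx x t) (Φxx x t) < p * Φt x t)
    {φ φt φx φxx : ι → ℝ → ℝ → ℝ} (Bφ : ∀ i, Barr τ (φ i) (φt i) (φx i) (φxx i))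
    (hsol : ∀ i x, ∀ t ≤ τ, p * φt i x t = NN p (φ i x t) (φx i x t) (φxx i x t))
    (hle : ∀ i x, ∀ t ≤ τ, φ i x t ≤ Φ x t) :
    ∃ κ0 > 0, ∀ κ ≥ κ0, ∀ (J : ℕ), T0 + J * (p / κ) ≤ τ →
      ∃ U : ℕ → ℝ → ℝ, RotheFam p κ R J (fun i j => iteratedDeriv i (U j)) ∧
        (∀ j ≤ J, ∀ x ∈ Set.Icc (-R) R, 1 ≤ U j x ∧ U j x ≤ Φ x (T0 + j * (p / κ)) ∧
          ∀ i, φ i x (T0 + j * (p / κ)) - ε ≤ U j x) ∧ U 0 = fun x => Φ x T0 := by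
  have hp0 : 0 < p := by linarith
  obtain ⟨B, hB0, hB⟩ := bound_on (R := R) (T0 := T0) BΦ.c
  have hlow := fun i => lower_stage (T0 := T0) (B := B) hp hR hε (Bφ i) (hsol i)
  choose k0 hk0 hlow using hlow
  obtain ⟨Kb, hKb⟩ := (Set.finite_range k0).bddAbove
  obtain ⟨h0, hh0, hdisc⟩ := time_disc (p := p) (R := R) (T0 := T0) (τ := τ) hp0
    (G := fun y => -NN p (Φ y.1 y.2) (Φx y.1 y.2) (Φxx y.1 y.2))
    BΦ.dt BΦ.ct BΦ.cNN.neg (fun x _ t ht => by have := hsup x t ht.2; dsimp only; linarith)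
  refine ⟨max (p / h0 + 1) Kb, lt_max_of_lt_left (by positivity), ?_⟩
  intro κ hκ J hJ
  have hκ1 : p / h0 + 1 ≤ κ := (le_max_left _ _).trans hκ
  have hκ2 : Kb ≤ κ := (le_max_right _ _).trans hκ
  have hκ0 : 0 < κ := by
    have : 0 < p / h0 := by positivity
    linarith
  set h := p / κ with hh
  have hhpos : 0 < h := by positivity
  have hhlt : h < h0 := by
    rw [hh, div_lt_iff₀ hκ0]
    have : p / h0 < κ := by linarith
    rw [div_lt_iff₀ hh0] at this; linarith
  have htj : ∀ j ≤ J, T0 + j * h ∈ Set.Icc T0 τ := by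
    intro j hj
    have h1 : (j:ℝ) * h ≤ J * h := by
      have : (j:ℝ) ≤ J := by exact_mod_cast hj
      gcongr
    have h2 : 0 ≤ (j:ℝ) * h := by positivity
    exact ⟨by linarith, by linarith⟩
  -- freeze the barrier after step J so that it is smooth for every index
  set Ψ : ℕ → ℝ → ℝ := fun j x => Φ x (T0 + (min j J : ℕ) * h) with hΨ
  have hΨeq : ∀ j ≤ J, Ψ j = fun x => Φ x (T0 + j * h) := by
    intro j hj; simp only [hΨ]; rw [min_eq_left hj]
  have hIoo : Set.Ioo (-R) R ⊆ Set.Icc (-R) R := Set.Ioo_subset_Icc_self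
  obtain ⟨U, HU, hUc, hUb, hUe, hU0⟩ := rothe_exists hp hκ0 hR Ψ
    (fun j => hsm _ (htj _ (min_le_right _ _)).2) J
    (fun j hj x _ => by rw [hΨeq j hj]; exact hge x _ (htj j hj).2)
    (fun j hj x hx => by
      rw [hΨeq j (by omega), hΨeq (j+1) hj]
      have ht := (htj (j+1) hj).2
      have d1 : deriv (fun y => Φ y (T0 + ((j+1 : ℕ) : ℝ) * h)) =
          fun y => Φx y (T0 + ((j+1 : ℕ) : ℝ) * h) := funext fun y => (BΦ.dx _ ht y).deriv
      rw [d1, (BΦ.dxx _ ht x).deriv]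
      have e1 : T0 + ((j + 1 : ℕ) : ℝ) * h - h = T0 + j * h := by push_cast; ring
      have := hdisc h hhpos hhlt (T0 + ((j + 1 : ℕ) : ℝ) * h)
        (by rw [e1]; exact (htj j (by omega)).1) (htj (j+1) hj).2 x (hIoo hx)
      rw [e1] at this
      dsimp only at this ⊢
      have e2 : p = κ * h := by rw [hh]; field_simp
      generalize NN p (Φ x (T0 + ((j + 1 : ℕ) : ℝ) * h)) (Φx x (T0 + ((j + 1 : ℕ) : ℝ) * h))
        (Φxx x (T0 + ((j + 1 : ℕ) : ℝ) * h)) = N at *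
      rw [e2] at this
      have h3 : 0 < h * (κ * (Φ x (T0 + ((j + 1 : ℕ) : ℝ) * h) - Φ x (T0 + j * h)) - N) := by
        linarith
      have h4 := pos_of_mul_pos_right h3 hhpos.le
      linarith)
  have hl : (-R) ∈ Set.Icc (-R) R := ⟨le_refl _, by linarith⟩
  have hr : R ∈ Set.Icc (-R) R := ⟨by linarith, le_refl _⟩
  have hz : ∀ j, iteratedDeriv 0 (U j) = U j := fun j => iteratedDeriv_zero
  have hU0' : U 0 = fun x => Φ x T0 := by
    rw [hU0, hΨeq 0 (Nat.zero_le _)]; simp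
  refine ⟨U, HU, ?_, hU0'⟩
  intro j hj x hx
  have hb := hUb j hj x hx
  rw [hΨeq j hj] at hb
  refine ⟨hb.1, hb.2, fun i => ?_⟩
  have := hlow i κ ((hKb ⟨i, rfl⟩).trans hκ2) J _ HU
    (fun j hj => by simp only [hz]; exact hUc j hj)
    (fun j hj x hx => by
      simp only [hz]
      have hb := hUb j hj x hx
      rw [hΨeq j hj] at hb
      exact ⟨hb.1, hb.2.trans ((le_abs_self _).trans (hB x hx _ (htj j hj)))⟩)
    hJ
    (fun x hx => by
      simp only [hz]; rw [hU0']
      exact hle i x T0 (htj 0 (Nat.zero_le _) |>.2 |> fun h => by simpa using h))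
    (fun j hj => by
      simp only [hz]; rw [(hUe j hj).1, (hUe j hj).2, hΨeq j hj]
      exact ⟨hle i _ _ (htj j hj).2, hle i _ _ (htj j hj).2⟩)
    j hj x hx
  simpa only [hz] using this

end

section
lemma NN_bound {p M C : ℝ} (hp : 1 < p) (hC : 0 ≤ C) {a b c : ℝ} (ha : 1 ≤ a) (haM : a ≤ M)
    (hb : |b| ≤ C) (hc : |c| ≤ C) :
    |NN p a b c| ≤ M * C + p / (p - 1) * C ^ 2 + (p - 1) * M ^ 2 := by
  have hq : 0 < p / (p - 1) := div_pos (by linarith) (by linarith)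
  have h1 : |a * c| ≤ M * C := by
    rw [abs_mul, abs_of_nonneg (by linarith : 0 ≤ a)]
    exact mul_le_mul haM hc (abs_nonneg _) (by linarith)
  have h2 : b ^ 2 ≤ C ^ 2 := by
    rw [← sq_abs b]; exact pow_le_pow_left₀ (abs_nonneg _) hb 2
  have h3 : p / (p - 1) * b ^ 2 ≤ p / (p - 1) * C ^ 2 := mul_le_mul_of_nonneg_left h2 hq.le
  have h4 : 0 ≤ a ^ 2 - a ∧ a ^ 2 - a ≤ M ^ 2 := by
    constructor <;> nlinarith
  have h5 : (p - 1) * (a ^ 2 - a) ≤ (p - 1) * M ^ 2 :=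
    mul_le_mul_of_nonneg_left h4.2 (by linarith)
  have h6 : 0 ≤ (p - 1) * (a ^ 2 - a) := mul_nonneg (by linarith) h4.1
  have h7 : 0 ≤ p / (p - 1) * b ^ 2 := by positivity
  unfold NN
  rw [abs_le] at h1 ⊢
  have h8 : 0 ≤ (p - 1) * M ^ 2 := mul_nonneg (by linarith) (sq_nonneg _)
  have h9 : 0 ≤ p / (p - 1) * C ^ 2 := by positivity
  constructor <;> linarith [h1.1, h1.2]

lemma NN_lip {p M C : ℝ} (hp : 1 < p) (hC : 0 ≤ C) {a b c a' b' c' : ℝ}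
    (ha : 1 ≤ a) (haM : a ≤ M) (ha' : 1 ≤ a') (haM' : a' ≤ M)
    (hb : |b| ≤ C) (hb' : |b'| ≤ C) (hc' : |c'| ≤ C) {s : ℝ}
    (e0 : |a - a'| ≤ s) (e1 : |b - b'| ≤ s) (e2 : |c - c'| ≤ s) :
    |NN p a b c - NN p a' b' c'| ≤
      (M + C + p / (p - 1) * (2 * C) + (p - 1) * (2 * M + 1)) * s := by
  have hq : 0 < p / (p - 1) := div_pos (by linarith) (by linarith)
  have hs : 0 ≤ s := (abs_nonneg _).trans e0
  have h1 : |a * (c - c')| ≤ M * s := by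
    rw [abs_mul, abs_of_nonneg (by linarith : 0 ≤ a)]
    exact mul_le_mul haM e2 (abs_nonneg _) (by linarith)
  have h2 : |(a - a') * c'| ≤ s * C := by
    rw [abs_mul]; exact mul_le_mul e0 hc' (abs_nonneg _) hs
  have h3 : |p / (p - 1) * ((b + b') * (b - b'))| ≤ p / (p - 1) * (2 * C * s) := by
    rw [abs_mul, abs_of_pos hq]
    refine mul_le_mul_of_nonneg_left ?_ hq.le
    rw [abs_mul]
    exact mul_le_mul ((abs_add_le _ _).trans (by linarith)) e1 (abs_nonneg _) (by linarith)
  have h4 : |(p - 1) * ((a + a' - 1) * (a - a'))| ≤ (p - 1) * ((2 * M + 1) * s) := by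
    rw [abs_mul, abs_of_pos (by linarith : 0 < p - 1)]
    refine mul_le_mul_of_nonneg_left ?_ (by linarith)
    rw [abs_mul]
    refine mul_le_mul ?_ e0 (abs_nonneg _) (by linarith)
    rw [abs_le]; constructor <;> linarith
  have e : NN p a b c - NN p a' b' c' = a * (c - c') + (a - a') * c'
      - p / (p - 1) * ((b + b') * (b - b')) + (p - 1) * ((a + a' - 1) * (a - a')) := by
    unfold NN; ring
  rw [e]
  rw [abs_le] at *
  constructor <;> linarith [h1.1, h1.2, h2.1, h2.2, h3.1, h3.2, h4.1, h4.2]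

lemma lip_seg {ρ C : ℝ} {f f1 : ℝ → ℝ} (h1 : ∀ x, |x| ≤ ρ → HasDerivAt f (f1 x) x)
    (hb : ∀ x, |x| ≤ ρ → |f1 x| ≤ C) {x x' : ℝ} (hx : |x| ≤ ρ) (hx' : |x'| ≤ ρ) :
    |f x' - f x| ≤ C * |x' - x| := by
  have := (convex_Icc (-ρ) ρ).norm_image_sub_le_of_norm_hasDerivWithin_le (f := f) (f' := f1)
    (C := C) (fun y hy => (h1 y (abs_le.2 hy)).hasDerivWithinAt)
    (fun y hy => hb y (abs_le.2 hy)) (abs_le.1 hx) (abs_le.1 hx')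
  simpa using this

lemma taylor_seg {ρ C : ℝ} {f f1 f2 : ℝ → ℝ} (h1 : ∀ x, |x| ≤ ρ → HasDerivAt f (f1 x) x)
    (h2 : ∀ x, |x| ≤ ρ → HasDerivAt f1 (f2 x) x)
    (hb : ∀ x, |x| ≤ ρ → |f2 x| ≤ C) {x x' : ℝ} (hx : |x| ≤ ρ) (hx' : |x'| ≤ ρ) :
    |f x' - f x - f1 x * (x' - x)| ≤ C * |x' - x| ^ 2 := by
  have hsub : ∀ y ∈ Set.uIcc x x', |y| ≤ ρ ∧ |y - x| ≤ |x' - x| := by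
    intro y hy
    have hy' := hy
    rw [Set.mem_uIcc] at hy
    rw [abs_le] at *
    refine ⟨?_, Set.abs_sub_left_of_mem_uIcc hy'⟩
    rcases hy with hy | hy <;> constructor <;> linarith [hy.1, hy.2]
  have hC : 0 ≤ C := (abs_nonneg _).trans (hb x hx)
  have := (convex_uIcc x x').norm_image_sub_le_of_norm_hasDerivWithin_le
    (f := fun y => f y - f1 x * y) (f' := fun y => f1 y - f1 x)
    (C := C * |x' - x|)
    (fun y hy => (((h1 y (hsub y hy).1).sub ((hasDerivAt_id y).const_mul (f1 x))).congr_deriv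
      (by simp)).hasDerivWithinAt)
    (fun y hy => (lip_seg h2 hb hx (hsub y hy).1).trans
      (mul_le_mul_of_nonneg_left (hsub y hy).2 hC))
    Set.left_mem_uIcc Set.right_mem_uIcc
  rw [Real.norm_eq_abs, Real.norm_eq_abs] at this
  have e : f x' - f x - f1 x * (x' - x) = f x' - f1 x * x' - (f x - f1 x * x) := by ring
  rw [e]; refine this.trans (le_of_eq (by ring))

lemma taylor3_seg {ρ C : ℝ} {f f1 f2 f3 : ℝ → ℝ} (h1 : ∀ x, |x| ≤ ρ → HasDerivAt f (f1 x) x)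
    (h2 : ∀ x, |x| ≤ ρ → HasDerivAt f1 (f2 x) x) (h3 : ∀ x, |x| ≤ ρ → HasDerivAt f2 (f3 x) x)
    (hb : ∀ x, |x| ≤ ρ → |f3 x| ≤ C) {x x' : ℝ} (hx : |x| ≤ ρ) (hx' : |x'| ≤ ρ) :
    |f x' - f x - f1 x * (x' - x) - f2 x * (x' - x) ^ 2 / 2| ≤ C * |x' - x| ^ 3 := by
  have hsub : ∀ y ∈ Set.uIcc x x', |y| ≤ ρ ∧ |y - x| ≤ |x' - x| := by
    intro y hy
    have hy' := hy
    rw [Set.mem_uIcc] at hy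
    rw [abs_le] at *
    refine ⟨?_, Set.abs_sub_left_of_mem_uIcc hy'⟩
    rcases hy with hy | hy <;> constructor <;> linarith [hy.1, hy.2]
  have hC : 0 ≤ C := (abs_nonneg _).trans (hb x hx)
  have := (convex_uIcc x x').norm_image_sub_le_of_norm_hasDerivWithin_le
    (f := fun y => f y - f1 x * y - f2 x / 2 * (y - x) ^ 2)
    (f' := fun y => f1 y - f1 x - f2 x * (y - x))
    (C := C * |x' - x| ^ 2)
    (fun y hy => ((((h1 y (hsub y hy).1).sub ((hasDerivAt_id y).const_mul (f1 x))).sub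
      ((((hasDerivAt_id y).sub_const x).pow 2).const_mul (f2 x / 2))).congr_deriv
      (by simp; ring)).hasDerivWithinAt)
    (fun y hy => (taylor_seg h2 h3 hb hx (hsub y hy).1).trans
      (mul_le_mul_of_nonneg_left (pow_le_pow_left₀ (abs_nonneg _) (hsub y hy).2 2) hC))
    Set.left_mem_uIcc Set.right_mem_uIcc
  rw [Real.norm_eq_abs, Real.norm_eq_abs] at this
  have e : f x' - f x - f1 x * (x' - x) - f2 x * (x' - x) ^ 2 / 2
      = f x' - f1 x * x' - f2 x / 2 * (x' - x) ^ 2 -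
        (f x - f1 x * x - f2 x / 2 * (x - x) ^ 2) := by ring
  rw [e]; refine this.trans (le_of_eq (by ring))

theorem RotheFam.modulus {p : ℝ} (hp : 1 < p) (M C : ℝ) (hC : 0 ≤ C) (hM : 0 ≤ M) :
    ∃ L, 0 ≤ L ∧ ∀ {κ R : ℝ} {J : ℕ} {D : ℕ → ℕ → ℝ → ℝ} (_ : RotheFam p κ R J D) (_ : 0 < κ)
      {ρ : ℝ} (_ : ρ + 1 < R)
      (_ : ∀ j ≤ J, ∀ x, |x| ≤ ρ + 1 → (1 ≤ D 0 j x ∧ D 0 j x ≤ M) ∧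
        |D 1 j x| ≤ C ∧ |D 2 j x| ≤ C ∧ |D 3 j x| ≤ C),
      (∀ j ≤ J, ∀ x x', |x| ≤ ρ → |x'| ≤ ρ →
        |D 0 j x' - D 0 j x - D 1 j x * (x' - x)| ≤ L * |x' - x| ^ 2 ∧
        |D 1 j x' - D 1 j x - D 2 j x * (x' - x)| ≤ L * |x' - x| ^ 2 ∧
        |D 2 j x' - D 2 j x| ≤ L * |x' - x|) ∧
      (∀ j j', j ≤ j' → j' ≤ J → ∀ x, |x| ≤ ρ → ∀ r, 0 < r → r ≤ 1 →
        ((j' : ℝ) - j) / κ ≤ r ^ 3 →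
        |D 0 j' x - D 0 j x| ≤ L * r ∧ |D 1 j' x - D 1 j x| ≤ L * r ∧
        |D 2 j' x - D 2 j x| ≤ L * r ∧
        |κ * (D 0 j' x - D 0 j x) - ((j' : ℝ) - j) * NN p (D 0 j x) (D 1 j x) (D 2 j x)|
          ≤ ((j' : ℝ) - j) * (L * r)) := by
  set B := M * C + p / (p - 1) * C ^ 2 + (p - 1) * M ^ 2 with hB
  set K := M + C + p / (p - 1) * (2 * C) + (p - 1) * (2 * M + 1) with hK
  have hq : 0 < p / (p - 1) := div_pos (by linarith) (by linarith)
  have hp1 : 0 < p - 1 := by linarith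
  have hB0 : 0 ≤ B := by positivity
  have hK0 : 0 ≤ K := by positivity
  set S := 4 * B + 4 * C with hS
  have hS0 : 0 ≤ S := by positivity
  refine ⟨C + S + K * S, by positivity, ?_⟩
  intro κ R J D H hκ ρ hρ hb
  have hR1 : ∀ x, |x| ≤ ρ + 1 → x ∈ Set.Ioo (-R) R := fun x hx => by
    rw [abs_le] at hx; constructor <;> linarith [hx.1, hx.2]
  have d0 : ∀ j ≤ J, ∀ x, |x| ≤ ρ + 1 → HasDerivAt (D 0 j) (D 1 j x) x :=
    fun j hj x hx => H.der 0 (by norm_num) j hj x (hR1 x hx)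
  have d1 : ∀ j ≤ J, ∀ x, |x| ≤ ρ + 1 → HasDerivAt (D 1 j) (D 2 j x) x :=
    fun j hj x hx => H.der 1 (by norm_num) j hj x (hR1 x hx)
  have d2 : ∀ j ≤ J, ∀ x, |x| ≤ ρ + 1 → HasDerivAt (D 2 j) (D 3 j x) x :=
    fun j hj x hx => H.der 2 (by norm_num) j hj x (hR1 x hx)
  have hCL : C ≤ C + S + K * S := by nlinarith [mul_nonneg hK0 hS0]
  refine ⟨?_, ?_⟩
  · intro j hj x x' hx hx'
    have hx1 : |x| ≤ ρ + 1 := by linarith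
    have hx1' : |x'| ≤ ρ + 1 := by linarith
    refine ⟨?_, ?_, ?_⟩
    · exact (taylor_seg (d0 j hj) (d1 j hj) (fun y hy => (hb j hj y hy).2.2.1) hx1 hx1').trans
        (mul_le_mul_of_nonneg_right hCL (by positivity))
    · exact (taylor_seg (d1 j hj) (d2 j hj) (fun y hy => (hb j hj y hy).2.2.2) hx1 hx1').trans
        (mul_le_mul_of_nonneg_right hCL (by positivity))
    · exact (lip_seg (d2 j hj) (fun y hy => (hb j hj y hy).2.2.2) hx1 hx1').trans
        (mul_le_mul_of_nonneg_right hCL (by positivity))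
  · -- time difference of D 0
    have t0 : ∀ j j', j ≤ j' → j' ≤ J → ∀ x, |x| ≤ ρ + 1 →
        |D 0 j' x - D 0 j x| ≤ ((j' : ℝ) - j) / κ * B := by
      intro j j' hjj
      induction j', hjj using Nat.le_induction with
      | base => intro _ x _; simp
      | succ n hn ih =>
        intro hJ x hx
        have i1 := ih (by omega) x hx
        have i2 := H.eqn n hJ x (hR1 x hx)
        have b := hb (n+1) hJ x hx
        have i3 := NN_bound hp hC b.1.1 b.1.2 b.2.1 b.2.2.1
        rw [← i2, abs_mul, abs_of_pos hκ] at i3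
        have i4 : |D 0 (n+1) x - D 0 n x| ≤ 1 / κ * B := by
          rw [div_mul_eq_mul_div, one_mul, le_div_iff₀ hκ]; linarith
        have i5 : D 0 (n+1) x - D 0 j x = (D 0 (n+1) x - D 0 n x) + (D 0 n x - D 0 j x) := by ring
        rw [i5]
        refine (abs_add_le _ _).trans ((add_le_add i4 i1).trans (le_of_eq ?_))
        push_cast; ring
    have tS : ∀ j j', j ≤ j' → j' ≤ J → ∀ x, |x| ≤ ρ → ∀ r, 0 < r → r ≤ 1 →
        ((j' : ℝ) - j) / κ ≤ r ^ 3 →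
        |D 0 j' x - D 0 j x| ≤ S * r ∧ |D 1 j' x - D 1 j x| ≤ S * r ∧
        |D 2 j' x - D 2 j x| ≤ S * r := by
      intro j j' hjj hJ x hx r hr hr1 hδ
      have hJ' : j ≤ J := hjj.trans hJ
      have hx0 : |x| ≤ ρ + 1 := by linarith
      have hxp : |x + r| ≤ ρ + 1 := (abs_add_le _ _).trans (by rw [abs_of_pos hr]; linarith)
      have hxm : |x - r| ≤ ρ + 1 := (abs_sub _ _).trans (by rw [abs_of_pos hr]; linarith)
      have T : ∀ y, |y| ≤ ρ + 1 → |D 0 j' y - D 0 j y| ≤ B * r ^ 3 := fun y hy =>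
        (t0 j j' hjj hJ y hy).trans (by rw [mul_comm]; exact mul_le_mul_of_nonneg_left hδ hB0)
      have r2 : r ^ 2 ≤ r := by nlinarith
      have r3 : r ^ 3 ≤ r ^ 2 := by
        have : r ^ 3 = r ^ 2 * r := by ring
        nlinarith [sq_nonneg r]
      have a0 := T x hx0
      have ap := T _ hxp
      have am := T _ hxm
      refine ⟨?_, ?_, ?_⟩
      · refine a0.trans ?_
        have : B * r ^ 3 ≤ B * r := mul_le_mul_of_nonneg_left (r3.trans r2) hB0
        have : 0 ≤ C * r := by positivity
        have : 0 ≤ B * r := by positivity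
        rw [hS]; nlinarith
      · have u := taylor_seg (d0 j hJ') (d1 j hJ') (fun y hy => (hb j hJ' y hy).2.2.1) hx0 hxp
        have w := taylor_seg (d0 j' hJ) (d1 j' hJ) (fun y hy => (hb j' hJ y hy).2.2.1) hx0 hxp
        rw [add_sub_cancel_left, abs_of_pos hr] at u w
        have key : r * |D 1 j' x - D 1 j x| ≤ r * (S * r) := by
          have e1 : r * |D 1 j' x - D 1 j x| = |r * (D 1 j' x - D 1 j x)| := by
            rw [abs_mul, abs_of_pos hr]
          rw [e1]
          have : B * r ^ 3 ≤ B * r ^ 2 := mul_le_mul_of_nonneg_left r3 hB0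
          have q1 : 0 ≤ C * r ^ 2 := by positivity
          have q2 : 0 ≤ B * r ^ 2 := by positivity
          have e2 : r * (S * r) = 4 * (B * r ^ 2) + 4 * (C * r ^ 2) := by rw [hS]; ring
          rw [e2]
          rw [abs_le] at *
          constructor <;> linarith [u.1, u.2, w.1, w.2, a0.1, a0.2, ap.1, ap.2]
        exact le_of_mul_le_mul_left key hr
      · have u1 := taylor3_seg (d0 j hJ') (d1 j hJ') (d2 j hJ')
          (fun y hy => (hb j hJ' y hy).2.2.2) hx0 hxp
        have u2 := taylor3_seg (d0 j hJ') (d1 j hJ') (d2 j hJ')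
          (fun y hy => (hb j hJ' y hy).2.2.2) hx0 hxm
        have w1 := taylor3_seg (d0 j' hJ) (d1 j' hJ) (d2 j' hJ)
          (fun y hy => (hb j' hJ y hy).2.2.2) hx0 hxp
        have w2 := taylor3_seg (d0 j' hJ) (d1 j' hJ) (d2 j' hJ)
          (fun y hy => (hb j' hJ y hy).2.2.2) hx0 hxm
        rw [add_sub_cancel_left, abs_of_pos hr] at u1 w1
        have em : x - r - x = -r := by ring
        rw [em, abs_neg, abs_of_pos hr] at u2 w2
        have key : r ^ 2 * |D 2 j' x - D 2 j x| ≤ r ^ 2 * (S * r) := by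
          have e1 : r ^ 2 * |D 2 j' x - D 2 j x| = |r ^ 2 * (D 2 j' x - D 2 j x)| := by
            rw [abs_mul, abs_of_pos (by positivity : 0 < r ^ 2)]
          rw [e1]
          have e2 : r ^ 2 * (S * r) = 4 * (B * r ^ 3) + 4 * (C * r ^ 3) := by rw [hS]; ring
          rw [e2]
          have e3 : (-r) ^ 2 = r ^ 2 := by ring
          rw [e3] at u2 w2
          rw [abs_le] at *
          constructor <;> linarith [u1.1, u1.2, w1.1, w1.2, u2.1, u2.2, w2.1, w2.2,
            a0.1, a0.2, ap.1, ap.2, am.1, am.2]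
        exact le_of_mul_le_mul_left key (by positivity)
    intro j j' hjj hJ x hx r hr hr1 hδ
    have hx0 : |x| ≤ ρ + 1 := by linarith
    obtain ⟨s0, s1, s2⟩ := tS j j' hjj hJ x hx r hr hr1 hδ
    have hSL : S * r ≤ (C + S + K * S) * r := by
      refine mul_le_mul_of_nonneg_right ?_ hr.le
      nlinarith [mul_nonneg hK0 hS0]
    refine ⟨s0.trans hSL, s1.trans hSL, s2.trans hSL, ?_⟩
    have main : ∀ n, j ≤ n → n ≤ j' →
        |κ * (D 0 n x - D 0 j x) - ((n : ℝ) - j) * NN p (D 0 j x) (D 1 j x) (D 2 j x)|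
          ≤ ((n : ℝ) - j) * (K * (S * r)) := by
      intro n hn
      induction n, hn using Nat.le_induction with
      | base => intro _; simp
      | succ n hn ih =>
        intro hnj
        have i1 := ih (by omega)
        have i2 := H.eqn n (by omega) x (hR1 x hx0)
        have hδ' : (((n+1 : ℕ) : ℝ) - j) / κ ≤ r ^ 3 := by
          refine le_trans ?_ hδ
          have : ((n+1 : ℕ) : ℝ) ≤ j' := by exact_mod_cast hnj
          gcongr
        obtain ⟨v0, v1, v2⟩ := tS j (n+1) (by omega) (by omega) x hx r hr hr1 hδ'
        have b := hb (n+1) (by omega) x hx0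
        have b' := hb j (by omega) x hx0
        have i3 := NN_lip hp hC b.1.1 b.1.2 b'.1.1 b'.1.2 b.2.1 b'.2.1 b'.2.2.1 v0 v1 v2
        rw [← hK] at i3
        rw [← i2] at i3
        have e : κ * (D 0 (n+1) x - D 0 j x) -
            (((n+1 : ℕ) : ℝ) - j) * NN p (D 0 j x) (D 1 j x) (D 2 j x) =
            (κ * (D 0 (n+1) x - D 0 n x) - NN p (D 0 j x) (D 1 j x) (D 2 j x)) +
            (κ * (D 0 n x - D 0 j x) - ((n : ℝ) - j) * NN p (D 0 j x) (D 1 j x) (D 2 j x)) := by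
          push_cast; ring
        rw [e]
        refine (abs_add_le _ _).trans ((add_le_add i3 i1).trans (le_of_eq ?_))
        push_cast; ring
    refine (main j' hjj le_rfl).trans ?_
    have hjr : (0:ℝ) ≤ (j' : ℝ) - j := by
      have : (j : ℝ) ≤ j' := by exact_mod_cast hjj
      linarith
    refine mul_le_mul_of_nonneg_left ?_ hjr
    have : 0 ≤ (C + S) * r := by positivity
    have e : (C + S + K * S) * r = (C + S) * r + K * (S * r) := by ring
    rw [e]; linarith

end

section
lemma hasDerivAt_of_small {f : ℝ → ℝ} {g x : ℝ}
    (h : ∀ c > 0, ∀ᶠ x' in nhds x, |f x' - f x - g * (x' - x)| ≤ c * |x' - x|) :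
    HasDerivAt f g x := by
  rw [hasDerivAt_iff_isLittleO, Asymptotics.isLittleO_iff]
  intro c hc
  filter_upwards [h c hc] with x' hx'
  rw [smul_eq_mul, Real.norm_eq_abs, Real.norm_eq_abs, mul_comm (x' - x) g]
  exact hx'

lemma hasDerivAt_of_quad {f : ℝ → ℝ} {g x L : ℝ} (hL : 0 ≤ L)
    (h : ∀ᶠ x' in nhds x, |f x' - f x - g * (x' - x)| ≤ L * |x' - x| ^ 2) :
    HasDerivAt f g x := by
  apply hasDerivAt_of_small
  intro c hc
  have h2 : ∀ᶠ x' in nhds x, |x' - x| < c / (L + 1) := by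
    have := Metric.ball_mem_nhds x (show 0 < c / (L + 1) by positivity)
    filter_upwards [this] with y hy
    rwa [Metric.mem_ball, Real.dist_eq] at hy
  filter_upwards [h, h2] with x' h1 h2
  refine h1.trans ?_
  rw [pow_two, ← mul_assoc]
  refine mul_le_mul_of_nonneg_right ?_ (abs_nonneg _)
  rw [lt_div_iff₀ (by positivity)] at h2
  nlinarith [abs_nonneg (x' - x)]

theorem limit_core {p τ : ℝ} (hp : 1 < p) (F : ℕ → ℝ → ℝ → ℝ)
    (h : ∀ ρ ≥ 1, ∃ L, 0 ≤ L ∧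
      (∀ t ≤ τ, ∀ x x', |x| ≤ ρ → |x'| ≤ ρ →
        |F 0 x' t - F 0 x t - F 1 x t * (x' - x)| ≤ L * |x' - x| ^ 2 ∧
        |F 1 x' t - F 1 x t - F 2 x t * (x' - x)| ≤ L * |x' - x| ^ 2 ∧
        |F 2 x' t - F 2 x t| ≤ L * |x' - x|) ∧
      (∀ t t', t ≤ t' → t' ≤ τ → ∀ x, |x| ≤ ρ → ∀ r, 0 < r → r ≤ 1 → t' - t < p * r ^ 3 →
        |F 0 x t' - F 0 x t| ≤ L * r ∧ |F 1 x t' - F 1 x t| ≤ L * r ∧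
        |F 2 x t' - F 2 x t| ≤ L * r ∧
        |p * (F 0 x t' - F 0 x t) - (t' - t) * NN p (F 0 x t) (F 1 x t) (F 2 x t)|
          ≤ (t' - t) * (L * r))) :
    (∀ t ≤ τ, ContDiff ℝ 2 (fun x => F 0 x t)) ∧
    (∀ t ≤ τ, ∀ x, deriv (fun y => F 0 y t) x = F 1 x t ∧
      deriv (deriv fun y => F 0 y t) x = F 2 x t) ∧
    (∀ t < τ, ∀ x, HasDerivAt (fun s => F 0 x s) (NN p (F 0 x t) (F 1 x t) (F 2 x t) / p) t) ∧
    (∀ x, ContinuousOn (fun t => NN p (F 0 x t) (F 1 x t) (F 2 x t) / p) (Set.Iio τ)) := by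
  have hp0 : 0 < p := by linarith
  have near : ∀ x : ℝ, ∀ᶠ x' in nhds x, |x'| ≤ |x| + 1 := by
    intro x
    filter_upwards [Metric.ball_mem_nhds x one_pos] with y hy
    rw [Metric.mem_ball, Real.dist_eq] at hy
    have := abs_add_le (y - x) x
    rw [sub_add_cancel] at this; linarith
  have ge1 : ∀ x : ℝ, |x| + 1 ≥ 1 := fun x => by linarith [abs_nonneg x]
  have d0 : ∀ t ≤ τ, ∀ x, HasDerivAt (fun y => F 0 y t) (F 1 x t) x := by
    intro t ht x
    obtain ⟨L, hL, hs, -⟩ := h (|x| + 1) (ge1 x)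
    refine hasDerivAt_of_quad hL ?_
    filter_upwards [near x] with x' hx'
    exact (hs t ht x x' (by linarith) hx').1
  have d1 : ∀ t ≤ τ, ∀ x, HasDerivAt (fun y => F 1 y t) (F 2 x t) x := by
    intro t ht x
    obtain ⟨L, hL, hs, -⟩ := h (|x| + 1) (ge1 x)
    refine hasDerivAt_of_quad hL ?_
    filter_upwards [near x] with x' hx'
    exact (hs t ht x x' (by linarith) hx').2.1
  have c2 : ∀ t ≤ τ, Continuous (fun y => F 2 y t) := by
    intro t ht
    rw [continuous_iff_continuousAt]
    intro x
    obtain ⟨L, hL, hs, -⟩ := h (|x| + 1) (ge1 x)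
    refine tendsto_iff_norm_sub_tendsto_zero.2 ?_
    refine squeeze_zero' (g := fun y => L * |y - x|) (Filter.Eventually.of_forall fun _ => norm_nonneg _) ?_ ?_
    · filter_upwards [near x] with x' hx'
      exact (hs t ht x x' (by linarith) hx').2.2
    · have : Continuous (fun y => L * |y - x|) := by fun_prop
      simpa using this.tendsto x
  have e0 : ∀ t ≤ τ, deriv (fun y => F 0 y t) = fun x => F 1 x t :=
    fun t ht => funext fun x => (d0 t ht x).deriv
  have e1 : ∀ t ≤ τ, deriv (fun y => F 1 y t) = fun x => F 2 x t :=
    fun t ht => funext fun x => (d1 t ht x).deriv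
  -- continuity in time
  have small : ∀ c > 0, ∀ L : ℝ, 0 ≤ L → ∃ r, 0 < r ∧ r ≤ 1 ∧ L * r ≤ c := by
    intro c hc L hL
    refine ⟨min 1 (c / (L + 1)), lt_min one_pos (by positivity), min_le_left _ _, ?_⟩
    calc L * min 1 (c / (L + 1)) ≤ L * (c / (L + 1)) :=
          mul_le_mul_of_nonneg_left (min_le_right _ _) hL
      _ ≤ c := by
          rw [mul_div_assoc', div_le_iff₀ (by positivity)]; nlinarith
  have ct : ∀ i ∈ ({0, 1, 2} : Set ℕ), ∀ x, ∀ t < τ, ContinuousAt (fun s => F i x s) t := by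
    intro i hi x t ht
    obtain ⟨L, hL, -, hs⟩ := h (|x| + 1) (ge1 x)
    rw [Metric.continuousAt_iff]
    intro ε hε
    obtain ⟨r, hr, hr1, hLr⟩ := small (ε / 2) (by positivity) L hL
    refine ⟨min (p * r ^ 3) (τ - t), lt_min (by positivity) (by linarith), ?_⟩
    intro s hs'
    rw [Real.dist_eq] at hs'
    have b1 := (lt_min_iff.1 hs').1
    have b2 := (lt_min_iff.1 hs').2
    rw [abs_lt] at b1 b2
    rw [Real.dist_eq]
    suffices |F i x s - F i x t| ≤ L * r by linarith
    rcases le_total t s with hts | hts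
    · obtain ⟨a0, a1, a2, -⟩ := hs t s hts (by linarith) x (by linarith) r hr hr1 (by linarith)
      rcases hi with rfl | rfl | rfl <;> assumption
    · obtain ⟨a0, a1, a2, -⟩ := hs s t hts (by linarith) x (by linarith) r hr hr1 (by linarith)
      rw [abs_sub_comm]
      rcases hi with rfl | rfl | rfl <;> assumption
  have cN : ∀ x, ∀ t < τ, ContinuousAt (fun s => NN p (F 0 x s) (F 1 x s) (F 2 x s)) t := by
    intro x t ht
    have a0 := ct 0 (by simp) x t ht
    have a1 := ct 1 (by simp) x t ht
    have a2 := ct 2 (by simp) x t ht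
    unfold NN
    exact ((a0.mul a2).sub (continuousAt_const.mul (a1.pow 2))).add
      (continuousAt_const.mul ((a0.pow 2).sub a0))
  refine ⟨?_, ?_, ?_, ?_⟩
  · intro t ht
    have : (2 : WithTop ℕ∞) = 1 + 1 := by norm_num
    rw [this, contDiff_succ_iff_deriv]
    refine ⟨fun x => (d0 t ht x).differentiableAt, by simp, ?_⟩
    rw [e0 t ht, contDiff_one_iff_deriv]
    refine ⟨fun x => (d1 t ht x).differentiableAt, ?_⟩
    rw [e1 t ht]; exact c2 t ht
  · intro t ht x
    rw [e0 t ht, e1 t ht]; exact ⟨rfl, rfl⟩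
  · intro t ht x
    apply hasDerivAt_of_small
    intro c hc
    obtain ⟨L, hL, -, hs⟩ := h (|x| + 1) (ge1 x)
    obtain ⟨r, hr, hr1, hLr⟩ := small (c * p / 2) (by positivity) L hL
    have ev : ∀ᶠ s in nhds t, |s - t| < min (p * r ^ 3) (τ - t) := by
      have := Metric.ball_mem_nhds t
        (show 0 < min (p * r ^ 3) (τ - t) from lt_min (by positivity) (by linarith))
      filter_upwards [this] with y hy
      rwa [Metric.mem_ball, Real.dist_eq] at hy
    have ev2 := Metric.continuousAt_iff'.1 (cN x t ht) (c * p / 2) (by positivity)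
    filter_upwards [ev, ev2] with s hs' hN
    have b1 := (lt_min_iff.1 hs').1
    have b2 := (lt_min_iff.1 hs').2
    rw [abs_lt] at b1 b2
    rw [Real.dist_eq] at hN
    set N := NN p (F 0 x t) (F 1 x t) (F 2 x t) with hNdef
    set N' := NN p (F 0 x s) (F 1 x s) (F 2 x s) with hNdef'
    suffices hh : |p * (F 0 x s - F 0 x t) - (s - t) * N| ≤ |s - t| * (c * p) by
      have e : F 0 x s - F 0 x t - N / p * (s - t) = (p * (F 0 x s - F 0 x t) - (s - t) * N) / p := by
        field_simp
      rw [e, abs_div, abs_of_pos hp0, div_le_iff₀ hp0]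
      exact hh.trans (le_of_eq (by ring))
    have hcp : 0 ≤ c * p / 2 := by positivity
    rcases le_total t s with hts | hts
    · obtain ⟨-, -, -, a3⟩ := hs t s hts (by linarith) x (by linarith) r hr hr1 (by linarith)
      rw [abs_of_nonneg (by linarith : 0 ≤ s - t)]
      exact a3.trans (mul_le_mul_of_nonneg_left (by linarith) (by linarith))
    · obtain ⟨-, -, -, a3⟩ := hs s t hts (by linarith) x (by linarith) r hr hr1 (by linarith)
      have hd : 0 ≤ t - s := by linarith
      rw [abs_sub_comm s t, abs_of_nonneg hd]
      have e : p * (F 0 x s - F 0 x t) - (s - t) * N =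
        -(p * (F 0 x t - F 0 x s) - (t - s) * N') - (t - s) * (N' - N) := by ring
      rw [e]
      refine (abs_sub _ _).trans ?_
      rw [abs_neg, abs_mul, abs_of_nonneg hd]
      have q1 : (t - s) * |N' - N| ≤ (t - s) * (c * p / 2) :=
        mul_le_mul_of_nonneg_left hN.le hd
      have q2 := a3.trans (mul_le_mul_of_nonneg_left hLr hd)
      linarith
  · intro x t ht
    exact ((cN x t ht).div_const p).continuousWithinAt

end

section
open scoped ContDiff

lemma ultra_lim {f : ℕ → ℝ} {B : ℝ} (h : ∀ᶠ m in Filter.atTop, |f m| ≤ B) :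
    ∃ a, Filter.Tendsto f (Filter.hyperfilter ℕ) (nhds a) := by
  have h2 : ∀ᶠ m in (Filter.hyperfilter ℕ : Filter ℕ), f m ∈ Set.Icc (-B) B :=
    Nat.hyperfilter_le_atTop (h.mono fun m hm => abs_le.1 hm)
  obtain ⟨a, -, ha⟩ := (isCompact_Icc (a := -B) (b := B)).ultrafilter_le_nhds
    (Ultrafilter.map f (Filter.hyperfilter ℕ)) (by
      rw [Filter.le_principal_iff]; exact h2)
  exact ⟨a, ha⟩

theorem ancient_abstract {p τ : ℝ} (hp : 1 < p) {ι : Type} [Finite ι]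
    {Φ Φt Φx Φxx : ℝ → ℝ → ℝ} (BΦ : Barr τ Φ Φt Φx Φxx)
    (hsm : ∀ t ≤ τ, ContDiff ℝ ∞ (fun x => Φ x t))
    (hge : ∀ x, ∀ t ≤ τ, 1 ≤ Φ x t)
    (hsup : ∀ x, ∀ t ≤ τ, NN p (Φ x t) (Φx x t) (Φxx x t) < p * Φt x t)
    {φ φt φx φxx : ι → ℝ → ℝ → ℝ} (Bφ : ∀ i, Barr τ (φ i) (φt i) (φx i) (φxx i))
    (hsol : ∀ i x, ∀ t ≤ τ, p * φt i x t = NN p (φ i x t) (φx i x t) (φxx i x t))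
    (hle : ∀ i x, ∀ t ≤ τ, φ i x t ≤ Φ x t)
    (hloc : ∀ ρ : ℝ, ∃ M, ∀ x, |x| ≤ ρ → ∀ t ≤ τ, Φ x t ≤ M ∧
      |iteratedDeriv 1 (fun y => Φ y t) x| ≤ M ∧ |iteratedDeriv 2 (fun y => Φ y t) x| ≤ M ∧
      |iteratedDeriv 3 (fun y => Φ y t) x| ≤ M) :
    ∃ F : ℕ → ℝ → ℝ → ℝ,
      (∀ t ≤ τ, ContDiff ℝ 2 (fun x => F 0 x t)) ∧
      (∀ t ≤ τ, ∀ x, deriv (fun y => F 0 y t) x = F 1 x t ∧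
        deriv (deriv fun y => F 0 y t) x = F 2 x t) ∧
      (∀ t < τ, ∀ x, HasDerivAt (fun s => F 0 x s) (NN p (F 0 x t) (F 1 x t) (F 2 x t) / p) t) ∧
      (∀ x, ContinuousOn (fun t => NN p (F 0 x t) (F 1 x t) (F 2 x t) / p) (Set.Iio τ)) ∧
      (∀ x, ∀ t ≤ τ, 1 ≤ F 0 x t ∧ F 0 x t ≤ Φ x t ∧ ∀ i, φ i x t ≤ F 0 x t) := by
  have hp0 : 0 < p := by linarith
  have hst := fun m : ℕ => stage (R := (m:ℝ) + 1) (T0 := τ - m) (ε := 1 / ((m:ℝ) + 1)) hp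
    (by positivity) (by positivity) BΦ hsm hge hsup Bφ hsol hle
  choose κ0 hκ0 hst using hst
  set κ : ℕ → ℝ := fun m => max (κ0 m) ((m:ℝ) + 1) with hκdef
  have hκm : ∀ m : ℕ, (m:ℝ) + 1 ≤ κ m := fun m => le_max_right _ _
  have hκpos : ∀ m, 0 < κ m := fun m => lt_of_lt_of_le (by positivity) (hκm m)
  set J : ℕ → ℕ := fun m => ⌊(m:ℝ) * κ m / p⌋₊ with hJ
  have hhk : ∀ m, 0 < p / κ m := fun m => div_pos hp0 (hκpos m)
  have hJle : ∀ m : ℕ, τ - m + (J m : ℝ) * (p / κ m) ≤ τ := by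
    intro m
    have h1 : (J m : ℝ) ≤ (m:ℝ) * κ m / p := Nat.floor_le (by have := hκpos m; positivity)
    have h2 : (J m : ℝ) * (p / κ m) ≤ (m:ℝ) * κ m / p * (p / κ m) :=
      mul_le_mul_of_nonneg_right h1 (hhk m).le
    have h3 : (m:ℝ) * κ m / p * (p / κ m) = m := by
      have := (hκpos m).ne'; field_simp
    linarith
  have hst := fun m => hst m (κ m) (le_max_left _ _) (J m) (hJle m)
  choose U hfam hU hU0 using hst
  set jj : ℕ → ℝ → ℕ := fun m t => ⌊(t - τ + m) * κ m / p⌋₊ with hjj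
  set ss : ℕ → ℝ → ℝ := fun m t => τ - m + (jj m t : ℝ) * (p / κ m) with hss
  have jmono : ∀ m t t', t ≤ t' → jj m t ≤ jj m t' := by
    intro m t t' h
    apply Nat.floor_mono
    have := hκpos m
    gcongr
  have jle : ∀ m t, t ≤ τ → jj m t ≤ J m := by
    intro m t h
    apply Nat.floor_mono
    have := hκpos m
    have : t - τ + m ≤ m := by linarith
    gcongr
  have sle : ∀ m t, t ≤ τ → ss m t ≤ τ := by
    intro m t h
    refine le_trans ?_ (hJle m)
    have h1 : (jj m t : ℝ) ≤ J m := by exact_mod_cast jle m t h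
    have := mul_le_mul_of_nonneg_right h1 (hhk m).le
    simp only [hss]; linarith
  have sbd : ∀ t, ∀ m : ℕ, τ - t ≤ m → ss m t ≤ t ∧ t - p / κ m ≤ ss m t := by
    intro t m hm
    have hk := hκpos m
    have e : (t - τ + m) * κ m / p * (p / κ m) = t - τ + m := by field_simp
    have h1 : (jj m t : ℝ) ≤ (t - τ + m) * κ m / p :=
      Nat.floor_le (div_nonneg (mul_nonneg (by linarith) hk.le) hp0.le)
    have h2 : (t - τ + m) * κ m / p < (jj m t : ℝ) + 1 := Nat.lt_floor_add_one _
    have h3 := mul_le_mul_of_nonneg_right h1 (hhk m).le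
    have h4 := mul_le_mul_of_nonneg_right h2.le (hhk m).le
    rw [e] at h3 h4
    simp only [hss]
    constructor
    · linarith
    · linarith
  have hk0 : Filter.Tendsto (fun m => p / κ m) Filter.atTop (nhds 0) := by
    refine Filter.Tendsto.div_atTop tendsto_const_nhds ?_
    refine Filter.tendsto_atTop_mono hκm ?_
    exact Filter.tendsto_atTop_add_const_right _ _ tendsto_natCast_atTop_atTop
  have evm : ∀ c : ℝ, ∀ᶠ m : ℕ in Filter.atTop, c ≤ (m : ℝ) := fun c =>
    tendsto_natCast_atTop_atTop.eventually_ge_atTop c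
  have stend : ∀ t, Filter.Tendsto (fun m => ss m t) Filter.atTop (nhds t) := by
    intro t
    refine tendsto_of_tendsto_of_tendsto_of_le_of_le' (g := fun m => t - p / κ m)
      (h := fun _ => t) ?_ tendsto_const_nhds ?_ ?_
    · simpa using tendsto_const_nhds.sub hk0
    · filter_upwards [evm (τ - t)] with m hm using (sbd t m hm).2
    · filter_upwards [evm (τ - t)] with m hm using (sbd t m hm).1
  -- uniform local estimates
  have est : ∀ ρ ≥ (1:ℝ), ∃ B L, 0 ≤ L ∧ ∀ m : ℕ, 8 * (ρ + 1) < (m:ℝ) + 1 →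
      (∀ j ≤ J m, ∀ x, |x| ≤ ρ → |iteratedDeriv 0 (U m j) x| ≤ B ∧
        |iteratedDeriv 1 (U m j) x| ≤ B ∧ |iteratedDeriv 2 (U m j) x| ≤ B) ∧
      (∀ j ≤ J m, ∀ x x', |x| ≤ ρ → |x'| ≤ ρ →
        |iteratedDeriv 0 (U m j) x' - iteratedDeriv 0 (U m j) x
          - iteratedDeriv 1 (U m j) x * (x' - x)| ≤ L * |x' - x| ^ 2 ∧
        |iteratedDeriv 1 (U m j) x' - iteratedDeriv 1 (U m j) x
          - iteratedDeriv 2 (U m j) x * (x' - x)| ≤ L * |x' - x| ^ 2 ∧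
        |iteratedDeriv 2 (U m j) x' - iteratedDeriv 2 (U m j) x| ≤ L * |x' - x|) ∧
      (∀ j j', j ≤ j' → j' ≤ J m → ∀ x, |x| ≤ ρ → ∀ r, 0 < r → r ≤ 1 →
        ((j' : ℝ) - j) / κ m ≤ r ^ 3 →
        |iteratedDeriv 0 (U m j') x - iteratedDeriv 0 (U m j) x| ≤ L * r ∧
        |iteratedDeriv 1 (U m j') x - iteratedDeriv 1 (U m j) x| ≤ L * r ∧
        |iteratedDeriv 2 (U m j') x - iteratedDeriv 2 (U m j) x| ≤ L * r ∧
        |κ m * (iteratedDeriv 0 (U m j') x - iteratedDeriv 0 (U m j) x) - ((j' : ℝ) - j) *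
          NN p (iteratedDeriv 0 (U m j) x) (iteratedDeriv 1 (U m j) x) (iteratedDeriv 2 (U m j) x)|
          ≤ ((j' : ℝ) - j) * (L * r)) := by
    intro ρ hρ
    obtain ⟨M, hM⟩ := hloc (8 * (ρ + 1))
    have hM0 : 0 ≤ M := by
      have := (hM 0 (by rw [abs_zero]; linarith) τ le_rfl).2.1
      exact (abs_nonneg _).trans this
    obtain ⟨C, hC, hinter⟩ := RotheFam.interior hp M M
    obtain ⟨L, hL, hmod⟩ := RotheFam.modulus hp M C hC hM0
    refine ⟨max M C, L, hL, ?_⟩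
    intro m hm
    have ub : ∀ j ≤ J m, ∀ x ∈ Set.Icc (-(8 * (ρ + 1))) (8 * (ρ + 1)),
        1 ≤ iteratedDeriv 0 (U m j) x ∧ iteratedDeriv 0 (U m j) x ≤ M := by
      intro j hj x hx
      rw [iteratedDeriv_zero]
      have h1 := hU m j hj x ⟨by linarith [hx.1], by linarith [hx.2]⟩
      refine ⟨h1.1, h1.2.1.trans ((hM x (abs_le.2 hx) _ ?_).1)⟩
      refine le_trans ?_ (hJle m)
      have h1 : (j : ℝ) ≤ J m := by exact_mod_cast hj
      have := mul_le_mul_of_nonneg_right h1 (hhk m).le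
      linarith
    have hC3 := hinter (hfam m) (hκpos m) (ρ := ρ + 1) (by linarith) hm ub (by
      intro x hx
      have := hM x (abs_le.2 hx) (τ - m) (by linarith [Nat.cast_nonneg (α := ℝ) m])
      rw [hU0 m]; exact this.2)
    have key : ∀ j ≤ J m, ∀ x, |x| ≤ ρ + 1 →
        (1 ≤ iteratedDeriv 0 (U m j) x ∧ iteratedDeriv 0 (U m j) x ≤ M) ∧
        |iteratedDeriv 1 (U m j) x| ≤ C ∧ |iteratedDeriv 2 (U m j) x| ≤ C ∧
        |iteratedDeriv 3 (U m j) x| ≤ C := by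
      intro j hj x hx
      refine ⟨ub j hj x (abs_le.1 (by linarith)), hC3 j hj x hx⟩
    have hm2 := hmod (hfam m) (hκpos m) (ρ := ρ) (by linarith) key
    refine ⟨?_, hm2⟩
    intro j hj x hx
    have h1 := key j hj x (by linarith)
    refine ⟨?_, h1.2.1.trans (le_max_right _ _), h1.2.2.1.trans (le_max_right _ _)⟩
    rw [abs_of_nonneg (by linarith [h1.1.1])]
    exact h1.1.2.trans (le_max_left _ _)
  -- limits
  have hlim : ∀ i x t, ∃ a, i ≤ 2 → t ≤ τ →
      Filter.Tendsto (fun m => iteratedDeriv i (U m (jj m t)) x) (Filter.hyperfilter ℕ) (nhds a) := by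
    intro i x t
    by_cases hi : i ≤ 2 ∧ t ≤ τ
    · obtain ⟨B, L, -, hB⟩ := est (|x| + 1) (by linarith [abs_nonneg x])
      obtain ⟨a, ha⟩ := ultra_lim (f := fun m => iteratedDeriv i (U m (jj m t)) x) (B := B) (by
        filter_upwards [evm (8 * (|x| + 1 + 1))] with m hm
        obtain ⟨b0, b1, b2⟩ := (hB m (by linarith)).1 (jj m t) (jle m t hi.2) x (by linarith)
        have := hi.1
        interval_cases i <;> assumption)
      exact ⟨a, fun _ _ => ha⟩
    · exact ⟨0, fun h1 h2 => absurd ⟨h1, h2⟩ hi⟩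
  choose F hF using hlim
  have hl : (Filter.hyperfilter ℕ : Filter ℕ) ≤ Filter.atTop := Nat.hyperfilter_le_atTop
  have core := limit_core (τ := τ) hp F (by
    intro ρ hρ
    obtain ⟨B, L, hL, hB⟩ := est ρ hρ
    have ev8 : ∀ᶠ m : ℕ in (Filter.hyperfilter ℕ : Filter ℕ), 8 * (ρ + 1) ≤ (m:ℝ) := hl (evm _)
    refine ⟨L, hL, ?_, ?_⟩
    · intro t ht x x' hx hx'
      have f0 := hF 0 x t (by norm_num) ht
      have f1 := hF 1 x t (by norm_num) ht
      have f2 := hF 2 x t (by norm_num) ht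
      have f0' := hF 0 x' t (by norm_num) ht
      have f1' := hF 1 x' t (by norm_num) ht
      have f2' := hF 2 x' t (by norm_num) ht
      refine ⟨?_, ?_, ?_⟩
      · refine le_of_tendsto ((f0'.sub f0).sub (f1.mul_const (x' - x))).abs ?_
        filter_upwards [ev8] with m hm
        exact ((hB m (by linarith)).2.1 _ (jle m t ht) x x' hx hx').1
      · refine le_of_tendsto ((f1'.sub f1).sub (f2.mul_const (x' - x))).abs ?_
        filter_upwards [ev8] with m hm
        exact ((hB m (by linarith)).2.1 _ (jle m t ht) x x' hx hx').2.1
      · refine le_of_tendsto (f2'.sub f2).abs ?_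
        filter_upwards [ev8] with m hm
        exact ((hB m (by linarith)).2.1 _ (jle m t ht) x x' hx hx').2.2
    · intro t t' htt ht' x hx r hr hr1 hδ
      have ht : t ≤ τ := htt.trans ht'
      have f0 := hF 0 x t (by norm_num) ht
      have f1 := hF 1 x t (by norm_num) ht
      have f2 := hF 2 x t (by norm_num) ht
      have f0' := hF 0 x t' (by norm_num) ht'
      have f1' := hF 1 x t' (by norm_num) ht'
      have f2' := hF 2 x t' (by norm_num) ht'
      have hθ : Filter.Tendsto (fun m => ss m t' - ss m t) (Filter.hyperfilter ℕ)
          (nhds (t' - t)) := ((stend t').sub (stend t)).mono_left hl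
      have eθ : ∀ m, ss m t' - ss m t = ((jj m t' : ℝ) - jj m t) * (p / κ m) := by
        intro m; simp only [hss]; ring
      have evθ : ∀ᶠ m in (Filter.hyperfilter ℕ : Filter ℕ),
          ((jj m t' : ℝ) - jj m t) / κ m ≤ r ^ 3 := by
        filter_upwards [hθ.eventually_lt_const hδ] with m hm
        rw [eθ] at hm
        have hm' : p * (((jj m t' : ℝ) - jj m t) / κ m) < p * r ^ 3 := by
          refine lt_of_eq_of_lt ?_ hm; ring
        exact (lt_of_mul_lt_mul_left hm' hp0.le).le
      refine ⟨?_, ?_, ?_, ?_⟩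
      · refine le_of_tendsto (f0'.sub f0).abs ?_
        filter_upwards [ev8, evθ] with m hm hm2
        exact ((hB m (by linarith)).2.2 _ _ (jmono m t t' htt) (jle m t' ht') x hx r hr hr1 hm2).1
      · refine le_of_tendsto (f1'.sub f1).abs ?_
        filter_upwards [ev8, evθ] with m hm hm2
        exact ((hB m (by linarith)).2.2 _ _ (jmono m t t' htt) (jle m t' ht') x hx r hr hr1 hm2).2.1
      · refine le_of_tendsto (f2'.sub f2).abs ?_
        filter_upwards [ev8, evθ] with m hm hm2
        exact ((hB m (by linarith)).2.2 _ _ (jmono m t t' htt) (jle m t' ht') x hx r hr hr1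
          hm2).2.2.1
      · have fN : Filter.Tendsto (fun m => NN p (iteratedDeriv 0 (U m (jj m t)) x)
            (iteratedDeriv 1 (U m (jj m t)) x) (iteratedDeriv 2 (U m (jj m t)) x))
            (Filter.hyperfilter ℕ) (nhds (NN p (F 0 x t) (F 1 x t) (F 2 x t))) := by
          unfold NN
          exact ((f0.mul f2).sub ((f1.pow 2).const_mul _)).add
            (((f0.pow 2).sub f0).const_mul _)
        refine le_of_tendsto_of_tendsto (((f0'.sub f0).const_mul p).sub (hθ.mul fN)).abs
          (hθ.mul_const (L * r)) ?_
        filter_upwards [ev8, evθ] with m hm hm2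
        have h4 := ((hB m (by linarith)).2.2 _ _ (jmono m t t' htt) (jle m t' ht') x hx r hr hr1
          hm2).2.2.2
        have h5 := mul_le_mul_of_nonneg_left h4 (hhk m).le
        rw [← abs_of_pos (hhk m), ← abs_mul, abs_of_pos (hhk m)] at h5
        have hk := (hκpos m).ne'
        refine le_trans (le_of_eq ?_) (h5.trans (le_of_eq ?_))
        · congr 1
          rw [eθ]; field_simp
        · rw [eθ]; ring)
  refine ⟨F, core.1, core.2.1, core.2.2.1, core.2.2.2, ?_⟩
  intro x t ht
  have f0 := hF 0 x t (by norm_num) ht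
  have evx : ∀ᶠ m : ℕ in (Filter.hyperfilter ℕ : Filter ℕ), |x| ≤ (m:ℝ) := hl (evm _)
  have wt : Filter.Tendsto (fun m => ss m t) (Filter.hyperfilter ℕ) (nhdsWithin t (Set.Iic τ)) :=
    tendsto_nhdsWithin_iff.2 ⟨(stend t).mono_left hl,
      Filter.Eventually.of_forall fun m => sle m t ht⟩
  have contt : ∀ {f : ℝ → ℝ → ℝ}, ContinuousOn (Function.uncurry f) (Set.univ ×ˢ Set.Iic τ) →
      Filter.Tendsto (fun m => f x (ss m t)) (Filter.hyperfilter ℕ) (nhds (f x t)) := by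
    intro f hf
    have h1 : ContinuousOn (fun s => f x s) (Set.Iic τ) :=
      hf.comp (f := fun s : ℝ => ((x, s) : ℝ × ℝ)) (by fun_prop) (fun s hs => ⟨trivial, hs⟩)
    exact (h1 t ht).tendsto.comp wt
  have hb : ∀ m : ℕ, |x| ≤ (m:ℝ) → x ∈ Set.Icc (-((m:ℝ)+1)) ((m:ℝ)+1) := by
    intro m hm; rw [abs_le] at hm; constructor <;> linarith [hm.1, hm.2]
  refine ⟨?_, ?_, ?_⟩
  · refine ge_of_tendsto f0 ?_
    filter_upwards [evx] with m hm
    rw [iteratedDeriv_zero]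
    exact (hU m _ (jle m t ht) x (hb m hm)).1
  · refine le_of_tendsto_of_tendsto f0 (contt BΦ.c) ?_
    filter_upwards [evx] with m hm
    rw [iteratedDeriv_zero]
    exact (hU m _ (jle m t ht) x (hb m hm)).2.1
  · intro i
    have z : Filter.Tendsto (fun m : ℕ => 1 / ((m:ℝ) + 1)) (Filter.hyperfilter ℕ) (nhds 0) :=
      tendsto_one_div_add_atTop_nhds_zero_nat.mono_left hl
    have c1 := (contt (Bφ i).c).sub z
    rw [sub_zero] at c1
    refine le_of_tendsto_of_tendsto c1 f0 ?_
    filter_upwards [evx] with m hm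
    rw [iteratedDeriv_zero]
    exact (hU m _ (jle m t ht) x (hb m hm)).2.2 i

end

section
open Filter Asymptotics
open scoped ContDiff

lemma gamma_facts {p lam : ℝ} (hp : 1 < p) (hlam : 1 < lam) :
    0 < gammaExp p lam ∧ p - 1 ≤ gammaExp p lam * lam * p := by
  set s := Real.sqrt (lam ^ 2 * p ^ 2 - 4 * (p - 1)) with hs
  have h0 : 0 ≤ lam ^ 2 * p ^ 2 - 4 * (p - 1) := by
    nlinarith [sq_nonneg (p - 2), mul_pos (by linarith : 0 < lam - 1) (by positivity : 0 < p ^ 2),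
      sq_nonneg (lam - 1), sq_nonneg p, mul_nonneg (sq_nonneg (lam - 1)) (sq_nonneg p)]
  have h1 : s ^ 2 = lam ^ 2 * p ^ 2 - 4 * (p - 1) := Real.sq_sqrt h0
  have h2 : 0 ≤ s := Real.sqrt_nonneg _
  have h3 : s < lam * p := by
    refine lt_of_pow_lt_pow_left₀ 2 (by positivity) ?_
    rw [h1]; nlinarith
  have e : gammaExp p lam = (lam * p - s) / 2 := rfl
  refine ⟨by rw [e]; linarith, ?_⟩
  rw [e]
  nlinarith [sq_nonneg (lam * p - s)]

lemma exp_upper {f : ℝ → ℝ} {γ c : ℝ} (hf : Continuous f)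
    (h : (fun y => f y - c * Real.exp (-γ * y)) =o[atTop] fun y => Real.exp (-γ * y)) (y0 : ℝ) :
    ∃ C, 0 ≤ C ∧ ∀ y ≥ y0, |f y| ≤ C * Real.exp (-γ * y) := by
  have h1 := (isLittleO_iff.1 h) one_pos
  obtain ⟨Y, hY⟩ := eventually_atTop.1 h1
  obtain ⟨K, hK⟩ := (isCompact_Icc (a := y0) (b := Y)).exists_bound_of_continuousOn
    (f := fun y => f y * Real.exp (γ * y)) (by fun_prop)
  refine ⟨max (|c| + 1) |K|, le_max_of_le_right (abs_nonneg _), ?_⟩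
  intro y hy
  rcases le_total Y y with hy1 | hy1
  · have h2 := hY y hy1
    rw [Real.norm_eq_abs, Real.norm_eq_abs, abs_of_pos (Real.exp_pos _), one_mul] at h2
    have h3 : |f y| ≤ (|c| + 1) * Real.exp (-γ * y) := by
      have e : f y = (f y - c * Real.exp (-γ * y)) + c * Real.exp (-γ * y) := by ring
      rw [e]
      refine (abs_add_le _ _).trans ?_
      rw [abs_mul, abs_of_pos (Real.exp_pos _)]; linarith
    exact h3.trans (mul_le_mul_of_nonneg_right (le_max_left _ _) (Real.exp_pos _).le)
  · have h2 := hK y ⟨hy, hy1⟩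
    rw [Real.norm_eq_abs, abs_mul, abs_of_pos (Real.exp_pos _)] at h2
    have h3 : |f y| ≤ |K| * Real.exp (-γ * y) := by
      have e : |f y| = |f y| * Real.exp (γ * y) * Real.exp (-γ * y) := by
        rw [mul_assoc, ← Real.exp_add]
        have : γ * y + -γ * y = 0 := by ring
        rw [this, Real.exp_zero, mul_one]
      rw [e]
      exact mul_le_mul_of_nonneg_right (h2.trans (le_abs_self _)) (Real.exp_pos _).le
    exact h3.trans (mul_le_mul_of_nonneg_right (le_max_right _ _) (Real.exp_pos _).le)

lemma exp_lower {f : ℝ → ℝ} {γ c : ℝ} (hf : Continuous f) (hpos : ∀ y, 0 < f y) (hc : 0 < c)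
    (h : (fun y => f y - c * Real.exp (-γ * y)) =o[atTop] fun y => Real.exp (-γ * y)) (y0 : ℝ) :
    ∃ δ, 0 < δ ∧ ∀ y ≥ y0, δ * Real.exp (-γ * y) ≤ f y := by
  have h1 := (isLittleO_iff.1 h) (half_pos hc)
  obtain ⟨Y, hY⟩ := eventually_atTop.1 h1
  obtain ⟨z, hz, hmin⟩ := (isCompact_Icc (a := y0) (b := max y0 Y)).exists_isMinOn
    ⟨y0, le_rfl, le_max_left _ _⟩
    (f := fun y => f y * Real.exp (γ * y)) (by fun_prop)
  set K := f z * Real.exp (γ * z) with hK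
  have hK0 : 0 < K := mul_pos (hpos z) (Real.exp_pos _)
  refine ⟨min (c / 2) K, lt_min (by positivity) hK0, ?_⟩
  intro y hy
  rcases le_total Y y with hy1 | hy1
  · have h2 := hY y hy1
    rw [Real.norm_eq_abs, Real.norm_eq_abs, abs_of_pos (Real.exp_pos _), abs_le] at h2
    have h3 : c / 2 * Real.exp (-γ * y) ≤ f y := by linarith [h2.1]
    exact le_trans (mul_le_mul_of_nonneg_right (min_le_left _ _) (Real.exp_pos _).le) h3
  · have h2 : K ≤ f y * Real.exp (γ * y) := hmin ⟨hy, hy1.trans (le_max_right _ _)⟩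
    have e : f y = f y * Real.exp (γ * y) * Real.exp (-γ * y) := by
      rw [mul_assoc, ← Real.exp_add]
      have : γ * y + -γ * y = 0 := by ring
      rw [this, Real.exp_zero, mul_one]
    rw [e]
    exact mul_le_mul_of_nonneg_right ((min_le_right _ _).trans h2) (Real.exp_pos _).le

/-- The facts on a profile that are used in the barrier construction. -/
structure Prof (p lam : ℝ) (v v1 v2 v3 : ℝ → ℝ) : Prop where
  sm : ContDiff ℝ ∞ v
  d0 : ∀ y, HasDerivAt v (v1 y) y
  d1 : ∀ y, HasDerivAt v1 (v2 y) y
  d2 : ∀ y, HasDerivAt v2 (v3 y) y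
  ode : ∀ y, NN p (v y) (v1 y) (v2 y) + lam * p * v1 y = 0
  gt1 : ∀ y, 1 < v y
  neg : ∀ y, v1 y < 0
  grd : ∃ D, 0 ≤ D ∧ ∀ y, v y - 1 ≤ D * -v1 y ∧ |v2 y| ≤ D * -v1 y
  dec : ∃ γ, 0 < γ ∧ p - 1 ≤ γ * lam * p ∧ ∀ y0, ∃ C, 0 ≤ C ∧ ∀ y ≥ y0,
    v y - 1 ≤ C * Real.exp (-γ * y) ∧ -v1 y ≤ C * Real.exp (-γ * y) ∧
    |v2 y| ≤ C * Real.exp (-γ * y)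
  bd3 : ∀ y0, ∃ C, ∀ y ≥ y0, |v3 y| ≤ C

theorem profile_facts {p lam : ℝ} (hp : 1 < p) (hlam : 1 < lam) {v : ℝ → ℝ}
    (hv : IsTravelingWaveProfile p lam v) :
    Prof p lam v (deriv v) (deriv (deriv v)) (deriv (deriv (deriv v))) := by
  obtain ⟨hC2, hanti, hode, ⟨c1, c2, hc1, hc12, hexp⟩, C, hC, as0, as1, as2⟩ := hv
  obtain ⟨hγ, hγ2⟩ := gamma_facts hp hlam
  set γ := gammaExp p lam with hγdef
  have hp1 : 0 < p - 1 := by linarith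
  have diff0 : Differentiable ℝ v := hC2.differentiable (by norm_num)
  have hC1 : ContDiff ℝ 1 (deriv v) := by
    have h2 : (2 : WithTop ℕ∞) = 1 + 1 := by norm_num
    rw [h2, contDiff_succ_iff_deriv] at hC2
    exact hC2.2.2
  have diff1 : Differentiable ℝ (deriv v) := hC1.differentiable (by norm_num)
  have cont2 : Continuous (deriv (deriv v)) := by
    rw [contDiff_one_iff_deriv] at hC1; exact hC1.2
  have expz : Tendsto (fun y : ℝ => Real.exp (-γ * y)) atTop (nhds 0) := by
    refine Real.tendsto_exp_atBot.comp ?_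
    exact tendsto_id.const_mul_atTop_of_neg (by linarith)
  have lim1 : Tendsto v atTop (nhds 1) := by
    have a := as0.trans_tendsto expz
    have b := (a.add (expz.const_mul C)).add_const 1
    simp only [mul_zero, add_zero, zero_add] at b
    refine b.congr fun y => ?_
    ring
  have gt1 : ∀ y, 1 < v y := by
    intro y
    have : (1:ℝ) ≤ v (y + 1) := hanti.antitone.le_of_tendsto lim1 (y + 1)
    exact lt_of_le_of_lt this (hanti (by linarith))
  have le0 : ∀ y, deriv v y ≤ 0 := fun y => hanti.antitone.deriv_nonpos
  have neg : ∀ y, deriv v y < 0 := by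
    intro y
    refine lt_of_le_of_ne (le0 y) fun h0 => ?_
    have hm : IsLocalMax (deriv v) y := Eventually.of_forall fun z => by
      rw [h0]; exact le0 z
    have h2 := hm.deriv_eq_zero
    have := hode y
    rw [h2, h0] at this
    have h3 : 0 < (p - 1) * (v y ^ 2 - v y) := mul_pos hp1 (by nlinarith [gt1 y])
    nlinarith
  have sm : ContDiff ℝ ∞ v := by
    rw [← contDiffOn_univ]
    refine ode_smooth (f1 := deriv v) (f2 := deriv (deriv v)) (a := p / (p - 1)) (b := -(lam * p))
      (d := -(p - 1)) (e := p - 1) (g := fun _ => 0) isOpen_univ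
      (fun y _ => (diff0 y).hasDerivAt) (fun y _ => (diff1 y).hasDerivAt)
      (fun y _ => by linarith [gt1 y]) contDiffOn_const (fun y _ => ?_)
    linarith [hode y]
  have sm1 : ContDiff ℝ ∞ (deriv v) := (contDiff_infty_iff_deriv.1 sm).2
  have sm2 : ContDiff ℝ ∞ (deriv (deriv v)) := (contDiff_infty_iff_deriv.1 sm1).2
  have diff2 : Differentiable ℝ (deriv (deriv v)) := (contDiff_infty_iff_deriv.1 sm2).1
  have as1' : (fun y => -deriv v y - γ * C * Real.exp (-γ * y)) =o[atTop]
      fun y => Real.exp (-γ * y) := by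
    refine as1.neg_left.congr_left fun y => ?_
    ring
  have as0' : (fun y => (v y - 1) - C * Real.exp (-γ * y)) =o[atTop]
      fun y => Real.exp (-γ * y) := as0
  have cont0 : Continuous v := diff0.continuous
  have cont1 : Continuous (deriv v) := diff1.continuous
  have dec : ∀ y0, ∃ C, 0 ≤ C ∧ ∀ y ≥ y0,
      v y - 1 ≤ C * Real.exp (-γ * y) ∧ -deriv v y ≤ C * Real.exp (-γ * y) ∧
      |deriv (deriv v) y| ≤ C * Real.exp (-γ * y) := by
    intro y0
    obtain ⟨K0, hK0, b0⟩ := exp_upper (f := fun y => v y - 1) (cont0.sub continuous_const) as0' y0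
    obtain ⟨K1, hK1, b1⟩ := exp_upper (f := fun y => -deriv v y) cont1.neg as1' y0
    obtain ⟨K2, hK2, b2⟩ := exp_upper cont2 as2 y0
    refine ⟨K0 + K1 + K2, by positivity, fun y hy => ?_⟩
    have E := Real.exp_pos (-γ * y)
    have e0 := mul_nonneg hK0 E.le
    have e1 := mul_nonneg hK1 E.le
    have e2 := mul_nonneg hK2 E.le
    have e : (K0 + K1 + K2) * Real.exp (-γ * y) = K0 * Real.exp (-γ * y) +
      K1 * Real.exp (-γ * y) + K2 * Real.exp (-γ * y) := by ring
    rw [e]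
    refine ⟨?_, ?_, ?_⟩
    · linarith [le_abs_self (v y - 1), b0 y hy]
    · linarith [le_abs_self (-deriv v y), b1 y hy]
    · linarith [b2 y hy]
  refine ⟨sm, fun y => (diff0 y).hasDerivAt, fun y => (diff1 y).hasDerivAt,
    fun y => (diff2 y).hasDerivAt, ?_, gt1, neg, ?_, ⟨γ, hγ, hγ2, dec⟩, ?_⟩
  · intro y
    have := hode y
    unfold NN; linarith
  · obtain ⟨K, hK, b⟩ := dec 0
    obtain ⟨δ, hδ, bl⟩ := exp_lower (f := fun y => -deriv v y) cont1.neg (fun y => by linarith [neg y]) (by positivity) as1' 0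
    refine ⟨max (c2 / c1) (K / δ), le_max_of_le_right (by positivity), fun y => ?_⟩
    have hn : 0 ≤ -deriv v y := by linarith [neg y]
    rcases le_total y 0 with hy | hy
    · obtain ⟨⟨-, q1⟩, ⟨q2, -⟩, q3, q4⟩ := hexp y hy
      have E := Real.exp_pos (-(p - 1) * y)
      have c20 : 0 < c2 := lt_of_lt_of_le hc1 hc12
      have h1 : c2 * Real.exp (-(p - 1) * y) ≤ c2 / c1 * -deriv v y := by
        rw [div_mul_eq_mul_div, le_div_iff₀ hc1]
        calc c2 * Real.exp (-(p - 1) * y) * c1 = c2 * (c1 * Real.exp (-(p - 1) * y)) := by ring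
          _ ≤ _ := mul_le_mul_of_nonneg_left q2 c20.le
      have h2 := mul_le_mul_of_nonneg_right (le_max_left (c2 / c1) (K / δ)) hn
      refine ⟨by linarith, ?_⟩
      rw [abs_of_nonneg (le_trans (by positivity) q3)]
      linarith
    · obtain ⟨q1, -, q3⟩ := b y hy
      have h0 := bl y hy
      have h1 : K * Real.exp (-γ * y) ≤ K / δ * -deriv v y := by
        rw [div_mul_eq_mul_div, le_div_iff₀ hδ]
        calc K * Real.exp (-γ * y) * δ = K * (δ * Real.exp (-γ * y)) := by ring
          _ ≤ _ := mul_le_mul_of_nonneg_left h0 hK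
      have h2 := mul_le_mul_of_nonneg_right (le_max_right (c2 / c1) (K / δ)) hn
      exact ⟨by linarith, by linarith⟩
  · intro y0
    obtain ⟨K, hK, b⟩ := dec y0
    set B := K * Real.exp (-γ * y0) with hB
    have hB0 : 0 ≤ B := by positivity
    have bb : ∀ y ≥ y0, v y ≤ B + 1 ∧ |deriv v y| ≤ B ∧ |deriv (deriv v) y| ≤ B := by
      intro y hy
      obtain ⟨q1, q2, q3⟩ := b y hy
      have h1 : K * Real.exp (-γ * y) ≤ B :=
        mul_le_mul_of_nonneg_left (Real.exp_le_exp.2 (by nlinarith)) hK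
      refine ⟨by linarith, ?_, by linarith⟩
      rw [abs_of_neg (neg y)]; linarith
    have hq : 0 < p / (p - 1) := by positivity
    refine ⟨B * B + p / (p - 1) * (2 * (B * B)) + lam * p * B +
      (p - 1) * (2 * (B + 1) + 1) * B, fun y hy => ?_⟩
    obtain ⟨q0, q1, q2⟩ := bb y hy
    have D0 := (diff0 y).hasDerivAt
    have D1 := (diff1 y).hasDerivAt
    have D2 := (diff2 y).hasDerivAt
    have id1 : (((v * deriv (deriv v)) - (fun y => p / (p - 1) * (deriv v y) ^ 2))
        + (fun y => lam * p * deriv v y)) + (fun y => (p - 1) * (v y ^ 2 - v y)) =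
        fun _ => (0:ℝ) := by
      funext z; exact hode z
    have Dd := (((D0.mul D2).sub ((D1.pow 2).const_mul (p / (p - 1)))).add
      (D1.const_mul (lam * p))).add (((D0.pow 2).sub D0).const_mul (p - 1))
    have hz := Dd.unique (by
      have := hasDerivAt_const y (0:ℝ)
      rw [← id1] at this; exact this)
    set w1 := deriv v y
    set w2 := deriv (deriv v) y
    set w3 := deriv (deriv (deriv v)) y
    have hz' : v y * w3 = -(w1 * w2) + p / (p - 1) * (2 * (w1 * w2)) - lam * p * w2
        - (p - 1) * (2 * v y - 1) * w1 := by
      norm_num at hz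
      linarith
    have a12 : |w1 * w2| ≤ B * B := by
      rw [abs_mul]; exact mul_le_mul q1 q2 (abs_nonneg _) hB0
    have t1 : |p / (p - 1) * (2 * (w1 * w2))| ≤ p / (p - 1) * (2 * (B * B)) := by
      rw [abs_mul, abs_of_pos hq, abs_mul, abs_two]
      exact mul_le_mul_of_nonneg_left (by linarith) hq.le
    have hlp : 0 < lam * p := by positivity
    have t2 : |lam * p * w2| ≤ lam * p * B := by
      rw [abs_mul, abs_of_pos hlp]
      exact mul_le_mul_of_nonneg_left q2 hlp.le
    have t3 : |(p - 1) * (2 * v y - 1) * w1| ≤ (p - 1) * (2 * (B + 1) + 1) * B := by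
      have g := gt1 y
      rw [abs_mul, abs_mul, abs_of_pos hp1, abs_of_pos (by linarith : 0 < 2 * v y - 1)]
      refine mul_le_mul (mul_le_mul_of_nonneg_left (by linarith) hp1.le) q1 (abs_nonneg _)
        (by positivity)
    have t4 : |v y * w3| ≤ B * B + p / (p - 1) * (2 * (B * B)) + lam * p * B +
        (p - 1) * (2 * (B + 1) + 1) * B := by
      rw [hz']
      rw [abs_le] at *
      constructor <;> linarith [a12.1, a12.2, t1.1, t1.2, t2.1, t2.2, t3.1, t3.2]
    refine le_trans ?_ t4
    rw [abs_mul, abs_of_pos (by linarith [gt1 y] : 0 < v y)]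
    nlinarith [abs_nonneg w3, gt1 y]

end

section
open Filter Asymptotics
open scoped ContDiff

lemma cross_bd {c b D C1 k E A B C a1 b1 v2 w2 : ℝ} (hc : 0 ≤ c) (hb : 0 ≤ b) (hD : 0 ≤ D)
    (hE : 0 ≤ E) (hA : 0 ≤ A) (hB : 0 ≤ B) (hC : 0 ≤ C) (ha1 : 0 ≤ a1)
    (hb1 : 0 ≤ b1) (A1 : A ≤ D * a1) (A2 : |v2| ≤ D * a1) (B1 : B ≤ D * b1) (B2 : |w2| ≤ D * b1)
    (hCE : C ≤ 2 * k * E) (e0 : A ≤ C1 * E) (e1 : a1 ≤ C1 * E) (e2 : |v2| ≤ C1 * E) :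
    B * v2 + A * w2 + C * (v2 + w2) + 2 * c * (a1 * b1) + 2 * b * (A * B + A * C + B * C) ≤
      E * ((2 * D * C1 + 2 * k * D + 2 * c * C1 + 2 * b * D * C1 + 4 * b * k * D) * (a1 + b1)) := by
  have hC1 : 0 ≤ C1 * E := ha1.trans e1
  have hkE : 0 ≤ 2 * k * E := hC.trans hCE
  have hDa : 0 ≤ D * a1 := mul_nonneg hD ha1
  have hDb : 0 ≤ D * b1 := mul_nonneg hD hb1
  have t1 : B * v2 ≤ D * b1 * (C1 * E) :=
    (mul_le_mul_of_nonneg_left (le_abs_self v2) hB).trans (mul_le_mul B1 e2 (abs_nonneg _) hDb)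
  have t2 : A * w2 ≤ C1 * E * (D * b1) :=
    (mul_le_mul_of_nonneg_left (le_abs_self w2) hA).trans (mul_le_mul e0 B2 (abs_nonneg _) hC1)
  have t3 : C * (v2 + w2) ≤ 2 * k * E * (D * a1 + D * b1) := by
    refine (mul_le_mul_of_nonneg_left
      (add_le_add ((le_abs_self v2).trans A2) ((le_abs_self w2).trans B2)) hC).trans ?_
    exact mul_le_mul_of_nonneg_right hCE (by linarith)
  have t4 : 2 * c * (a1 * b1) ≤ 2 * c * (C1 * E * b1) :=
    mul_le_mul_of_nonneg_left (mul_le_mul_of_nonneg_right e1 hb1) (by linarith)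
  have t5 : A * B ≤ C1 * E * (D * b1) := mul_le_mul e0 B1 hB hC1
  have t6 : A * C + B * C ≤ (D * a1 + D * b1) * (2 * k * E) := by
    rw [← add_mul]
    exact mul_le_mul (add_le_add A1 B1) hCE hC (by linarith)
  have t7 : 2 * b * (A * B + A * C + B * C) ≤
      2 * b * (C1 * E * (D * b1) + (D * a1 + D * b1) * (2 * k * E)) :=
    mul_le_mul_of_nonneg_left (by linarith) (by linarith)
  have s1 : 0 ≤ 2 * (D * a1 * (C1 * E)) := by positivity
  have s2 : 0 ≤ 2 * c * (C1 * E * a1) := by positivity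
  have s3 : 0 ≤ 2 * b * (C1 * E * (D * a1)) := by positivity
  have e : E * ((2 * D * C1 + 2 * k * D + 2 * c * C1 + 2 * b * D * C1 + 4 * b * k * D)
      * (a1 + b1)) =
      D * b1 * (C1 * E) + C1 * E * (D * b1) + 2 * k * E * (D * a1 + D * b1) +
      2 * c * (C1 * E * b1) + 2 * b * (C1 * E * (D * b1) + (D * a1 + D * b1) * (2 * k * E)) +
      2 * (D * a1 * (C1 * E)) + 2 * c * (C1 * E * a1) + 2 * b * (C1 * E * (D * a1)) := by ring
  rw [e]
  linarith

lemma Barr.wave {p lam τ s : ℝ} {v v1 v2 v3 θ θ' : ℝ → ℝ} (P : Prof p lam v v1 v2 v3)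
    (hθ : ∀ t, HasDerivAt θ (θ' t) t) (hθ' : Continuous θ') :
    Barr τ (fun x t => v (s * x + θ t)) (fun x t => θ' t * v1 (s * x + θ t))
      (fun x t => s * v1 (s * x + θ t)) (fun x t => s * (s * v2 (s * x + θ t))) := by
  have cθ : Continuous θ := continuous_iff_continuousAt.2 fun t => (hθ t).continuousAt
  have c0 : Continuous v := continuous_iff_continuousAt.2 fun t => (P.d0 t).continuousAt
  have c1 : Continuous v1 := continuous_iff_continuousAt.2 fun t => (P.d1 t).continuousAt
  have c2 : Continuous v2 := continuous_iff_continuousAt.2 fun t => (P.d2 t).continuousAt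
  have dl : ∀ x t, HasDerivAt (fun y => s * y + θ t) s x := fun x t =>
    (((hasDerivAt_id x).const_mul s).add_const (θ t)).congr_deriv (by simp)
  have dt : ∀ x t, HasDerivAt (fun r => s * x + θ r) (θ' t) t := fun x t =>
    (hθ t).const_add (s * x)
  refine ⟨?_, ?_, ?_, ?_, ?_, ?_, ?_⟩
  · intro t _ x
    exact ((P.d0 _).comp x (dl x t)).congr_deriv (by ring)
  · intro t _ x
    exact (((P.d1 _).comp x (dl x t)).const_mul s).congr_deriv (by ring)
  · intro t _ x
    exact ((P.d0 _).comp t (dt x t)).congr_deriv (by ring)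
  all_goals
    refine Continuous.continuousOn ?_
    unfold Function.uncurry
    fun_prop

lemma Barr.add {τ : ℝ} {φ φt φx φxx ψ ψt ψx ψxx : ℝ → ℝ → ℝ} (A : Barr τ φ φt φx φxx)
    (B : Barr τ ψ ψt ψx ψxx) :
    Barr τ (fun x t => φ x t + ψ x t) (fun x t => φt x t + ψt x t)
      (fun x t => φx x t + ψx x t) (fun x t => φxx x t + ψxx x t) :=
  ⟨fun t ht x => (A.dx t ht x).add (B.dx t ht x), fun t ht x => (A.dxx t ht x).add (B.dxx t ht x),
    fun t ht x => (A.dt t ht x).add (B.dt t ht x), A.c.add B.c, A.ct.add B.ct, A.cx.add B.cx,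
    A.cxx.add B.cxx⟩

/-- The constant-in-space solution. -/
noncomputable def xi (k a t : ℝ) : ℝ := 1 / (1 - k * Real.exp (a * t))

lemma xi_deriv {k a t : ℝ} (h : k * Real.exp (a * t) ≤ 1 / 2) :
    HasDerivAt (xi k a) (a * (xi k a t ^ 2 - xi k a t)) t := by
  have hne : 1 - k * Real.exp (a * t) ≠ 0 := by linarith
  have d : HasDerivAt (fun t => 1 - k * Real.exp (a * t)) (-(k * (Real.exp (a * t) * a))) t := by
    have := ((((hasDerivAt_id t).const_mul a).exp).const_mul k).const_sub 1
    exact this.congr_deriv (by simp)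
  have := d.inv hne
  have e : xi k a = (fun t => 1 - k * Real.exp (a * t))⁻¹ := by
    funext s; simp [xi]
  rw [e]
  refine this.congr_deriv ?_
  simp only [Pi.inv_apply]
  field_simp
  ring

lemma xi_bd {k a t : ℝ} (hk : 0 ≤ k) (h : k * Real.exp (a * t) ≤ 1 / 2) :
    1 ≤ xi k a t ∧ xi k a t ≤ 2 ∧ xi k a t - 1 ≤ 2 * k * Real.exp (a * t) := by
  have h0 : 0 ≤ k * Real.exp (a * t) := mul_nonneg hk (Real.exp_pos _).le
  have hpos : 0 < 1 - k * Real.exp (a * t) := by linarith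
  unfold xi
  refine ⟨?_, ?_, ?_⟩
  · rw [le_div_iff₀ hpos]; linarith
  · rw [div_le_iff₀ hpos]; linarith
  · have : 1 / (1 - k * Real.exp (a * t)) ≤ 1 + 2 * (k * Real.exp (a * t)) := by
      rw [div_le_iff₀ hpos]; nlinarith
    linarith

lemma Barr.xi {k a τ : ℝ} (c : ℝ) (h : ∀ t ≤ τ, k * Real.exp (a * t) ≤ 1 / 2) :
    Barr τ (fun _ t => xi k a t + c) (fun _ t => a * (xi k a t ^ 2 - xi k a t))
      (fun _ _ => 0) (fun _ _ => 0) := by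
  have cx : ContinuousOn (fun y : ℝ × ℝ => _root_.xi k a y.2) (Set.univ ×ˢ Set.Iic τ) := by
    have h1 : ContinuousOn (_root_.xi k a) (Set.Iic τ) := fun t ht =>
      (xi_deriv (h t ht)).continuousAt.continuousWithinAt
    exact h1.comp continuousOn_snd fun y hy => hy.2
  refine ⟨fun t _ x => hasDerivAt_const _ _, fun t _ x => hasDerivAt_const _ _,
    fun t ht x => (xi_deriv (h t ht)).add_const c, ?_, ?_, ?_, ?_⟩
  · exact cx.add continuousOn_const
  · exact continuousOn_const.mul ((cx.pow 2).sub cx)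
  · exact continuousOn_const
  · exact continuousOn_const

/-- Time shift for the upper barrier. -/
noncomputable def th (lam h q a t : ℝ) : ℝ := -(lam * t * (1 - q * Real.exp (a * t))) + h
noncomputable def th' (lam q a t : ℝ) : ℝ := -(lam * (1 - q * Real.exp (a * t) * (1 + a * t)))

lemma th_deriv (lam h q a t : ℝ) : HasDerivAt (th lam h q a) (th' lam q a t) t := by
  have d1 : HasDerivAt (fun t => 1 - q * Real.exp (a * t)) (-(q * (Real.exp (a * t) * a))) t := by
    have := ((((hasDerivAt_id t).const_mul a).exp).const_mul q).const_sub 1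
    exact this.congr_deriv (by simp)
  have d2 := ((((hasDerivAt_id t).const_mul lam).mul d1).neg).add_const h
  refine d2.congr_deriv ?_
  unfold th'
  simp; ring

lemma th'_cont (lam q a : ℝ) : Continuous (th' lam q a) := by
  unfold th'; fun_prop

lemma th_ge {lam h q a t : ℝ} (hlam : 1 < lam) (ht : t ≤ -1)
    (hq : -t * (q * Real.exp (a * t)) ≤ 1) : h ≤ th lam h q a t := by
  have h1 : q * Real.exp (a * t) ≤ 1 := by
    by_contra hcon
    push Not at hcon
    nlinarith
  have : 0 ≤ (-t) * (1 - q * Real.exp (a * t)) := mul_nonneg (by linarith) (by linarith)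
  have h2 := mul_nonneg (by linarith : 0 ≤ lam) this
  unfold th
  linarith

/-- Exponential smallness of a wave on its far side. -/
lemma far_small {lam h q p γ t y : ℝ} (hp : 1 < p) (hlam : 1 < lam) (hγ : 0 < γ)
    (hγ2 : p - 1 ≤ γ * lam * p) (ht : t ≤ -1)
    (hq : -t * (q * Real.exp ((p - 1) / p * t)) ≤ 1) (hy : th lam h q ((p - 1) / p) t ≤ y) :
    Real.exp (-γ * y) ≤ Real.exp (γ * (lam - h)) * Real.exp ((p - 1) / p * t) := by
  rw [← Real.exp_add, Real.exp_le_exp]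
  have hp0 : 0 < p := by linarith
  have h1 : (p - 1) / p ≤ γ * lam := by rw [div_le_iff₀ hp0]; linarith
  have h2 : γ * lam * t ≤ (p - 1) / p * t := mul_le_mul_of_nonpos_right h1 (by linarith)
  have h3 := mul_le_mul_of_nonneg_left hy hγ.le
  have h4 := mul_le_mul_of_nonneg_left hq (by positivity : 0 ≤ γ * lam)
  unfold th at h3
  nlinarith

lemma choose_time {a q k : ℝ} (ha : 0 < a) :
    ∃ τ : ℝ, ∀ t ≤ τ, t ≤ -1 ∧ 1 + a * t ≤ -1 ∧ k * Real.exp (a * t) ≤ 1 / 2 ∧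
      -t * (q * Real.exp (a * t)) ≤ 1 := by
  have hat : Tendsto (fun t : ℝ => a * t) atBot atBot := tendsto_id.const_mul_atBot ha
  have e0 : Tendsto (fun t : ℝ => k * Real.exp (a * t)) atBot (nhds 0) := by
    have := (Real.tendsto_exp_atBot.comp hat).const_mul k
    simpa using this
  have e1 : Tendsto (fun t : ℝ => -t * (q * Real.exp (a * t))) atBot (nhds 0) := by
    have h1 := (Real.tendsto_pow_mul_exp_neg_atTop_nhds_zero 1).comp
      (tendsto_neg_atBot_atTop.comp hat)
    have h2 := h1.const_mul (q / a)
    rw [mul_zero] at h2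
    refine h2.congr fun t => ?_
    simp only [Function.comp, pow_one, neg_neg]
    field_simp
  have ev := ((eventually_le_atBot (-1 : ℝ)).and ((hat.eventually_le_atBot (-2)))).and
    ((e0.eventually_le_const (show (0:ℝ) < 1 / 2 by norm_num)).and
      (e1.eventually_le_const (show (0:ℝ) < 1 by norm_num)))
  obtain ⟨τ, hτ⟩ := eventually_atBot.1 ev
  refine ⟨τ, fun t ht => ?_⟩
  obtain ⟨⟨h1, h2⟩, h3, h4⟩ := hτ t ht
  exact ⟨h1, by linarith, h3, h4⟩

end

section
open Filter Asymptotics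
open scoped ContDiff

lemma NN_neg (p u u1 u2 : ℝ) : NN p u (-1 * u1) (-1 * (-1 * u2)) = NN p u u1 u2 := by
  unfold NN; ring

lemma NN_one (p u u1 u2 : ℝ) : NN p u (1 * u1) (1 * (1 * u2)) = NN p u u1 u2 := by
  unfold NN; ring

/-- Superposition is a strict supersolution: the algebra. -/
lemma super_alg {p lam lam' q E z K v v1 v2 w w1 w2 ξ : ℝ} (hp : 1 < p) (hlam : 1 < lam)
    (hlam' : 1 < lam') (hE : 0 < E) (hK : 0 ≤ K) (hq : K + 1 ≤ q) (hz : z ≤ -1)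
    (hv : NN p v v1 v2 + lam * p * v1 = 0) (hw : NN p w w1 w2 + lam' * p * w1 = 0)
    (nv : v1 < 0) (nw : w1 < 0)
    (hcross : (w - 1) * v2 + (v - 1) * w2 + (ξ - 1) * (v2 + w2) + 2 * (p / (p - 1)) * (-v1 * -w1)
      + 2 * (p - 1) * ((v - 1) * (w - 1) + (v - 1) * (ξ - 1) + (w - 1) * (ξ - 1))
      ≤ E * (K * (-v1 + -w1))) :
    NN p (v + (w + (ξ + -2))) (1 * v1 + (-1 * w1 + 0)) (1 * (1 * v2) + (-1 * (-1 * w2) + 0)) <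
      p * (-(lam * (1 - q * E * z)) * v1 + (-(lam' * (1 - q * E * z)) * w1 +
        (p - 1) / p * (ξ ^ 2 - ξ))) := by
  have hp0 : p ≠ 0 := by linarith
  have e1 : NN p (v + (w + (ξ + -2))) (1 * v1 + (-1 * w1 + 0)) (1 * (1 * v2) + (-1 * (-1 * w2) + 0))
      = NN p v v1 v2 + NN p w w1 w2 + (p - 1) * (ξ ^ 2 - ξ) +
      ((w - 1) * v2 + (v - 1) * w2 + (ξ - 1) * (v2 + w2) + 2 * (p / (p - 1)) * (-v1 * -w1)
      + 2 * (p - 1) * ((v - 1) * (w - 1) + (v - 1) * (ξ - 1) + (w - 1) * (ξ - 1))) := by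
    unfold NN; ring
  have e2 : p * (-(lam * (1 - q * E * z)) * v1 + (-(lam' * (1 - q * E * z)) * w1 +
        (p - 1) / p * (ξ ^ 2 - ξ))) = -(lam * p * v1) - (lam' * p * w1) + (p - 1) * (ξ ^ 2 - ξ)
        + p * q * E * -z * (lam * -v1 + lam' * -w1) := by
    field_simp; ring
  rw [e1, e2]
  have s0 : 0 < -v1 + -w1 := by linarith
  have s1 : -v1 + -w1 ≤ lam * -v1 + lam' * -w1 := by nlinarith
  have hq0 : 0 < q := by linarith
  have s2 : K + 1 ≤ p * q * -z := by
    have : q ≤ p * q := by nlinarith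
    have h3 : p * q * 1 ≤ p * q * -z := mul_le_mul_of_nonneg_left (by linarith) (by linarith)
    linarith
  have s3 : (K + 1) * (-v1 + -w1) ≤ p * q * -z * (lam * -v1 + lam' * -w1) :=
    mul_le_mul s2 s1 s0.le (by linarith)
  have s4 := mul_le_mul_of_nonneg_left s3 hE.le
  have s5 : 0 < E * (-v1 + -w1) := mul_pos hE s0
  have e3 : E * (p * q * -z * (lam * -v1 + lam' * -w1)) =
    p * q * E * -z * (lam * -v1 + lam' * -w1) := by ring
  have e4 : E * ((K + 1) * (-v1 + -w1)) = E * (K * (-v1 + -w1)) + E * (-v1 + -w1) := by ring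
  linarith

lemma Prof.far_bd {p lam h : ℝ} {v v1 v2 v3 : ℝ → ℝ} (P : Prof p lam v v1 v2 v3) (hp : 1 < p)
    (hlam : 1 < lam) : ∃ C, 0 ≤ C ∧ ∀ q t y, t ≤ -1 →
      -t * (q * Real.exp ((p - 1) / p * t)) ≤ 1 → th lam h q ((p - 1) / p) t ≤ y →
      v y - 1 ≤ C * Real.exp ((p - 1) / p * t) ∧ -v1 y ≤ C * Real.exp ((p - 1) / p * t) ∧
      |v2 y| ≤ C * Real.exp ((p - 1) / p * t) := by
  obtain ⟨γ, hγ, hγ2, hdec⟩ := P.dec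
  obtain ⟨C, hC, hd⟩ := hdec h
  refine ⟨C * Real.exp (γ * (lam - h)), by positivity, ?_⟩
  intro q t y ht hq hy
  have h1 := far_small hp hlam hγ hγ2 ht hq hy
  have h2 := hd y ((th_ge hlam ht hq).trans hy)
  have h3 := mul_le_mul_of_nonneg_left h1 hC
  rw [← mul_assoc] at h3
  exact ⟨h2.1.trans h3, h2.2.1.trans h3, h2.2.2.trans h3⟩

lemma Prof.loc_bd {p lam : ℝ} {v v1 v2 v3 : ℝ → ℝ} (P : Prof p lam v v1 v2 v3) (y0 : ℝ) :
    ∃ M, 0 ≤ M ∧ ∀ y ≥ y0, v y ≤ M ∧ |v1 y| ≤ M ∧ |v2 y| ≤ M ∧ |v3 y| ≤ M := by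
  obtain ⟨γ, hγ, hγ2, hdec⟩ := P.dec
  obtain ⟨C, hC, hd⟩ := hdec y0
  obtain ⟨C3, hd3⟩ := P.bd3 y0
  have hB0 : 0 ≤ C * Real.exp (-γ * y0) := by positivity
  refine ⟨C * Real.exp (-γ * y0) + 1 + |C3|, by positivity, ?_⟩
  intro y hy
  obtain ⟨q1, q2, q3⟩ := hd y hy
  have h1 : C * Real.exp (-γ * y) ≤ C * Real.exp (-γ * y0) :=
    mul_le_mul_of_nonneg_left (Real.exp_le_exp.2 (by nlinarith)) hC
  have h3 := hd3 y hy
  have := abs_nonneg C3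
  have := le_abs_self C3
  refine ⟨by linarith, ?_, by linarith, by linarith⟩
  rw [abs_of_neg (P.neg y)]; linarith

theorem ancient_main {p lam lam' h h' k : ℝ} (hp : 1 < p) (hlam : 1 < lam) (hlam' : 1 < lam')
    (hk : 0 ≤ k) {v v1 v2 v3 w w1 w2 w3 : ℝ → ℝ} (P : Prof p lam v v1 v2 v3)
    (Q : Prof p lam' w w1 w2 w3) :
    ∃ q : ℝ, 0 < q ∧ ∃ τ : ℝ, τ ≤ -1 ∧ ∃ F : ℕ → ℝ → ℝ → ℝ,
      (∀ t ≤ τ, ContDiff ℝ 2 (fun x => F 0 x t)) ∧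
      (∀ t ≤ τ, ∀ x, deriv (fun y => F 0 y t) x = F 1 x t ∧
        deriv (deriv fun y => F 0 y t) x = F 2 x t) ∧
      (∀ t < τ, ∀ x, HasDerivAt (fun s => F 0 x s) (NN p (F 0 x t) (F 1 x t) (F 2 x t) / p) t) ∧
      (∀ x, ContinuousOn (fun t => NN p (F 0 x t) (F 1 x t) (F 2 x t) / p) (Set.Iio τ)) ∧
      (∀ x, ∀ t ≤ τ, 1 ≤ F 0 x t ∧
        F 0 x t ≤ v (1 * x + th lam h q ((p - 1) / p) t) +
          (w (-1 * x + th lam' h' q ((p - 1) / p) t) + (xi k ((p - 1) / p) t + -2)) ∧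
        v (1 * x + th lam h 0 ((p - 1) / p) t) ≤ F 0 x t ∧
        w (-1 * x + th lam' h' 0 ((p - 1) / p) t) ≤ F 0 x t ∧
        xi k ((p - 1) / p) t ≤ F 0 x t) := by
  have hp1 : 0 < p - 1 := by linarith
  have hp0 : 0 < p := by linarith
  set a := (p - 1) / p with ha
  have ha0 : 0 < a := div_pos hp1 hp0
  have hc : 0 < p / (p - 1) := div_pos hp0 hp1
  obtain ⟨D1, hD1, g1⟩ := P.grd
  obtain ⟨D2, hD2, g2⟩ := Q.grd
  obtain ⟨C1, hC1, f1⟩ := P.far_bd (h := h) hp hlam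
  obtain ⟨C2, hC2, f2⟩ := Q.far_bd (h := h') hp hlam'
  rw [← ha] at f1 f2
  set D := max D1 D2 with hD
  set C := max C1 C2 with hC
  have hD0 : 0 ≤ D := le_max_of_le_left hD1
  have hC0 : 0 ≤ C := le_max_of_le_left hC1
  have g1' : ∀ y, v y - 1 ≤ D * -v1 y ∧ |v2 y| ≤ D * -v1 y := fun y => by
    have := mul_le_mul_of_nonneg_right (le_max_left D1 D2) (by linarith [P.neg y] : 0 ≤ -v1 y)
    exact ⟨(g1 y).1.trans this, (g1 y).2.trans this⟩
  have g2' : ∀ y, w y - 1 ≤ D * -w1 y ∧ |w2 y| ≤ D * -w1 y := fun y => by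
    have := mul_le_mul_of_nonneg_right (le_max_right D1 D2) (by linarith [Q.neg y] : 0 ≤ -w1 y)
    exact ⟨(g2 y).1.trans this, (g2 y).2.trans this⟩
  set K := 2 * D * C + 2 * k * D + 2 * (p / (p - 1)) * C + 2 * (p - 1) * D * C
    + 4 * (p - 1) * k * D with hK
  have hK0 : 0 ≤ K := by positivity
  set q := K + 1 with hq
  have hq0 : 0 < q := by positivity
  obtain ⟨τ, hτ⟩ := choose_time (a := a) (q := q) (k := k) ha0
  refine ⟨q, hq0, τ, (hτ τ le_rfl).1, ?_⟩
  have hxi : ∀ t ≤ τ, k * Real.exp (a * t) ≤ 1 / 2 := fun t ht => (hτ t ht).2.2.1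
  have hxb : ∀ t ≤ τ, 1 ≤ xi k a t ∧ xi k a t ≤ 2 ∧ xi k a t - 1 ≤ 2 * k * Real.exp (a * t) :=
    fun t ht => xi_bd hk (hxi t ht)
  have BV := Barr.wave (τ := τ) (s := 1) P (th_deriv lam h q a) (th'_cont lam q a)
  have BW := Barr.wave (τ := τ) (s := -1) Q (th_deriv lam' h' q a) (th'_cont lam' q a)
  have BX := Barr.xi (k := k) (a := a) (τ := τ) (-2) hxi
  have BΦ := BV.add (BW.add BX)
  have bV := Barr.wave (τ := τ) (s := 1) P (th_deriv lam h 0 a) (th'_cont lam 0 a)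
  have bW := Barr.wave (τ := τ) (s := -1) Q (th_deriv lam' h' 0 a) (th'_cont lam' 0 a)
  have bX := Barr.xi (k := k) (a := a) (τ := τ) 0 hxi
  have hge : ∀ x, ∀ t ≤ τ, 1 ≤ v (1 * x + th lam h q a t) +
          (w (-1 * x + th lam' h' q a t) + (xi k a t + -2)) := by
    intro x t ht
    linarith [P.gt1 (1 * x + th lam h q a t), Q.gt1 (-1 * x + th lam' h' q a t), (hxb t ht).1]
  have thle : ∀ {l hh t : ℝ}, 1 < l → t ≤ τ → th l hh q a t ≤ th l hh 0 a t := by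
    intro l hh t hl ht
    have h1 := (hτ t ht).1
    have h2 : 0 ≤ l * (-t) * (q * Real.exp (a * t)) := by
      have : 0 ≤ -t := by linarith
      positivity
    unfold th
    linarith
  have antiV : Antitone v := antitone_of_deriv_nonpos (fun y => (P.d0 y).differentiableAt)
    (fun y => by rw [(P.d0 y).deriv]; exact (P.neg y).le)
  have antiW : Antitone w := antitone_of_deriv_nonpos (fun y => (Q.d0 y).differentiableAt)
    (fun y => by rw [(Q.d0 y).deriv]; exact (Q.neg y).le)
  have hsup : ∀ x, ∀ t ≤ τ,
      NN p (v (1 * x + th lam h q a t) + (w (-1 * x + th lam' h' q a t) + (xi k a t + -2)))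
        (1 * v1 (1 * x + th lam h q a t) + (-1 * w1 (-1 * x + th lam' h' q a t) + 0))
        (1 * (1 * v2 (1 * x + th lam h q a t)) + (-1 * (-1 * w2 (-1 * x + th lam' h' q a t)) + 0))
      < p * (th' lam q a t * v1 (1 * x + th lam h q a t) +
        (th' lam' q a t * w1 (-1 * x + th lam' h' q a t) + a * (xi k a t ^ 2 - xi k a t))) := by
    intro x t ht
    obtain ⟨ht1, hz, -, htq⟩ := hτ t ht
    obtain ⟨x1, -, x3⟩ := hxb t ht
    set y := 1 * x + th lam h q a t with hy
    set z := -1 * x + th lam' h' q a t with hzz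
    have E := Real.exp_pos (a * t)
    refine super_alg hp hlam hlam' E hK0 le_rfl hz (P.ode y) (Q.ode z) (P.neg y) (Q.neg z) ?_
    have pa := P.gt1 y
    have pb := Q.gt1 z
    have na := P.neg y
    have nb := Q.neg z
    rcases le_total 0 x with hx | hx
    · obtain ⟨u0, u1, u2⟩ := f1 q t y ht1 htq (by rw [hy]; linarith)
      have up := mul_le_mul_of_nonneg_right (le_max_left C1 C2) E.le
      exact cross_bd hc.le hp1.le hD0 E.le (by linarith) (by linarith) (by linarith) (by linarith)
        (by linarith) (g1' y).1 (g1' y).2 (g2' z).1 (g2' z).2 x3 (u0.trans up) (u1.trans up)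
        (u2.trans up)
    · obtain ⟨u0, u1, u2⟩ := f2 q t z ht1 htq (by rw [hzz]; linarith)
      have up := mul_le_mul_of_nonneg_right (le_max_right C1 C2) E.le
      have := cross_bd (v2 := w2 z) (w2 := v2 y) hc.le hp1.le hD0 E.le (by linarith : 0 ≤ w z - 1)
        (by linarith : 0 ≤ v y - 1) (by linarith : 0 ≤ xi k a t - 1) (by linarith : 0 ≤ -w1 z)
        (by linarith : 0 ≤ -v1 y) (g2' z).1 (g2' z).2 (g1' y).1 (g1' y).2 x3 (u0.trans up)
        (u1.trans up) (u2.trans up)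
      rw [← hK] at this
      refine le_trans (le_of_eq ?_) (this.trans (le_of_eq ?_)) <;> ring
  have hsm : ∀ t ≤ τ, ContDiff ℝ ∞ (fun x => v (1 * x + th lam h q a t) +
      (w (-1 * x + th lam' h' q a t) + (xi k a t + -2))) := by
    intro t _
    have h1 := P.sm
    have h2 := Q.sm
    fun_prop
  have hloc : ∀ ρ : ℝ, ∃ M, ∀ x, |x| ≤ ρ → ∀ t ≤ τ,
      (fun x t => v (1 * x + th lam h q a t) +
        (w (-1 * x + th lam' h' q a t) + (xi k a t + -2))) x t ≤ M ∧
      |iteratedDeriv 1 (fun y => (fun x t => v (1 * x + th lam h q a t) +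
        (w (-1 * x + th lam' h' q a t) + (xi k a t + -2))) y t) x| ≤ M ∧
      |iteratedDeriv 2 (fun y => (fun x t => v (1 * x + th lam h q a t) +
        (w (-1 * x + th lam' h' q a t) + (xi k a t + -2))) y t) x| ≤ M ∧
      |iteratedDeriv 3 (fun y => (fun x t => v (1 * x + th lam h q a t) +
        (w (-1 * x + th lam' h' q a t) + (xi k a t + -2))) y t) x| ≤ M := by
    intro ρ
    obtain ⟨M1, hM1, m1⟩ := P.loc_bd (h - ρ)
    obtain ⟨M2, hM2, m2⟩ := Q.loc_bd (h' - ρ)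
    refine ⟨M1 + M2, fun x hx t ht => ?_⟩
    obtain ⟨ht1, hz, -, htq⟩ := hτ t ht
    rw [abs_le] at hx
    have a1 := th_ge (h := h) hlam ht1 htq
    have a2 := th_ge (h := h') hlam' ht1 htq
    obtain ⟨p0, p1, p2, p3⟩ := m1 (1 * x + th lam h q a t) (by linarith [hx.1])
    obtain ⟨q0, q1, q2, q3⟩ := m2 (-1 * x + th lam' h' q a t) (by linarith [hx.2])
    have i1 : iteratedDeriv 1 (fun y => v (1 * y + th lam h q a t) +
        (w (-1 * y + th lam' h' q a t) + (xi k a t + -2))) =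
        fun y => 1 * v1 (1 * y + th lam h q a t) + (-1 * w1 (-1 * y + th lam' h' q a t) + 0) := by
      funext y
      rw [iteratedDeriv_one]
      exact (BΦ.dx t ht y).deriv
    have i2 : iteratedDeriv 2 (fun y => v (1 * y + th lam h q a t) +
        (w (-1 * y + th lam' h' q a t) + (xi k a t + -2))) =
        fun y => 1 * (1 * v2 (1 * y + th lam h q a t)) +
          (-1 * (-1 * w2 (-1 * y + th lam' h' q a t)) + 0) := by
      funext y
      rw [iteratedDeriv_succ, i1]
      exact (BΦ.dxx t ht y).deriv
    have dl : ∀ (s c : ℝ) x, HasDerivAt (fun y => s * y + c) s x := fun s c x =>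
      (((hasDerivAt_id x).const_mul s).add_const c).congr_deriv (by simp)
    have i3 : iteratedDeriv 3 (fun y => v (1 * y + th lam h q a t) +
        (w (-1 * y + th lam' h' q a t) + (xi k a t + -2))) =
        fun y => v3 (1 * y + th lam h q a t) - w3 (-1 * y + th lam' h' q a t) := by
      funext y
      rw [iteratedDeriv_succ, i2]
      have e1 := (((P.d2 _).comp y (dl 1 (th lam h q a t) y)).const_mul 1).const_mul 1
      have e2 := ((((Q.d2 _).comp y (dl (-1) (th lam' h' q a t) y)).const_mul (-1)).const_mul
        (-1)).add_const 0
      refine ((e1.add e2).congr_deriv ?_).deriv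
      ring
    dsimp only
    refine ⟨?_, ?_, ?_, ?_⟩
    · linarith [(hxb t ht).2.1]
    · rw [i1]
      rw [abs_le] at *
      constructor <;> linarith [p1.1, p1.2, q1.1, q1.2]
    · rw [i2]
      rw [abs_le] at *
      constructor <;> linarith [p2.1, p2.2, q2.1, q2.2]
    · rw [i3]
      rw [abs_le] at *
      constructor <;> linarith [p3.1, p3.2, q3.1, q3.2]
  have solV : ∀ x t, p * (th' lam 0 a t * v1 (1 * x + th lam h 0 a t)) =
      NN p (v (1 * x + th lam h 0 a t)) (1 * v1 (1 * x + th lam h 0 a t))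
        (1 * (1 * v2 (1 * x + th lam h 0 a t))) := by
    intro x t
    rw [NN_one]
    have := P.ode (1 * x + th lam h 0 a t)
    unfold th'
    linarith
  have solW : ∀ x t, p * (th' lam' 0 a t * w1 (-1 * x + th lam' h' 0 a t)) =
      NN p (w (-1 * x + th lam' h' 0 a t)) (-1 * w1 (-1 * x + th lam' h' 0 a t))
        (-1 * (-1 * w2 (-1 * x + th lam' h' 0 a t))) := by
    intro x t
    rw [NN_neg]
    have := Q.ode (-1 * x + th lam' h' 0 a t)
    unfold th'
    linarith
  have solX : ∀ t, p * (a * (xi k a t ^ 2 - xi k a t)) = NN p (xi k a t + 0) 0 0 := by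
    intro t
    unfold NN
    rw [ha]; field_simp; ring
  obtain ⟨F, F1, F2, F3, F4, F5⟩ := ancient_abstract (ι := Option Bool) hp BΦ hsm hge hsup
    (φ := fun i => match i with
      | none => fun _ t => xi k a t + 0
      | some true => fun x t => v (1 * x + th lam h 0 a t)
      | some false => fun x t => w (-1 * x + th lam' h' 0 a t))
    (φt := fun i => match i with
      | none => fun _ t => a * (xi k a t ^ 2 - xi k a t)
      | some true => fun x t => th' lam 0 a t * v1 (1 * x + th lam h 0 a t)
      | some false => fun x t => th' lam' 0 a t * w1 (-1 * x + th lam' h' 0 a t))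
    (φx := fun i => match i with
      | none => fun _ _ => 0
      | some true => fun x t => 1 * v1 (1 * x + th lam h 0 a t)
      | some false => fun x t => -1 * w1 (-1 * x + th lam' h' 0 a t))
    (φxx := fun i => match i with
      | none => fun _ _ => 0
      | some true => fun x t => 1 * (1 * v2 (1 * x + th lam h 0 a t))
      | some false => fun x t => -1 * (-1 * w2 (-1 * x + th lam' h' 0 a t)))
    (by
      rintro (_ | _ | _)
      · exact bX
      · exact bW
      · exact bV)
    (by
      rintro (_ | _ | _) x t ht
      · exact solX t
      · exact solW x t
      · exact solV x t)
    (by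
      rintro (_ | _ | _) x t ht
      · have := P.gt1 (1 * x + th lam h q a t)
        have := Q.gt1 (-1 * x + th lam' h' q a t)
        dsimp only; linarith
      · have := P.gt1 (1 * x + th lam h q a t)
        have := antiW (add_le_add_right (thle (hh := h') hlam' ht) (-1 * x))
        have := (hxb t ht).1
        dsimp only; linarith
      · have := Q.gt1 (-1 * x + th lam' h' q a t)
        have := antiV (add_le_add_right (thle (hh := h) hlam ht) (1 * x))
        have := (hxb t ht).1
        dsimp only; linarith)
    hloc
  refine ⟨F, F1, F2, F3, F4, fun x t ht => ?_⟩
  obtain ⟨r1, r2, r3⟩ := F5 x t ht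
  have r4 := r3 none
  dsimp only at r4
  exact ⟨r1, r2, r3 (some true), r3 (some false), by linarith⟩

theorem ancient_final (n : ℕ) (hn : 3 ≤ n) (p : ℝ)
    (hp : p = ((n : ℝ) + 2) / ((n : ℝ) - 2))
    (lam lam' h h' k : ℝ) (hlam : 1 < lam) (hlam' : 1 < lam') (hk : 0 ≤ k)
    (v v' : ℝ → ℝ)
    (hv : IsTravelingWaveProfile p lam v) (hv' : IsTravelingWaveProfile p lam' v') :
    ∃ q : ℝ, 0 < q ∧ ∃ τ₀ : ℝ, τ₀ < 0 ∧ ∃ u : ℝ → ℝ → ℝ,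
      (∀ x τ : ℝ, τ ≤ τ₀ → 0 < u x τ) ∧
      (∀ τ : ℝ, τ ≤ τ₀ → ContDiff ℝ 2 fun x => u x τ) ∧
      (∀ x τ : ℝ, τ ≤ τ₀ → DifferentiableAt ℝ (fun s => u x s) τ) ∧
      (∀ x : ℝ, ContinuousOn (fun τ => deriv (fun s => u x s) τ) (Set.Iic τ₀)) ∧
      (∀ x τ : ℝ, τ ≤ τ₀ →
        p * deriv (fun s => u x s) τ =
          u x τ * deriv (deriv fun y => u y τ) x
            - p / (p - 1) * (deriv (fun y => u y τ) x) ^ 2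
            + (p - 1) * ((u x τ) ^ 2 - u x τ)) ∧
      (∀ x τ : ℝ, τ ≤ τ₀ →
        max (max (v (x - lam * τ + h)) (1 / (1 - k * Real.exp ((p - 1) / p * τ))))
            (v' (-x - lam' * τ + h')) ≤ u x τ ∧
        u x τ ≤ v (x - lam * τ * (1 - q * Real.exp ((p - 1) / p * τ)) + h)
            + v' (-x - lam' * τ * (1 - q * Real.exp ((p - 1) / p * τ)) + h')
            + 1 / (1 - k * Real.exp ((p - 1) / p * τ)) - 2) := by
  have hp1 : 1 < p := by
    have hn' : (3:ℝ) ≤ n := by exact_mod_cast hn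
    rw [hp, lt_div_iff₀ (by linarith)]; linarith
  obtain ⟨q, hq, τ, hτ, F, F1, F2, F3, F4, F5⟩ := ancient_main (h := h) (h' := h') hp1 hlam hlam' hk
    (profile_facts hp1 hlam hv) (profile_facts hp1 hlam' hv')
  have hlt : ∀ {t}, t ≤ τ - 1 → t < τ := fun ht => by linarith
  refine ⟨q, hq, τ - 1, by linarith, F 0, ?_, ?_, ?_, ?_, ?_, ?_⟩
  · intro x t ht
    linarith [(F5 x t (hlt ht).le).1]
  · exact fun t ht => F1 t (hlt ht).le
  · exact fun x t ht => (F3 t (hlt ht) x).differentiableAt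
  · intro x
    refine ((F4 x).mono fun t ht => hlt ht).congr fun t ht => ?_
    exact (F3 t (hlt ht) x).deriv
  · intro x t ht
    rw [(F3 t (hlt ht) x).deriv, (F2 t (hlt ht).le x).1, (F2 t (hlt ht).le x).2]
    have : p ≠ 0 := by linarith
    rw [mul_div_cancel₀ _ this]
    rfl
  · intro x t ht
    obtain ⟨-, r2, r3, r4, r5⟩ := F5 x t (hlt ht).le
    unfold th at r2 r3 r4
    unfold xi at r2 r5
    have e1 : 1 * x + (-(lam * t * (1 - q * Real.exp ((p - 1) / p * t))) + h) =
      x - lam * t * (1 - q * Real.exp ((p - 1) / p * t)) + h := by ring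
    have e2 : -1 * x + (-(lam' * t * (1 - q * Real.exp ((p - 1) / p * t))) + h') =
      -x - lam' * t * (1 - q * Real.exp ((p - 1) / p * t)) + h' := by ring
    have e3 : 1 * x + (-(lam * t * (1 - 0 * Real.exp ((p - 1) / p * t))) + h) =
      x - lam * t + h := by ring
    have e4 : -1 * x + (-(lam' * t * (1 - 0 * Real.exp ((p - 1) / p * t))) + h') =
      -x - lam' * t + h' := by ring
    rw [e1, e2] at r2
    rw [e3] at r3
    rw [e4] at r4
    exact ⟨max_le (max_le r3 r5) r4, by linarith⟩

end

/-- for `n ≥ 3`, `p = (n+2)/(n−2)`, `λ, λ' > 1`, `h, h' ∈ ℝ`, `k ≥ 0`,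
there are `q > 0`, `τ₀ < 0` and a positive ancient solution `u` of the pressure equation
`p u_τ = u u_xx − (p/(p−1)) u_x² + (p−1)(u² − u)` on `ℝ × (−∞, τ₀]`, C² in `x` and
C¹ in `τ`, sandwiched between
`max(v_λ(x−λτ+h), ξ_k(τ), v_{λ'}(−x−λ'τ+h'))` and
`v_λ(x−λτ(1−q e^{aτ})+h) + v_{λ'}(−x−λ'τ(1−q e^{aτ})+h') + ξ_k(τ) − 2`,
where `a = (p−1)/p` and `ξ_k(τ) = 1/(1 − k e^{aτ})`. -/
theorem ancient_solution_exists (n : ℕ) (hn : 3 ≤ n) (p : ℝ)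
    (hp : p = ((n : ℝ) + 2) / ((n : ℝ) - 2))
    (lam lam' h h' k : ℝ) (hlam : 1 < lam) (hlam' : 1 < lam') (hk : 0 ≤ k)
    (v v' : ℝ → ℝ)
    (hv : IsTravelingWaveProfile p lam v) (hv' : IsTravelingWaveProfile p lam' v') :
    ∃ q : ℝ, 0 < q ∧ ∃ τ₀ : ℝ, τ₀ < 0 ∧ ∃ u : ℝ → ℝ → ℝ,
      (∀ x τ : ℝ, τ ≤ τ₀ → 0 < u x τ) ∧
      (∀ τ : ℝ, τ ≤ τ₀ → ContDiff ℝ 2 fun x => u x τ) ∧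
      (∀ x τ : ℝ, τ ≤ τ₀ → DifferentiableAt ℝ (fun s => u x s) τ) ∧
      (∀ x : ℝ, ContinuousOn (fun τ => deriv (fun s => u x s) τ) (Set.Iic τ₀)) ∧
      (∀ x τ : ℝ, τ ≤ τ₀ →
        p * deriv (fun s => u x s) τ =
          u x τ * deriv (deriv fun y => u y τ) x
            - p / (p - 1) * (deriv (fun y => u y τ) x) ^ 2
            + (p - 1) * ((u x τ) ^ 2 - u x τ)) ∧
      (∀ x τ : ℝ, τ ≤ τ₀ →
        max (max (v (x - lam * τ + h)) (1 / (1 - k * Real.exp ((p - 1) / p * τ))))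
            (v' (-x - lam' * τ + h')) ≤ u x τ ∧
        u x τ ≤ v (x - lam * τ * (1 - q * Real.exp ((p - 1) / p * τ)) + h)
            + v' (-x - lam' * τ * (1 - q * Real.exp ((p - 1) / p * τ)) + h')
            + 1 / (1 - k * Real.exp ((p - 1) / p * τ)) - 2) := by
  exact ancient_final n hn p hp lam lam' h h' k hlam hlam' hk v v' hv hv'
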